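/- (Orientational long-range order on the torus) Suppose J₁ = J₂ > 0. Then for each δ > 0 there exist β₀ = β₀(δ) < ∞ and a sequence (ε_N) with ε_N → 0 as N → ∞ such that for every β ≥ β₀ and for both components α = x and α = z, the torus Gibbs measure satisfies μ_{N,β}( Σ_{r∈T_N} (S_r^α)² ≥ N²(1 − δ) ) ≥ 1/2 − ε_N for all sufficiently large even N. -/

import Mathlib

open scoped BigOperators
open MeasureTheory

/-- The `N × N` torus `(ℤ/Nℤ)²`. -/
abbrev Torus (N : ℕ) := ZMod N × ZMod N

instance : Fact (0 < 2 * Real.pi) := ⟨by positivity⟩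

noncomputable instance : MeasureSpace Real.Angle :=
  inferInstanceAs (MeasureSpace (AddCircle (2 * Real.pi)))

/-- Configurations of unit spins parametrized by their angles. -/
abbrev Cfg (N : ℕ) := Torus N → Real.Angle

/-- The unit spin `(S^x, S^z)` with angle `φ`. -/
noncomputable def spinOf (φ : Real.Angle) : ℝ × ℝ := (φ.cos, φ.sin)

/-- The plaquette-orbital Hamiltonian on the torus (spins as unit vectors). -/
noncomputable def ham (N : ℕ) [NeZero N] (J₁ J₂ : ℝ) (S : Torus N → ℝ × ℝ) : ℝ :=
  - J₁ * ((∑ r : Torus N, if Even r.1.val then (S r).1 * (S (r + (1, 0))).1 else 0)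
        + (∑ r : Torus N, if Even r.2.val then (S r).1 * (S (r + (0, 1))).1 else 0))
  - J₂ * ((∑ r : Torus N, if ¬ Even r.1.val then (S r).2 * (S (r + (1, 0))).2 else 0)
        + (∑ r : Torus N, if ¬ Even r.2.val then (S r).2 * (S (r + (0, 1))).2 else 0))

/-- The Hamiltonian as a function of the angles. -/
noncomputable def hamA (N : ℕ) [NeZero N] (J₁ J₂ : ℝ) (φ : Cfg N) : ℝ :=
  ham N J₁ J₂ fun r => spinOf (φ r)

/-- The a priori product measure: each site carries the uniform measure on the
circle normalized to total mass `√(2π)`. -/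
noncomputable def apriori (N : ℕ) [NeZero N] : Measure (Cfg N) :=
  (ENNReal.ofReal (Real.sqrt (2 * Real.pi) / (2 * Real.pi))) ^ (N ^ 2) •
    Measure.pi (fun _ : Torus N => (volume : Measure Real.Angle))

/-- The partition function `Z_{N,β}`. -/
noncomputable def Zfull (N : ℕ) [NeZero N] (β J₁ J₂ : ℝ) : ℝ :=
  ∫ φ, Real.exp (-β * hamA N J₁ J₂ φ) ∂(apriori N)

/-- The torus Gibbs measure `μ_{N,β}`, with density proportional to `e^{−βH_N}`
with respect to the a priori measure. -/
noncomputable def gibbs (N : ℕ) [NeZero N] (β J₁ J₂ : ℝ) : Measure (Cfg N) :=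
  (ENNReal.ofReal (Zfull N β J₁ J₂))⁻¹ •
    (apriori N).withDensity fun φ => ENNReal.ofReal (Real.exp (-β * hamA N J₁ J₂ φ))

set_option linter.unusedSectionVars false

/-- A function on a finite set that satisfies a reflection inequality lowering the defect count
is dominated by its values at defect-free points. -/
theorem exists_defect_free_ge {P : Type*} [Finite P] (ψ : P → ℝ) (h0 : ∀ p, 0 ≤ ψ p)
    (d : P → ℕ)
    (h : ∀ p, 0 < d p → ∃ p₁ p₂, ψ p ^ 2 ≤ ψ p₁ * ψ p₂ ∧ d p₁ + d p₂ < 2 * d p) (p : P) :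
    ∃ p₀, d p₀ = 0 ∧ ψ p ≤ ψ p₀ := by
  have : Nonempty P := ⟨p⟩
  obtain ⟨q, hq⟩ := Finite.exists_max ψ
  have hne : {x | ψ x = ψ q}.Nonempty := ⟨q, rfl⟩
  obtain ⟨x, hx, hmin⟩ := Set.exists_min_image {x | ψ x = ψ q} d (Set.toFinite _) hne
  refine ⟨x, ?_, by rw [hx]; exact hq p⟩
  by_contra hd
  obtain ⟨p₁, p₂, h1, h2⟩ := h x (Nat.pos_of_ne_zero hd)
  rw [hx] at h1
  have key : ψ p₁ = ψ q ∧ ψ p₂ = ψ q := by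
    rcases (h0 q).eq_or_lt with hz | hpos
    · exact ⟨le_antisymm (hq _) (hz ▸ h0 _), le_antisymm (hq _) (hz ▸ h0 _)⟩
    · constructor <;> apply le_antisymm (hq _)
      · nlinarith [mul_le_mul_of_nonneg_left (hq p₂) (h0 p₁)]
      · nlinarith [mul_le_mul_of_nonneg_right (hq p₁) (h0 p₂)]
  have a1 := hmin p₁ key.1
  have a2 := hmin p₂ key.2
  omega

/-- Two independent configurations, one of them reflected, glue to a configuration with the same
product law. -/
theorem measurePreserving_glue {V X : Type*} [Fintype V] [MeasurableSpace X] (μ : Measure X)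
    [IsProbabilityMeasure μ] (ρ : V → V) (hρ : Function.Involutive ρ) (L : V → Prop)
    [DecidablePred L] (hL : ∀ r, L (ρ r) ↔ ¬ L r) :
    MeasurePreserving
      (fun p : (V → X) × (V → X) => fun r => if L r then p.1 r else p.2 (ρ r))
      ((Measure.pi fun _ => μ).prod (Measure.pi fun _ => μ)) (Measure.pi fun _ : V => μ) := by
  have hm : Measurable
      (fun p : (V → X) × (V → X) => fun r => if L r then p.1 r else p.2 (ρ r)) := by
    refine measurable_pi_lambda _ fun r => ?_
    by_cases hr : L r
    · simp only [hr, if_true]; fun_prop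
    · simp only [hr, if_false]; fun_prop
  refine ⟨hm, (Measure.pi_eq fun s hs => ?_).symm⟩
  rw [Measure.map_apply hm (MeasurableSet.univ_pi hs)]
  have : (fun p : (V → X) × (V → X) => fun r => if L r then p.1 r else p.2 (ρ r)) ⁻¹'
      (Set.univ.pi s) = (Set.univ.pi fun r => if L r then s r else Set.univ) ×ˢ
        (Set.univ.pi fun r => if L r then s (ρ r) else Set.univ) := by
    ext p
    simp only [Set.mem_preimage, Set.mem_pi, Set.mem_univ, true_implies, Set.mem_prod]
    constructor
    · intro h
      refine ⟨fun r => ?_, fun r => ?_⟩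
      · by_cases hr : L r
        · simpa [hr] using h r
        · simp [hr]
      · by_cases hr : L r
        · have := h (ρ r)
          simp only [hL, hr, not_true, if_false, hρ r] at this
          simpa [hr] using this
        · simp [hr]
    · rintro ⟨h1, h2⟩ r
      by_cases hr : L r
      · simpa [hr] using h1 r
      · have := h2 (ρ r)
        simp only [hL, hr, not_false_eq_true, if_true, hρ r] at this
        simpa [hr] using this
  rw [this, Measure.prod_prod, Measure.pi_pi, Measure.pi_pi,
    ← Equiv.prod_comp hρ.toPerm (fun r => μ (if L r then s (ρ r) else Set.univ)),
    ← Finset.prod_mul_distrib]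
  refine Finset.prod_congr rfl fun r _ => ?_
  by_cases hr : L r
  · simp [hr, hL]
  · simp [hr, hL, hρ r]

theorem sq_le_mul_of_forall_weighted {Q a b : ℝ} (ha : 0 ≤ a) (hb : 0 ≤ b)
    (h : ∀ t : ℝ, 0 < t → 2 * |Q| ≤ t * a + b / t) : Q ^ 2 ≤ a * b := by
  by_contra hlt
  push Not at hlt
  have hQ : 0 < |Q| := by
    rw [abs_pos]; rintro rfl; nlinarith [mul_nonneg ha hb]
  rw [← sq_abs] at hlt
  rcases ha.eq_or_lt with rfl | ha'
  · have := h ((b + 1) / |Q|) (by positivity)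
    rw [div_div_eq_mul_div, mul_zero, zero_add, le_div_iff₀ (by positivity)] at this
    nlinarith [mul_nonneg hb hQ.le]
  · have := h (|Q| / a) (by positivity)
    rw [div_mul_cancel₀ _ ha'.ne', div_div_eq_mul_div, ← sub_le_iff_le_add', le_div_iff₀ hQ] at this
    nlinarith

section CauchySchwarz

variable {Y Ω : Type*} [MeasurableSpace Y] [MeasurableSpace Ω] (m : Measure Y)
  [IsProbabilityMeasure m] (γ : Measure Ω) [IsProbabilityMeasure γ]

theorem integral_kernel_eq (θ : Ω → Y → ℝ) (hθ : Measurable (Function.uncurry θ)) (w : Ω → ℝ)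
    (hw : Measurable w) (C : ℝ) (hw0 : ∀ k, 0 ≤ w k) (hwC : ∀ k, w k ≤ C) (F G : Y → ℝ)
    (hF : Measurable F) (hG : Measurable G) (hF0 : ∀ y, 0 ≤ F y) (hF1 : ∀ y, F y ≤ 1)
    (hG0 : ∀ y, 0 ≤ G y) (hG1 : ∀ y, G y ≤ 1) :
    ∫ p, F p.1 * G p.2 * (∫ k, w k * Real.cos (θ k p.1 - θ k p.2) ∂γ) ∂(m.prod m) =
      ∫ k, w k * ((∫ y, F y * Real.cos (θ k y) ∂m) * (∫ y, G y * Real.cos (θ k y) ∂m) +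
        (∫ y, F y * Real.sin (θ k y) ∂m) * (∫ y, G y * Real.sin (θ k y) ∂m)) ∂γ := by
  have hθk : ∀ k, Measurable (θ k) := fun k => hθ.comp measurable_prodMk_left
  have hθ1 : Measurable fun q : (Y × Y) × Ω => θ q.2 q.1.1 :=
    hθ.comp (measurable_snd.prodMk (measurable_fst.comp measurable_fst))
  have hθ2 : Measurable fun q : (Y × Y) × Ω => θ q.2 q.1.2 :=
    hθ.comp (measurable_snd.prodMk (measurable_snd.comp measurable_fst))
  have hpull : ∀ p : Y × Y, F p.1 * G p.2 * (∫ k, w k * Real.cos (θ k p.1 - θ k p.2) ∂γ) =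
      ∫ k, F p.1 * G p.2 * (w k * Real.cos (θ k p.1 - θ k p.2)) ∂γ :=
    fun p => (integral_const_mul _ _).symm
  simp_rw [hpull]
  rw [integral_integral_swap]
  · refine integral_congr_ae (Filter.Eventually.of_forall fun k => ?_)
    have hint : ∀ H : Y → ℝ, Measurable H → (∀ y, 0 ≤ H y) → (∀ y, H y ≤ 1) → ∀ g : ℝ → ℝ,
        Measurable g → (∀ x, |g x| ≤ 1) → Integrable (fun y => H y * g (θ k y)) m := by
      intro H hH h0 h1 g hg hg1
      refine Integrable.of_bound (C := 1)
        (hH.mul (hg.comp (hθk k))).aestronglyMeasurable (Filter.Eventually.of_forall fun y => ?_)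
      rw [Real.norm_eq_abs, abs_mul, abs_of_nonneg (h0 y)]
      exact mul_le_one₀ (h1 y) (abs_nonneg _) (hg1 _)
    have hc := fun H hH h0 h1 =>
      hint H hH h0 h1 Real.cos Real.measurable_cos Real.abs_cos_le_one
    have hs := fun H hH h0 h1 =>
      hint H hH h0 h1 Real.sin Real.measurable_sin Real.abs_sin_le_one
    simp only
    rw [mul_add, ← integral_prod_mul, ← integral_prod_mul, ← integral_const_mul,
      ← integral_const_mul, ← integral_add]
    · refine integral_congr_ae (Filter.Eventually.of_forall fun p => ?_)
      simp only [Real.cos_sub]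
      ring
    · exact ((hc F hF hF0 hF1).mul_prod (hc G hG hG0 hG1)).const_mul _
    · exact ((hs F hF hF0 hF1).mul_prod (hs G hG hG0 hG1)).const_mul _
  · refine Integrable.of_bound (C := C) ?_ (Filter.Eventually.of_forall fun q => ?_)
    · refine Measurable.aestronglyMeasurable ?_
      exact ((hF.comp (measurable_fst.comp measurable_fst)).mul
        (hG.comp (measurable_snd.comp measurable_fst))).mul
        ((hw.comp measurable_snd).mul (Real.measurable_cos.comp (hθ1.sub hθ2)))
    · simp only [Function.uncurry, Real.norm_eq_abs, abs_mul, abs_of_nonneg (hF0 _),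
        abs_of_nonneg (hG0 _), abs_of_nonneg (hw0 _)]
      have e1 : F q.1.1 * G q.1.2 ≤ 1 := mul_le_one₀ (hF1 _) (hG0 _) (hG1 _)
      have e2 : w q.2 * |Real.cos (θ q.2 q.1.1 - θ q.2 q.1.2)| ≤ C * 1 :=
        mul_le_mul (hwC _) (Real.abs_cos_le_one _) (abs_nonneg _) ((hw0 q.2).trans (hwC _))
      calc _ ≤ 1 * (C * 1) := mul_le_mul e1 e2
            (mul_nonneg (hw0 _) (abs_nonneg _)) zero_le_one
        _ = C := by ring

/-- Reflection positivity as a Cauchy–Schwarz inequality for kernels with a nonnegative spectral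
weight; a spectral weight bounded by `C` costs at most `C` relative to the unit weight. -/
theorem sq_integral_kernel_le (θ : Ω → Y → ℝ) (hθ : Measurable (Function.uncurry θ)) (w : Ω → ℝ)
    (hw : Measurable w) (C : ℝ) (hw0 : ∀ k, 0 ≤ w k) (hwC : ∀ k, w k ≤ C) (F G : Y → ℝ)
    (hF : Measurable F) (hG : Measurable G) (hF0 : ∀ y, 0 ≤ F y) (hF1 : ∀ y, F y ≤ 1)
    (hG0 : ∀ y, 0 ≤ G y) (hG1 : ∀ y, G y ≤ 1) :
    (∫ p, F p.1 * G p.2 * (∫ k, w k * Real.cos (θ k p.1 - θ k p.2) ∂γ) ∂(m.prod m)) ^ 2 ≤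
      C ^ 2 * ((∫ p, F p.1 * F p.2 * (∫ k, Real.cos (θ k p.1 - θ k p.2) ∂γ) ∂(m.prod m)) *
        (∫ p, G p.1 * G p.2 * (∫ k, Real.cos (θ k p.1 - θ k p.2) ∂γ) ∂(m.prod m))) := by
  have hone := fun (H : Y → ℝ) hH h0 h1 => integral_kernel_eq m γ θ hθ (fun _ => 1)
    measurable_const 1 (fun _ => zero_le_one) (fun _ => le_rfl) H H hH hH h0 h1 h0 h1
  simp only [one_mul] at hone
  rw [hone F hF hF0 hF1, hone G hG hG0 hG1,
    integral_kernel_eq m γ θ hθ w hw C hw0 hwC F G hF hG hF0 hF1 hG0 hG1]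
  set Fc : Ω → ℝ := fun k => ∫ y, F y * Real.cos (θ k y) ∂m with hFc
  set Fs : Ω → ℝ := fun k => ∫ y, F y * Real.sin (θ k y) ∂m with hFs
  set Gc : Ω → ℝ := fun k => ∫ y, G y * Real.cos (θ k y) ∂m with hGc
  set Gs : Ω → ℝ := fun k => ∫ y, G y * Real.sin (θ k y) ∂m with hGs
  have hmeas : ∀ H : Y → ℝ, Measurable H → ∀ g : ℝ → ℝ, Measurable g →
      AEStronglyMeasurable (fun k => ∫ y, H y * g (θ k y) ∂m) γ := by
    intro H hH g hg
    have : StronglyMeasurable (Function.uncurry fun (k : Ω) (y : Y) => H y * g (θ k y)) :=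
      ((hH.comp measurable_snd).mul (hg.comp hθ)).stronglyMeasurable
    exact (this.integral_prod_right (ν := m)).aestronglyMeasurable
  have hbd : ∀ H : Y → ℝ, (∀ y, 0 ≤ H y) → (∀ y, H y ≤ 1) → ∀ g : ℝ → ℝ,
      (∀ x, |g x| ≤ 1) → ∀ k, |∫ y, H y * g (θ k y) ∂m| ≤ 1 := by
    intro H h0 h1 g hg k
    have := norm_integral_le_of_norm_le_const (μ := m) (C := 1) (f := fun y => H y * g (θ k y))
      (Filter.Eventually.of_forall fun y => by
        rw [Real.norm_eq_abs, abs_mul, abs_of_nonneg (h0 y)]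
        exact mul_le_one₀ (h1 y) (abs_nonneg _) (hg _))
    simpa using this
  have hint2 : ∀ u v : Ω → ℝ, AEStronglyMeasurable u γ → AEStronglyMeasurable v γ →
      (∀ k, |u k| ≤ 1) → (∀ k, |v k| ≤ 1) → Integrable (fun k => u k * v k) γ := by
    intro u v hu hv hu1 hv1
    refine Integrable.of_bound (C := 1) (hu.mul hv) (Filter.Eventually.of_forall fun k => ?_)
    rw [Real.norm_eq_abs, abs_mul]
    exact mul_le_one₀ (hu1 k) (abs_nonneg _) (hv1 k)
  have mFc : AEStronglyMeasurable Fc γ := hmeas F hF _ Real.measurable_cos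
  have mFs : AEStronglyMeasurable Fs γ := hmeas F hF _ Real.measurable_sin
  have mGc : AEStronglyMeasurable Gc γ := hmeas G hG _ Real.measurable_cos
  have mGs : AEStronglyMeasurable Gs γ := hmeas G hG _ Real.measurable_sin
  have bFc : ∀ k, |Fc k| ≤ 1 := hbd F hF0 hF1 _ Real.abs_cos_le_one
  have bFs : ∀ k, |Fs k| ≤ 1 := hbd F hF0 hF1 _ Real.abs_sin_le_one
  have bGc : ∀ k, |Gc k| ≤ 1 := hbd G hG0 hG1 _ Real.abs_cos_le_one
  have bGs : ∀ k, |Gs k| ≤ 1 := hbd G hG0 hG1 _ Real.abs_sin_le_one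
  have iF : Integrable (fun k => Fc k * Fc k + Fs k * Fs k) γ :=
    (hint2 Fc Fc mFc mFc bFc bFc).add (hint2 Fs Fs mFs mFs bFs bFs)
  have iG : Integrable (fun k => Gc k * Gc k + Gs k * Gs k) γ :=
    (hint2 Gc Gc mGc mGc bGc bGc).add (hint2 Gs Gs mGs mGs bGs bGs)
  by_cases hΩ : IsEmpty Ω
  · have : γ = 0 := Measure.eq_zero_of_isEmpty γ
    exact absurd this (IsProbabilityMeasure.ne_zero γ)
  have hC : 0 ≤ C := by
    rw [not_isEmpty_iff] at hΩ
    obtain ⟨k⟩ := hΩ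
    exact (hw0 k).trans (hwC k)
  have nF : 0 ≤ ∫ k, (Fc k * Fc k + Fs k * Fs k) ∂γ :=
    integral_nonneg fun k => add_nonneg (mul_self_nonneg _) (mul_self_nonneg _)
  have nG : 0 ≤ ∫ k, (Gc k * Gc k + Gs k * Gs k) ∂γ :=
    integral_nonneg fun k => add_nonneg (mul_self_nonneg _) (mul_self_nonneg _)
  have := sq_le_mul_of_forall_weighted (Q := ∫ k, w k * (Fc k * Gc k + Fs k * Gs k) ∂γ)
    (mul_nonneg hC nF) (mul_nonneg hC nG) ?_
  · calc _ ≤ _ := this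
      _ = _ := by ring
  intro t ht
  have hle : |∫ k, w k * (Fc k * Gc k + Fs k * Gs k) ∂γ| ≤
      ∫ k, (C * t / 2 * (Fc k * Fc k + Fs k * Fs k) +
        C / t / 2 * (Gc k * Gc k + Gs k * Gs k)) ∂γ := by
    refine (abs_integral_le_integral_abs).trans ?_
    refine integral_mono_of_nonneg (Filter.Eventually.of_forall fun k => abs_nonneg _)
      ((iF.const_mul _).add (iG.const_mul _)) (Filter.Eventually.of_forall fun k => ?_)
    simp only
    rw [abs_mul, abs_of_nonneg (hw0 k)]
    have h1 : ∀ x y : ℝ, |x * y| ≤ t / 2 * (x * x) + 1 / t / 2 * (y * y) := by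
      intro x y
      have e : t / 2 * (x * x) + 1 / t / 2 * (y * y) - |x * y| =
          (t * |x| - |y|) ^ 2 / (2 * t) := by
        rw [abs_mul]
        field_simp
        rw [sub_sq, mul_pow, sq_abs, sq_abs]
        ring
      have : 0 ≤ (t * |x| - |y|) ^ 2 / (2 * t) := by positivity
      linarith
    calc w k * |Fc k * Gc k + Fs k * Gs k|
        ≤ C * (|Fc k * Gc k| + |Fs k * Gs k|) :=
          mul_le_mul (hwC k) (abs_add_le _ _) (abs_nonneg _) hC
      _ ≤ C * ((t / 2 * (Fc k * Fc k) + 1 / t / 2 * (Gc k * Gc k)) +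
            (t / 2 * (Fs k * Fs k) + 1 / t / 2 * (Gs k * Gs k))) := by
          gcongr <;> exact h1 _ _
      _ = _ := by ring
  rw [integral_add (iF.const_mul _) (iG.const_mul _), integral_const_mul, integral_const_mul] at hle
  calc _ ≤ 2 * _ := mul_le_mul_of_nonneg_left hle zero_le_two
    _ = _ := by ring

end CauchySchwarz

/-- The Gaussian bond weight, at half strength when `h` holds. -/
noncomputable def gaussKer (lam : ℝ) (h : Prop) [Decidable h] (u : ℝ) : ℝ :=
  Real.exp (-(if h then lam / 2 else lam) * u ^ 2)

/-- Spectral density of the bond weight relative to that of the full-strength weight. -/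
noncomputable def specDensity (lam : ℝ) (h : Prop) [Decidable h] (k : ℝ) : ℝ :=
  if h then √2 * Real.exp (-(k ^ 2) / (4 * lam)) else 1

theorem specDensity_nonneg (lam : ℝ) (h : Prop) [Decidable h] (k : ℝ) :
    0 ≤ specDensity lam h k := by
  unfold specDensity; split_ifs <;> positivity

theorem specDensity_le {lam : ℝ} (hl : 0 < lam) (h : Prop) [Decidable h] (k : ℝ) :
    specDensity lam h k ≤ if h then √2 else 1 := by
  unfold specDensity
  split_ifs
  · refine mul_le_of_le_one_right (Real.sqrt_nonneg _) (Real.exp_le_one_iff.2 ?_)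
    exact div_nonpos_of_nonpos_of_nonneg (by nlinarith [sq_nonneg k]) (by positivity)
  · exact le_rfl

theorem measurable_specDensity (lam : ℝ) (h : Prop) [Decidable h] :
    Measurable (specDensity lam h) := by
  unfold specDensity
  split_ifs <;> fun_prop

theorem measurable_gaussKer (lam : ℝ) (h : Prop) [Decidable h] :
    Measurable (gaussKer lam h) := by
  unfold gaussKer
  fun_prop

theorem gaussKer_pos (lam : ℝ) (h : Prop) [Decidable h] (u : ℝ) : 0 < gaussKer lam h u :=
  Real.exp_pos _

theorem gaussKer_le_one {lam : ℝ} (hl : 0 < lam) (h : Prop) [Decidable h] (u : ℝ) :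
    gaussKer lam h u ≤ 1 := by
  refine Real.exp_le_one_iff.2 ?_
  split_ifs <;> nlinarith [mul_nonneg hl.le (sq_nonneg u)]

theorem gaussKer_zero (lam : ℝ) (h : Prop) [Decidable h] : gaussKer lam h 0 = 1 := by
  simp [gaussKer]

theorem gaussKer_neg (lam : ℝ) (h : Prop) [Decidable h] (u : ℝ) :
    gaussKer lam h (-u) = gaussKer lam h u := by
  simp [gaussKer]

theorem gaussKer_congr (lam : ℝ) {h h' : Prop} [Decidable h] [Decidable h'] (hh : h ↔ h')
    (u : ℝ) : gaussKer lam h u = gaussKer lam h' u := by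
  simp only [gaussKer, hh]

theorem integral_specDensity_mul_cexp {lam : ℝ} (hl : 0 < lam) (h : Prop) [Decidable h] (u : ℝ) :
    ∫ k, (specDensity lam h k : ℂ) * Complex.exp (u * k * Complex.I)
      ∂(ProbabilityTheory.gaussianReal 0 (2 * lam).toNNReal) = (gaussKer lam h u : ℂ) := by
  have hchar : ∀ v : ℝ, 0 < v → ∫ k : ℝ, Complex.exp (u * k * Complex.I)
      ∂(ProbabilityTheory.gaussianReal 0 v.toNNReal) = Complex.exp (-(v * u ^ 2 / 2)) := by
    intro v hv
    rw [← charFun_apply_real, ProbabilityTheory.charFun_gaussianReal]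
    have : (((v.toNNReal : NNReal) : ℝ) : ℂ) = (v : ℂ) := by
      rw [Real.coe_toNNReal _ hv.le]
    rw [this]
    simp
  by_cases hh : h
  · simp only [specDensity, gaussKer, hh, if_true]
    rw [ProbabilityTheory.integral_gaussianReal_eq_integral_smul (by simpa using hl)]
    have h2 := hchar lam hl
    rw [ProbabilityTheory.integral_gaussianReal_eq_integral_smul (by simpa using hl)] at h2
    have hpdf : ∀ k : ℝ, ProbabilityTheory.gaussianPDFReal 0 (2 * lam).toNNReal k *
        (√2 * Real.exp (-(k ^ 2) / (4 * lam))) =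
        ProbabilityTheory.gaussianPDFReal 0 lam.toNNReal k := by
      intro k
      simp only [ProbabilityTheory.gaussianPDFReal, Real.coe_toNNReal _ hl.le,
        Real.coe_toNNReal _ (by positivity : (0 : ℝ) ≤ 2 * lam), sub_zero]
      have e1 : √(2 * Real.pi * (2 * lam)) = √2 * √(2 * Real.pi * lam) := by
        rw [← Real.sqrt_mul zero_le_two]; congr 1; ring
      have e2 : Real.exp (-k ^ 2 / (2 * lam)) =
          Real.exp (-k ^ 2 / (2 * (2 * lam))) * Real.exp (-(k ^ 2) / (4 * lam)) := by
        rw [← Real.exp_add]; congr 1; field_simp; ring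
      rw [e1, e2]
      have : √2 ≠ 0 := by positivity
      field_simp
    calc _ = ∫ k : ℝ, ProbabilityTheory.gaussianPDFReal 0 lam.toNNReal k •
          Complex.exp (u * k * Complex.I) := by
          refine integral_congr_ae (Filter.Eventually.of_forall fun k => ?_)
          simp only [Complex.real_smul]
          rw [← hpdf k]
          push_cast
          ring
      _ = _ := by
        rw [h2]
        push_cast
        congr 1
        ring
  · simp only [specDensity, gaussKer, hh, if_false, Complex.ofReal_one, one_mul]
    rw [hchar _ (by positivity)]
    push_cast
    congr 1
    ring

/-- Joint spectral representation of a product of bond weights. -/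
theorem integral_prod_specDensity_mul_cos {E : Type*} [Fintype E] {lam : ℝ} (hl : 0 < lam)
    (b : E → Prop) [DecidablePred b] (u : E → ℝ) :
    ∫ k : E → ℝ, (∏ e, specDensity lam (b e) (k e)) * Real.cos (∑ e, k e * u e)
      ∂(Measure.pi fun _ => ProbabilityTheory.gaussianReal 0 (2 * lam).toNNReal) =
      ∏ e, gaussKer lam (b e) (u e) := by
  have h := integral_fintype_prod_eq_prod (𝕜 := ℂ)
    (fun e (k : ℝ) => (specDensity lam (b e) k : ℂ) * Complex.exp (u e * k * Complex.I))
    (μ := fun _ => ProbabilityTheory.gaussianReal 0 (2 * lam).toNNReal)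
  simp only [integral_specDensity_mul_cexp hl] at h
  rw [← Complex.ofReal_prod] at h
  have h' := congrArg Complex.re h
  rw [Complex.ofReal_re] at h'
  rw [← h']
  have hint : Integrable (fun k : E → ℝ => ∏ e, ((specDensity lam (b e) (k e) : ℂ) *
      Complex.exp (u e * k e * Complex.I)))
      (Measure.pi fun _ => ProbabilityTheory.gaussianReal 0 (2 * lam).toNNReal) := by
    refine Integrable.of_bound (C := ∏ e, if b e then √2 else 1) ?_
      (Filter.Eventually.of_forall fun k => ?_)
    · refine Measurable.aestronglyMeasurable (Finset.measurable_prod _ fun e _ => ?_)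
      have := measurable_specDensity lam (b e)
      fun_prop
    · rw [norm_prod]
      refine Finset.prod_le_prod (fun _ _ => norm_nonneg _) fun e _ => ?_
      rw [norm_mul, ← Complex.ofReal_mul, Complex.norm_exp_ofReal_mul_I, mul_one,
        Complex.norm_real, Real.norm_of_nonneg (specDensity_nonneg _ _ _)]
      exact specDensity_le hl _ _
  rw [show (∫ k : E → ℝ, ∏ e, ((specDensity lam (b e) (k e) : ℂ) *
      Complex.exp (u e * k e * Complex.I)) ∂_).re = ∫ k : E → ℝ, (∏ e, ((specDensity lam (b e) (k e) : ℂ) *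
      Complex.exp (u e * k e * Complex.I))).re ∂_ from (integral_re hint).symm]
  refine integral_congr_ae (Filter.Eventually.of_forall fun k => ?_)
  simp only
  rw [Finset.prod_mul_distrib, ← Complex.exp_sum, ← Complex.ofReal_prod, Complex.re_ofReal_mul]
  congr 1
  have : ∑ e, (u e : ℂ) * k e * Complex.I = ((∑ e, k e * u e : ℝ) : ℂ) * Complex.I := by
    push_cast
    rw [Finset.sum_mul]
    exact Finset.sum_congr rfl fun e _ => by ring
  rw [this, Complex.exp_ofReal_mul_I_re]

/-- A system of bonds `e` joining `src e` to `tgt e`, each comparing the observable `obs e`. -/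
structure BondSystem (V E X : Type*) where
  src : E → V
  tgt : E → V
  obs : E → X → ℝ

/-- A reflection of a bond system, exchanging the half `L` and its complement, with bonds across
the reflection line joining mirror images. -/
structure Mirror {V E X : Type*} (S : BondSystem V E X) where
  ρ : V → V
  τ : E → E
  L : Finset V
  ρ_invol : Function.Involutive ρ
  τ_invol : Function.Involutive τ
  mem_L : ∀ r, ρ r ∈ L ↔ r ∉ L
  obs_τ : ∀ e, S.obs (τ e) = S.obs e
  ends : ∀ e, (S.src (τ e) = ρ (S.src e) ∧ S.tgt (τ e) = ρ (S.tgt e)) ∨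
    (S.src (τ e) = ρ (S.tgt e) ∧ S.tgt (τ e) = ρ (S.src e))
  cross : ∀ e, ¬ (S.src e ∈ L ↔ S.tgt e ∈ L) → ρ (S.src e) = S.tgt e

namespace BondSystem

variable {V E X : Type*} (S : BondSystem V E X)

/-- The gradient of the observable along a bond. -/
def grad (e : E) (φ : V → X) : ℝ := S.obs e (φ (S.src e)) - S.obs e (φ (S.tgt e))

/-- The bonds separating `A` from its complement. -/
def split [Fintype E] [DecidableEq V] (A : Finset V) : Finset E :=
  Finset.univ.filter fun e => ¬ (S.src e ∈ A ↔ S.tgt e ∈ A)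

/-- Weight of a configuration with the constraint `χ` on the sites of `A` and bonds of `B` at
half strength. -/
noncomputable def patWeight [Fintype E] [DecidableEq E] (χ : X → ℝ) (lam : ℝ) (A : Finset V)
    (B : Finset E) (φ : V → X) : ℝ :=
  (∏ r ∈ A, χ (φ r)) * ∏ e, gaussKer lam (e ∈ B) (S.grad e φ)

/-- The partition function of a pattern. -/
noncomputable def patZ [Fintype V] [Fintype E] [DecidableEq E] [MeasurableSpace X]
    (μ : Measure X) (χ : X → ℝ) (lam : ℝ) (A : Finset V) (B : Finset E) : ℝ :=
  ∫ φ, S.patWeight χ lam A B φ ∂(Measure.pi fun _ => μ)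

theorem measurable_grad [MeasurableSpace X] (hs : ∀ e, Measurable (S.obs e)) (e : E) :
    Measurable (S.grad e) := by
  unfold grad
  exact ((hs e).comp (measurable_pi_apply _)).sub ((hs e).comp (measurable_pi_apply _))

theorem measurable_patWeight [Fintype E] [DecidableEq E] [MeasurableSpace X]
    (hs : ∀ e, Measurable (S.obs e)) {χ : X → ℝ} (hχ : Measurable χ) (lam : ℝ) (A : Finset V)
    (B : Finset E) : Measurable (S.patWeight χ lam A B) := by
  unfold patWeight
  exact (Finset.measurable_prod _ fun r _ => hχ.comp (measurable_pi_apply r)).mul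
    (Finset.measurable_prod _ fun e _ => (measurable_gaussKer _ _).comp (S.measurable_grad hs e))

theorem patWeight_nonneg [Fintype E] [DecidableEq E] {χ : X → ℝ} (h0 : ∀ x, 0 ≤ χ x) (lam : ℝ)
    (A : Finset V) (B : Finset E) (φ : V → X) : 0 ≤ S.patWeight χ lam A B φ :=
  mul_nonneg (Finset.prod_nonneg fun _ _ => h0 _)
    (Finset.prod_nonneg fun _ _ => (gaussKer_pos _ _ _).le)

theorem patWeight_le_one [Fintype E] [DecidableEq E] {χ : X → ℝ} (h0 : ∀ x, 0 ≤ χ x)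
    (h1 : ∀ x, χ x ≤ 1) {lam : ℝ} (hl : 0 < lam)
    (A : Finset V) (B : Finset E) (φ : V → X) : S.patWeight χ lam A B φ ≤ 1 :=
  mul_le_one₀ (Finset.prod_le_one (fun _ _ => h0 _) fun _ _ => h1 _)
    (Finset.prod_nonneg fun _ _ => (gaussKer_pos _ _ _).le)
    (Finset.prod_le_one (fun _ _ => (gaussKer_pos _ _ _).le) fun _ _ => gaussKer_le_one hl _ _)

end BondSystem

namespace Mirror

variable {V E X : Type*} [Fintype V] [Fintype E] [DecidableEq V] [DecidableEq E]
  {S : BondSystem V E X} (R : Mirror S)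

/-- Bonds inside the half `L`. -/
def inside : Finset E := Finset.univ.filter fun e => S.src e ∈ R.L ∧ S.tgt e ∈ R.L

/-- Bonds inside the complementary half. -/
def outside : Finset E := Finset.univ.filter fun e => S.src e ∉ R.L ∧ S.tgt e ∉ R.L

/-- Bonds across the reflection line. -/
def crossing : Finset E := Finset.univ.filter fun e => ¬ (S.src e ∈ R.L ↔ S.tgt e ∈ R.L)

/-- Mirror image of a set of sites. -/
def reflV (A : Finset V) : Finset V := Finset.univ.filter fun r => R.ρ r ∈ A

/-- Mirror image of a set of bonds. -/
def reflE (B : Finset E) : Finset E := Finset.univ.filter fun e => R.τ e ∈ B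

/-- The symmetric set of sites that agrees with `A` on `L`. -/
def symmV (A : Finset V) : Finset V :=
  Finset.univ.filter fun r => (r ∈ R.L ∧ r ∈ A) ∨ (r ∉ R.L ∧ R.ρ r ∈ A)

/-- The symmetric set of bonds that agrees with `B` inside `L` and has no crossing bond. -/
def symmE (B : Finset E) : Finset E :=
  Finset.univ.filter fun e => (e ∈ R.inside ∧ e ∈ B) ∨ (e ∈ R.outside ∧ R.τ e ∈ B)

theorem mem_inside_τ (e : E) : R.τ e ∈ R.inside ↔ e ∈ R.outside := by
  have h1 := R.mem_L (S.src e)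
  have h2 := R.mem_L (S.tgt e)
  rcases R.ends e with ⟨h, h'⟩ | ⟨h, h'⟩ <;> simp [inside, outside, h, h', h1, h2, and_comm]

theorem mem_outside_τ (e : E) : R.τ e ∈ R.outside ↔ e ∈ R.inside := by
  rw [← R.mem_inside_τ, R.τ_invol]

theorem prod_split (f : E → ℝ) :
    ∏ e, f e = (∏ e ∈ R.inside, f e) * (∏ e ∈ R.outside, f e) * ∏ e ∈ R.crossing, f e := by
  rw [inside, outside, crossing, Finset.prod_filter, Finset.prod_filter, Finset.prod_filter,
    ← Finset.prod_mul_distrib, ← Finset.prod_mul_distrib]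
  refine Finset.prod_congr rfl fun e _ => ?_
  by_cases h1 : S.src e ∈ R.L <;> by_cases h2 : S.tgt e ∈ R.L <;> simp [h1, h2]

theorem card_split (B : Finset E) :
    B.card = (B ∩ R.inside).card + (B ∩ R.outside).card + (B ∩ R.crossing).card := by
  rw [inside, outside, crossing]
  have : ∀ s : Finset E, s.card = ∑ e, if e ∈ s then 1 else 0 := fun s => by simp
  rw [this B, this (B ∩ _), this (B ∩ _), this (B ∩ _), ← Finset.sum_add_distrib,
    ← Finset.sum_add_distrib]
  refine Finset.sum_congr rfl fun e _ => ?_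
  by_cases h1 : S.src e ∈ R.L <;> by_cases h2 : S.tgt e ∈ R.L <;> simp [h1, h2]

theorem card_inter_add_card_inter_compl (A : Finset V) :
    A.card = (A.filter (· ∈ R.L)).card + (A.filter (· ∉ R.L)).card :=
  (Finset.card_filter_add_card_filter_not _).symm

theorem card_reflV_filter (A : Finset V) :
    ((R.reflV A).filter (· ∈ R.L)).card = (A.filter (· ∉ R.L)).card := by
  refine Finset.card_bij (fun r _ => R.ρ r) ?_ (fun _ _ _ _ h => R.ρ_invol.injective h) ?_
  · intro r hr
    simp only [reflV, Finset.mem_filter, Finset.mem_univ, true_and] at hr ⊢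
    exact ⟨hr.1, fun h => (R.mem_L r).1 h hr.2⟩
  · intro r hr
    simp only [reflV, Finset.mem_filter, Finset.mem_univ, true_and] at hr ⊢
    exact ⟨R.ρ r, ⟨by rw [R.ρ_invol]; exact hr.1, (R.mem_L r).2 hr.2⟩, R.ρ_invol r⟩

theorem card_reflE_inter (B : Finset E) :
    (R.reflE B ∩ R.inside).card = (B ∩ R.outside).card := by
  refine Finset.card_bij (fun r _ => R.τ r) ?_ (fun _ _ _ _ h => R.τ_invol.injective h) ?_
  · intro r hr
    simp only [reflE, Finset.mem_filter, Finset.mem_univ, true_and, Finset.mem_inter] at hr ⊢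
    exact ⟨hr.1, (R.mem_outside_τ r).2 hr.2⟩
  · intro r hr
    simp only [reflE, Finset.mem_filter, Finset.mem_univ, true_and, Finset.mem_inter] at hr ⊢
    exact ⟨R.τ r, ⟨by rw [R.τ_invol]; exact hr.1, (R.mem_inside_τ r).2 hr.2⟩, R.τ_invol r⟩

theorem card_symmV (A : Finset V) : (R.symmV A).card = 2 * (A.filter (· ∈ R.L)).card := by
  rw [R.card_inter_add_card_inter_compl, ← R.card_reflV_filter (R.symmV A), two_mul]
  congr 2
  · ext r; simp only [symmV, Finset.mem_filter, Finset.mem_univ, true_and]; tauto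
  · ext r
    simp only [symmV, reflV, Finset.mem_filter, Finset.mem_univ, true_and, R.mem_L, R.ρ_invol r]
    tauto

theorem not_mem_outside {e : E} (h : e ∈ R.inside) : e ∉ R.outside := by
  simp only [inside, outside, Finset.mem_filter, Finset.mem_univ, true_and] at *
  tauto

theorem not_mem_crossing {e : E} (h : e ∈ R.inside) : e ∉ R.crossing := by
  simp only [inside, crossing, Finset.mem_filter, Finset.mem_univ, true_and] at *
  tauto

theorem not_mem_crossing' {e : E} (h : e ∈ R.outside) : e ∉ R.crossing := by
  simp only [outside, crossing, Finset.mem_filter, Finset.mem_univ, true_and] at *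
  tauto

theorem symmE_inter_crossing (B : Finset E) : R.symmE B ∩ R.crossing = ∅ := by
  ext e
  simp only [symmE, Finset.mem_inter, Finset.mem_filter, Finset.mem_univ, true_and,
    Finset.notMem_empty, iff_false]
  rintro ⟨⟨h, -⟩ | ⟨h, -⟩, hc⟩
  · exact R.not_mem_crossing h hc
  · exact R.not_mem_crossing' h hc

theorem card_symmE (B : Finset E) : (R.symmE B).card = 2 * (B ∩ R.inside).card := by
  rw [R.card_split, R.symmE_inter_crossing, Finset.card_empty, add_zero,
    ← R.card_reflE_inter (R.symmE B), two_mul]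
  congr 2
  · ext e
    have := R.not_mem_outside (e := e)
    simp only [symmE, Finset.mem_filter, Finset.mem_univ, true_and, Finset.mem_inter]
    tauto
  · ext e
    have := R.not_mem_outside (e := e)
    simp only [symmE, reflE, Finset.mem_filter, Finset.mem_univ, true_and, Finset.mem_inter,
      R.mem_inside_τ, R.mem_outside_τ, R.τ_invol e]
    tauto

theorem split_symmV (A : Finset V) : S.split (R.symmV A) = R.symmE (S.split A) := by
  ext e
  have h1 := R.mem_L (S.src e)
  have h2 := R.mem_L (S.tgt e)
  have hc := R.cross e
  have i1 := R.ρ_invol (S.src e)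
  simp only [BondSystem.split, symmV, symmE, inside, outside, Finset.mem_filter, Finset.mem_univ,
    true_and]
  by_cases c1 : S.src e ∈ R.L <;> by_cases c2 : S.tgt e ∈ R.L
  · simp [c1, c2]
  · have := hc (by tauto)
    rw [this] at i1
    simp [c1, c2, i1]
  · have := hc (by tauto)
    simp [c1, c2, this]
  · rcases R.ends e with ⟨h, h'⟩ | ⟨h, h'⟩ <;> simp [c1, c2, h, h', iff_comm]

theorem split_reflV (A : Finset V) : S.split (R.reflV A) = R.reflE (S.split A) := by
  ext e
  simp only [BondSystem.split, reflV, reflE, Finset.mem_filter, Finset.mem_univ, true_and]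
  rcases R.ends e with ⟨h, h'⟩ | ⟨h, h'⟩ <;> simp [h, h', iff_comm]

/-- Part of the pattern weight carried by the half `L`. -/
noncomputable def halfWeight (χ : X → ℝ) (lam : ℝ) (A : Finset V) (B : Finset E)
    (φ : V → X) : ℝ :=
  (∏ r ∈ A.filter (· ∈ R.L), χ (φ r)) * ∏ e ∈ R.inside, gaussKer lam (e ∈ B) (S.grad e φ)

/-- Value of the observable at the endpoint in `L` of a crossing bond. -/
noncomputable def trace (e : E) (φ : V → X) : ℝ :=
  if e ∈ R.crossing then S.obs e (φ (if S.src e ∈ R.L then S.src e else S.tgt e)) else 0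

/-- Combine a configuration on `L` with the mirror image of another one. -/
def glue (p : (V → X) × (V → X)) : V → X := fun r => if r ∈ R.L then p.1 r else p.2 (R.ρ r)

theorem patWeight_glue (χ : X → ℝ) (lam : ℝ) (A : Finset V) (B : Finset E)
    (p : (V → X) × (V → X)) :
    S.patWeight χ lam A B (R.glue p) =
      R.halfWeight χ lam A B p.1 * R.halfWeight χ lam (R.reflV A) (R.reflE B) p.2 *
        ∏ e, gaussKer lam (e ∈ B ∩ R.crossing) (R.trace e p.1 - R.trace e p.2) := by
  have hV : ∏ r ∈ A, χ (R.glue p r) = (∏ r ∈ A.filter (· ∈ R.L), χ (p.1 r)) *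
      ∏ r ∈ (R.reflV A).filter (· ∈ R.L), χ (p.2 r) := by
    rw [← Finset.prod_filter_mul_prod_filter_not A (· ∈ R.L)]
    congr 1
    · refine Finset.prod_congr rfl fun r hr => ?_
      rw [glue, if_pos (Finset.mem_filter.1 hr).2]
    · refine (Finset.prod_bij (fun r _ => R.ρ r) ?_ (fun _ _ _ _ h => R.ρ_invol.injective h)
        ?_ ?_).symm
      · intro r hr
        simp only [reflV, Finset.mem_filter, Finset.mem_univ, true_and] at hr ⊢
        exact ⟨hr.1, fun h => (R.mem_L r).1 h hr.2⟩
      · intro r hr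
        simp only [reflV, Finset.mem_filter, Finset.mem_univ, true_and] at hr ⊢
        exact ⟨R.ρ r, ⟨by rw [R.ρ_invol]; exact hr.1, (R.mem_L r).2 hr.2⟩, R.ρ_invol r⟩
      · intro r hr
        simp only [Finset.mem_filter] at hr
        rw [glue, if_neg (fun h => (R.mem_L r).1 h hr.2), R.ρ_invol]
  have hI : ∏ e ∈ R.inside, gaussKer lam (e ∈ B) (S.grad e (R.glue p)) =
      ∏ e ∈ R.inside, gaussKer lam (e ∈ B) (S.grad e p.1) := by
    refine Finset.prod_congr rfl fun e he => ?_
    simp only [inside, Finset.mem_filter, Finset.mem_univ, true_and] at he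
    simp only [BondSystem.grad, glue, if_pos he.1, if_pos he.2]
  have hO : ∏ e ∈ R.outside, gaussKer lam (e ∈ B) (S.grad e (R.glue p)) =
      ∏ e ∈ R.inside, gaussKer lam (e ∈ R.reflE B) (S.grad e p.2) := by
    refine (Finset.prod_bij (fun e _ => R.τ e) (fun e he => (R.mem_outside_τ e).2 he)
      (fun _ _ _ _ h => R.τ_invol.injective h)
      (fun e he => ⟨R.τ e, (R.mem_inside_τ e).2 he, R.τ_invol e⟩) ?_).symm
    intro e he
    simp only [inside, Finset.mem_filter, Finset.mem_univ, true_and] at he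
    have h1 : R.glue p (R.ρ (S.src e)) = p.2 (S.src e) := by
      rw [glue, if_neg (fun h => (R.mem_L _).1 h he.1), R.ρ_invol]
    have h2 : R.glue p (R.ρ (S.tgt e)) = p.2 (S.tgt e) := by
      rw [glue, if_neg (fun h => (R.mem_L _).1 h he.2), R.ρ_invol]
    rw [gaussKer_congr lam (h := e ∈ R.reflE B) (h' := R.τ e ∈ B)
      (by simp [reflE])]
    rcases R.ends e with ⟨h, h'⟩ | ⟨h, h'⟩
    · rw [BondSystem.grad, BondSystem.grad, h, h', h1, h2, R.obs_τ]
    · rw [BondSystem.grad, BondSystem.grad, h, h', h1, h2, R.obs_τ,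
        ← gaussKer_neg lam (R.τ e ∈ B), neg_sub]
  have hC : ∏ e ∈ R.crossing, gaussKer lam (e ∈ B) (S.grad e (R.glue p)) =
      ∏ e, gaussKer lam (e ∈ B ∩ R.crossing) (R.trace e p.1 - R.trace e p.2) := by
    rw [← Finset.prod_subset (Finset.subset_univ R.crossing)
      (fun e _ he => by simp [trace, he, gaussKer_zero])]
    refine Finset.prod_congr rfl fun e he => ?_
    rw [gaussKer_congr lam (h := e ∈ B) (h' := e ∈ B ∩ R.crossing) (by simp [he])]
    simp only [trace, if_pos he]
    have hx : ¬ (S.src e ∈ R.L ↔ S.tgt e ∈ R.L) := by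
      simpa [crossing] using he
    have hr := R.cross e hx
    by_cases hs : S.src e ∈ R.L
    · have ht : S.tgt e ∉ R.L := by tauto
      have : R.ρ (S.tgt e) = S.src e := by rw [← hr, R.ρ_invol]
      simp only [BondSystem.grad, glue, if_pos hs, if_neg ht, this]
    · have ht : S.tgt e ∈ R.L := by tauto
      simp only [BondSystem.grad, glue, if_neg hs, if_pos ht, hr]
      rw [← gaussKer_neg, neg_sub]
  rw [BondSystem.patWeight, R.prod_split, hV, hI, hO, hC, halfWeight, halfWeight]
  ring

theorem halfWeight_symm (χ : X → ℝ) (lam : ℝ) (A : Finset V) (B : Finset E) (φ : V → X) :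
    R.halfWeight χ lam (R.symmV A) (R.symmE B) φ = R.halfWeight χ lam A B φ := by
  rw [halfWeight, halfWeight]
  congr 1
  · congr 1
    ext r; simp only [symmV, Finset.mem_filter, Finset.mem_univ, true_and]; tauto
  · refine Finset.prod_congr rfl fun e he => gaussKer_congr _ ?_ _
    have := R.not_mem_outside he
    simp only [symmE, Finset.mem_filter, Finset.mem_univ, true_and]
    tauto

theorem halfWeight_refl_symm (χ : X → ℝ) (lam : ℝ) (A : Finset V) (B : Finset E) (φ : V → X) :
    R.halfWeight χ lam (R.reflV (R.symmV A)) (R.reflE (R.symmE B)) φ =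
      R.halfWeight χ lam A B φ := by
  rw [halfWeight, halfWeight]
  congr 1
  · congr 1
    ext r
    simp only [symmV, reflV, Finset.mem_filter, Finset.mem_univ, true_and, R.mem_L, R.ρ_invol r]
    tauto
  · refine Finset.prod_congr rfl fun e he => gaussKer_congr _ ?_ _
    have := R.not_mem_outside he
    simp only [symmE, reflE, Finset.mem_filter, Finset.mem_univ, true_and, R.mem_inside_τ,
      R.mem_outside_τ, R.τ_invol e]
    tauto

end Mirror

namespace Mirror

variable {V E X : Type*} [Fintype V] [Fintype E] [DecidableEq V] [DecidableEq E]
  {S : BondSystem V E X} (R : Mirror S)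

section measure

variable [MeasurableSpace X] (μ : Measure X) [IsProbabilityMeasure μ]

theorem measurable_halfWeight (hs : ∀ e, Measurable (S.obs e)) {χ : X → ℝ} (hχ : Measurable χ)
    (lam : ℝ) (A : Finset V) (B : Finset E) : Measurable (R.halfWeight χ lam A B) := by
  unfold halfWeight
  exact (Finset.measurable_prod _ fun r _ => hχ.comp (measurable_pi_apply r)).mul
    (Finset.measurable_prod _ fun e _ => (measurable_gaussKer _ _).comp (S.measurable_grad hs e))

theorem halfWeight_nonneg {χ : X → ℝ} (h0 : ∀ x, 0 ≤ χ x) (lam : ℝ)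
    (A : Finset V) (B : Finset E) (φ : V → X) : 0 ≤ R.halfWeight χ lam A B φ :=
  mul_nonneg (Finset.prod_nonneg fun _ _ => h0 _)
    (Finset.prod_nonneg fun _ _ => (gaussKer_pos _ _ _).le)

theorem halfWeight_le_one {χ : X → ℝ} (h0 : ∀ x, 0 ≤ χ x)
    (h1 : ∀ x, χ x ≤ 1) {lam : ℝ} (hl : 0 < lam)
    (A : Finset V) (B : Finset E) (φ : V → X) : R.halfWeight χ lam A B φ ≤ 1 :=
  mul_le_one₀ (Finset.prod_le_one (fun _ _ => h0 _) fun _ _ => h1 _)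
    (Finset.prod_nonneg fun _ _ => (gaussKer_pos _ _ _).le)
    (Finset.prod_le_one (fun _ _ => (gaussKer_pos _ _ _).le) fun _ _ => gaussKer_le_one hl _ _)

theorem measurable_trace (hs : ∀ e, Measurable (S.obs e)) (e : E) : Measurable (R.trace e) := by
  unfold trace
  by_cases h : e ∈ R.crossing
  · simp only [h, if_true]
    exact (hs e).comp (measurable_pi_apply _)
  · simp only [h, if_false]
    exact measurable_const

theorem patZ_eq_prod (hs : ∀ e, Measurable (S.obs e)) {χ : X → ℝ} (hχ : Measurable χ)
    {lam : ℝ} (hl : 0 < lam) (A : Finset V) (B : Finset E) :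
    S.patZ μ χ lam A B = ∫ p, R.halfWeight χ lam A B p.1 *
      R.halfWeight χ lam (R.reflV A) (R.reflE B) p.2 *
        (∫ k : E → ℝ, (∏ e, specDensity lam (e ∈ B ∩ R.crossing) (k e)) *
          Real.cos ((∑ e, k e * R.trace e p.1) - ∑ e, k e * R.trace e p.2)
          ∂(Measure.pi fun _ => ProbabilityTheory.gaussianReal 0 (2 * lam).toNNReal))
      ∂((Measure.pi fun _ : V => μ).prod (Measure.pi fun _ => μ)) := by
  have hmp := measurePreserving_glue μ R.ρ R.ρ_invol (· ∈ R.L) R.mem_L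
  have hmap : S.patZ μ χ lam A B = ∫ p, S.patWeight χ lam A B (R.glue p)
      ∂((Measure.pi fun _ : V => μ).prod (Measure.pi fun _ => μ)) := by
    have h := integral_map (μ := (Measure.pi fun _ : V => μ).prod (Measure.pi fun _ => μ))
      (f := S.patWeight χ lam A B) hmp.measurable.aemeasurable
      (S.measurable_patWeight hs hχ lam A B).aestronglyMeasurable
    rw [hmp.map_eq] at h
    exact h
  rw [hmap]
  refine integral_congr_ae (Filter.Eventually.of_forall fun p => ?_)
  simp only [R.patWeight_glue, ← integral_prod_specDensity_mul_cos hl (fun e => e ∈ B ∩ R.crossing)]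
  congr 2
  funext k
  congr 2
  rw [← Finset.sum_sub_distrib]
  exact Finset.sum_congr rfl fun e _ => by ring

theorem patZ_symm_eq (hs : ∀ e, Measurable (S.obs e)) {χ : X → ℝ} (hχ : Measurable χ)
    {lam : ℝ} (hl : 0 < lam) (A : Finset V) (B : Finset E) :
    S.patZ μ χ lam (R.symmV A) (R.symmE B) = ∫ p, R.halfWeight χ lam A B p.1 *
      R.halfWeight χ lam A B p.2 *
        (∫ k : E → ℝ, 
          Real.cos ((∑ e, k e * R.trace e p.1) - ∑ e, k e * R.trace e p.2)
          ∂(Measure.pi fun _ => ProbabilityTheory.gaussianReal 0 (2 * lam).toNNReal))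
      ∂((Measure.pi fun _ : V => μ).prod (Measure.pi fun _ => μ)) := by
  rw [R.patZ_eq_prod μ hs hχ hl]
  simp only [halfWeight_symm, halfWeight_refl_symm]
  simp [symmE_inter_crossing, specDensity]

theorem sq_patZ_le (hs : ∀ e, Measurable (S.obs e)) {χ : X → ℝ} (hχ : Measurable χ)
    (h0 : ∀ x, 0 ≤ χ x) (h1 : ∀ x, χ x ≤ 1) {lam : ℝ} (hl : 0 < lam)
    (A : Finset V) (B : Finset E) :
    S.patZ μ χ lam A B ^ 2 ≤ 2 ^ (B ∩ R.crossing).card *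
      (S.patZ μ χ lam (R.symmV A) (R.symmE B) *
        S.patZ μ χ lam (R.symmV (R.reflV A)) (R.symmE (R.reflE B))) := by
  have hC : ∏ e : E, (if e ∈ B ∩ R.crossing then √2 else 1) = √2 ^ (B ∩ R.crossing).card := by
    rw [Finset.prod_ite_mem, Finset.univ_inter, Finset.prod_const]
  rw [R.patZ_eq_prod μ hs hχ hl, R.patZ_symm_eq μ hs hχ hl, R.patZ_symm_eq μ hs hχ hl]
  have key := sq_integral_kernel_le (Measure.pi fun _ : V => μ)
    (Measure.pi fun _ : E => ProbabilityTheory.gaussianReal 0 (2 * lam).toNNReal)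
    (fun k φ => ∑ e, k e * R.trace e φ) (by
      refine Finset.measurable_sum _ fun e _ => ?_
      exact ((measurable_pi_apply e).comp measurable_fst).mul
        ((R.measurable_trace hs e).comp measurable_snd))
    (fun k => ∏ e, specDensity lam (e ∈ B ∩ R.crossing) (k e))
    (Finset.measurable_prod _ fun e _ =>
      (measurable_specDensity _ _).comp (measurable_pi_apply e))
    (√2 ^ (B ∩ R.crossing).card)
    (fun k => Finset.prod_nonneg fun e _ => specDensity_nonneg _ _ _)
    (fun k => by
      rw [← hC]
      exact Finset.prod_le_prod (fun e _ => specDensity_nonneg _ _ _)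
        fun e _ => specDensity_le hl _ _)
    (R.halfWeight χ lam A B) (R.halfWeight χ lam (R.reflV A) (R.reflE B))
    (R.measurable_halfWeight hs hχ _ _ _) (R.measurable_halfWeight hs hχ _ _ _)
    (R.halfWeight_nonneg h0 _ _ _) (R.halfWeight_le_one h0 h1 hl _ _)
    (R.halfWeight_nonneg h0 _ _ _) (R.halfWeight_le_one h0 h1 hl _ _)
  rw [← pow_mul, mul_comm _ 2, pow_mul, Real.sq_sqrt zero_le_two] at key
  exact key

end measure

end Mirror

namespace BondSystem

variable {V E X : Type*} [Fintype V] [Fintype E] [DecidableEq V] [DecidableEq E]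
  (S : BondSystem V E X) [MeasurableSpace X] (μ : Measure X) [IsProbabilityMeasure μ]

/-- Chessboard-type estimate: patterns of constrained sites and weakened bonds cost a factor per
site and per bond. -/
theorem patZ_le (hs : ∀ e, Measurable (S.obs e)) {χ : X → ℝ} (hχ : Measurable χ)
    (h0 : ∀ x, 0 ≤ χ x) (h1 : ∀ x, χ x ≤ 1) {lam : ℝ} (hl : 0 < lam)
    (hcross : ∀ e, ∃ R : Mirror S, e ∈ R.crossing)
    (hconn : ∀ A : Finset V, S.split A = ∅ → A = ∅ ∨ A = Finset.univ)
    {q : ℝ} (hq : 0 < q)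
    (hbad : S.patZ μ χ lam Finset.univ ∅ ≤ q ^ Fintype.card V * S.patZ μ χ lam ∅ ∅)
    (A : Finset V) (B : Finset E) :
    S.patZ μ χ lam A B ≤ q ^ A.card * √2 ^ B.card * S.patZ μ χ lam ∅ ∅ := by
  have hZ0 : ∀ A B, 0 ≤ S.patZ μ χ lam A B := fun A B =>
    integral_nonneg fun φ => S.patWeight_nonneg h0 lam A B φ
  obtain ⟨⟨A₀, B₀⟩, hd, hle⟩ := exists_defect_free_ge (P := Finset V × Finset E)
    (fun p => S.patZ μ χ lam p.1 p.2 / (q ^ p.1.card * √2 ^ p.2.card))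
    (fun p => div_nonneg (hZ0 _ _) (by positivity))
    (fun p => (S.split p.1).card + p.2.card) (by
      rintro ⟨A, B⟩ hpos
      have hne : (S.split A ∪ B).Nonempty := by
        rw [← Finset.card_pos]
        have := Finset.card_union_le (S.split A) B
        by_contra h
        have h0 : (S.split A ∪ B) = ∅ := Finset.card_eq_zero.1 (by omega)
        rw [Finset.union_eq_empty] at h0
        simp [h0.1, h0.2] at hpos
      obtain ⟨e, he⟩ := hne
      obtain ⟨R, hR⟩ := hcross e
      refine ⟨(R.symmV A, R.symmE B), (R.symmV (R.reflV A), R.symmE (R.reflE B)), ?_, ?_⟩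
      · have key := R.sq_patZ_le μ hs hχ h0 h1 hl A B
        have cA := R.card_inter_add_card_inter_compl A
        have cB := R.card_split B
        simp only [R.card_symmV, R.card_reflV_filter, R.card_symmE, R.card_reflE_inter]
        rw [div_pow, div_mul_div_comm, div_le_div_iff₀ (by positivity) (by positivity)]
        set a := (A.filter (· ∈ R.L)).card
        set a' := (A.filter (· ∉ R.L)).card
        set b := (B ∩ R.inside).card
        set b' := (B ∩ R.outside).card
        set c := (B ∩ R.crossing).card
        have e1 : (q ^ A.card * √2 ^ B.card) ^ 2 = q ^ (2 * a) * q ^ (2 * a') *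
            (√2 ^ (2 * b) * √2 ^ (2 * b')) * 2 ^ c := by
          have : (2 : ℝ) ^ c = √2 ^ (2 * c) := by rw [pow_mul, Real.sq_sqrt zero_le_two]
          rw [this, cA, cB]
          ring
        rw [e1]
        calc _ ≤ _ := mul_le_mul_of_nonneg_right key (by positivity)
          _ = _ := by ring
      · have cS := R.card_split (S.split A)
        have cB := R.card_split B
        simp only [R.split_symmV, R.split_reflV, R.card_symmE, R.card_reflE_inter]
        have : 0 < (S.split A ∩ R.crossing).card + (B ∩ R.crossing).card := by
          rcases Finset.mem_union.1 he with h | h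
          · exact Nat.add_pos_left (Finset.card_pos.2 ⟨e, Finset.mem_inter.2 ⟨h, hR⟩⟩) _
          · exact Nat.add_pos_right _ (Finset.card_pos.2 ⟨e, Finset.mem_inter.2 ⟨h, hR⟩⟩)
        omega) (A, B)
  have hd' : (S.split A₀).card + B₀.card = 0 := hd
  have hA0 : S.split A₀ = ∅ := Finset.card_eq_zero.1 (by omega)
  have hB0 : B₀ = ∅ := Finset.card_eq_zero.1 (by omega)
  subst hB0
  have hfin : S.patZ μ χ lam A₀ ∅ / (q ^ A₀.card * √2 ^ (∅ : Finset E).card) ≤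
      S.patZ μ χ lam ∅ ∅ := by
    rw [div_le_iff₀ (by positivity)]
    rcases hconn A₀ hA0 with rfl | rfl
    · simp
    · simpa [mul_comm, Finset.card_univ] using hbad
  have := (div_le_iff₀ (by positivity)).1 (hle.trans hfin)
  linarith
end BondSystem

theorem even_val_add {N : ℕ} [NeZero N] (hN : Even N) (a b : ZMod N) :
    Even (a + b).val ↔ (Even a.val ↔ Even b.val) := by
  rw [ZMod.val_add, ← Nat.even_add, Nat.even_iff, Nat.even_iff,
    Nat.mod_mod_of_dvd _ (even_iff_two_dvd.1 hN)]

theorem even_val_two_sub {N : ℕ} [NeZero N] (hN : Even N) (k a : ZMod N) :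
    Even (k + k - a).val ↔ Even a.val := by
  have h := even_val_add hN (k + k - a) a
  rw [sub_add_cancel, even_val_add hN k k] at h
  tauto

theorem not_even_val_add_one {N : ℕ} [NeZero N] (hN : Even N) (a : ZMod N) :
    Even (a + 1).val ↔ ¬ Even a.val := by
  have h1 : ¬ Even (1 : ZMod N).val := by
    have : 2 ≤ N := Nat.le_of_dvd (NeZero.pos N) (even_iff_two_dvd.1 hN)
    rw [ZMod.val_one'' (by omega)]
    decide
  rw [even_val_add hN]
  tauto

/-- The half circle of the points following `k`. -/
def ZMod.halfFrom {N : ℕ} (k a : ZMod N) : Prop := (a - (k + 1)).val < N / 2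

instance {N : ℕ} (k : ZMod N) : DecidablePred (ZMod.halfFrom k) :=
  fun _ => inferInstanceAs (Decidable (_ < _))

theorem ZMod.halfFrom_refl {N : ℕ} [NeZero N] (hN : Even N) (k a : ZMod N) :
    ZMod.halfFrom k (k + k + 1 - a) ↔ ¬ ZMod.halfFrom k a := by
  unfold ZMod.halfFrom
  have e : k + k + 1 - a - (k + 1) = -1 - (a - (k + 1)) := by ring
  rw [e]
  set b := a - (k + 1)
  have hb := ZMod.val_lt b
  have : (-1 - b).val = N - 1 - b.val := by
    have e2 : -1 - b = ((N - 1 - b.val : ℕ) : ZMod N) := by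
      rw [Nat.cast_sub (by omega), Nat.cast_sub (NeZero.pos N)]
      simp
    rw [e2, ZMod.val_natCast, Nat.mod_eq_of_lt (by omega)]
  rw [this]
  obtain ⟨m, rfl⟩ := hN
  omega

theorem ZMod.refl_eq_of_halfFrom {N : ℕ} [NeZero N] (hN : Even N) (k a : ZMod N)
    (h : ¬ (ZMod.halfFrom k a ↔ ZMod.halfFrom k (a + 1))) : k + k + 1 - a = a + 1 := by
  unfold ZMod.halfFrom at h
  have e : a + 1 - (k + 1) = (a - (k + 1)) + 1 := by ring
  rw [e] at h
  suffices h2 : (2 : ZMod N) * ((a - (k + 1)) + 1) = 0 by linear_combination -h2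
  generalize a - (k + 1) = b at h
  have hb := ZMod.val_lt b
  have hc : ((b.val : ℕ) : ZMod N) = b := ZMod.natCast_zmod_val b
  rw [ZMod.val_add, ZMod.val_one_eq_one_mod, Nat.add_mod_mod] at h
  obtain ⟨m, rfl⟩ := hN
  have hz : ((m + m : ℕ) : ZMod (m + m)) = 0 := ZMod.natCast_self _
  rcases Nat.lt_or_ge (b.val + 1) (m + m) with h1 | h1
  · rw [Nat.mod_eq_of_lt h1] at h
    have : b.val + 1 = m := by omega
    have h2 : ((b.val + 1 : ℕ) : ZMod (m + m)) = (m : ℕ) := by rw [this]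
    rw [Nat.cast_add, hc, Nat.cast_one] at h2
    rw [h2, ← hz]
    push_cast; ring
  · have : b.val + 1 = m + m := by omega
    have h2 : ((b.val + 1 : ℕ) : ZMod (m + m)) = (m + m : ℕ) := by rw [this]
    rw [Nat.cast_add, hc, Nat.cast_one] at h2
    rw [h2, hz, mul_zero]

theorem ZMod.halfFrom_cross {N : ℕ} [NeZero N] (hN : Even N) (k : ZMod N) :
    ¬ (ZMod.halfFrom k k ↔ ZMod.halfFrom k (k + 1)) := by
  have h := ZMod.halfFrom_refl hN k k
  rw [show k + k + 1 - k = k + 1 by ring] at h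
  tauto

/-- The bonds of the torus: `(r, false)` is horizontal and `(r, true)` vertical. -/
noncomputable def torusBonds (N : ℕ) : BondSystem (Torus N) (Torus N × Bool) Real.Angle where
  src e := e.1
  tgt e := if e.2 then e.1 + (0, 1) else e.1 + (1, 0)
  obs e φ := if Even (if e.2 then e.1.2 else e.1.1).val then φ.cos else φ.sin

variable {N : ℕ} [NeZero N]

/-- Reflection of the torus in the vertical line through the midpoint of `k, k + 1`. -/
def horizontalMirror (hN : Even N) (k : ZMod N) : Mirror (torusBonds N) where
  ρ r := (k + k + 1 - r.1, r.2)
  τ e := if e.2 then ((k + k + 1 - e.1.1, e.1.2), true) else ((k + k - e.1.1, e.1.2), false)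
  L := Finset.univ.filter fun r => ZMod.halfFrom k r.1
  ρ_invol r := by simp
  τ_invol e := by obtain ⟨⟨a, b⟩, _ | _⟩ := e <;> simp
  mem_L r := by simp [ZMod.halfFrom_refl hN]
  obs_τ e := by
    obtain ⟨⟨a, b⟩, _ | _⟩ := e <;> funext φ
    · simp [torusBonds, even_val_two_sub hN]
    · simp [torusBonds]
  ends e := by
    obtain ⟨⟨a, b⟩, _ | _⟩ := e
    · right
      simp only [torusBonds, Prod.mk_add_mk, Prod.mk.injEq, Bool.false_eq_true, if_false]
      refine ⟨⟨by ring, by ring⟩, ⟨by ring, by ring⟩⟩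
    · left
      simp [torusBonds]
  cross e := by
    obtain ⟨⟨a, b⟩, _ | _⟩ := e
    · intro h
      have := ZMod.refl_eq_of_halfFrom hN k a (by simpa [torusBonds] using h)
      simp [torusBonds, this]
    · intro h
      simp [torusBonds] at h

/-- Exchange of the two coordinates, on bonds. -/
def swapBond (e : Torus N × Bool) : Torus N × Bool := (e.1.swap, !e.2)

theorem swapBond_swapBond (e : Torus N × Bool) : swapBond (swapBond e) = e := by
  simp [swapBond]

theorem torusBonds_src_swap (e : Torus N × Bool) :
    (torusBonds N).src (swapBond e) = ((torusBonds N).src e).swap := rfl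

theorem torusBonds_tgt_swap (e : Torus N × Bool) :
    (torusBonds N).tgt (swapBond e) = ((torusBonds N).tgt e).swap := by
  obtain ⟨⟨a, b⟩, _ | _⟩ := e <;> simp [torusBonds, swapBond]

theorem torusBonds_obs_swap (e : Torus N × Bool) :
    (torusBonds N).obs (swapBond e) = (torusBonds N).obs e := by
  obtain ⟨⟨a, b⟩, _ | _⟩ := e <;> simp [torusBonds, swapBond]

/-- The mirror obtained by exchanging the two coordinates. -/
def Mirror.transpose (R : Mirror (torusBonds N)) : Mirror (torusBonds N) where
  ρ r := (R.ρ r.swap).swap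
  τ e := swapBond (R.τ (swapBond e))
  L := Finset.univ.filter fun r => r.swap ∈ R.L
  ρ_invol r := by simp [R.ρ_invol _]
  τ_invol e := by simp [swapBond_swapBond, R.τ_invol _]
  mem_L r := by simp [R.mem_L]
  obs_τ e := by rw [torusBonds_obs_swap, R.obs_τ, torusBonds_obs_swap]
  ends e := by
    simpa only [torusBonds_src_swap, torusBonds_tgt_swap, Prod.swap_inj] using R.ends (swapBond e)
  cross e h := by
    have := R.cross (swapBond e) (by
      simpa only [torusBonds_src_swap, torusBonds_tgt_swap, Finset.mem_filter, Finset.mem_univ,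
        true_and] using h)
    rw [torusBonds_src_swap, torusBonds_tgt_swap] at this
    rw [this, Prod.swap_swap]

theorem exists_mirror_crossing (hN : Even N) (e : Torus N × Bool) :
    ∃ R : Mirror (torusBonds N), e ∈ R.crossing := by
  have hh : ∀ r : Torus N, (r, false) ∈ (horizontalMirror hN r.1).crossing := by
    intro r
    simpa [Mirror.crossing, horizontalMirror, torusBonds] using ZMod.halfFrom_cross hN r.1
  obtain ⟨r, _ | _⟩ := e
  · exact ⟨_, hh r⟩
  · refine ⟨(horizontalMirror hN r.2).transpose, ?_⟩
    have := hh r.swap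
    simp only [Mirror.crossing, Finset.mem_filter, Finset.mem_univ, true_and] at this ⊢
    simpa [Mirror.transpose, torusBonds] using this

theorem ZMod.forall_iff_of_forall_add_one {P : ZMod N → Prop} (h : ∀ a, P a ↔ P (a + 1))
    (a b : ZMod N) : P a ↔ P b := by
  have key : ∀ (n : ℕ) (a : ZMod N), P a ↔ P (a + n) := by
    intro n
    induction n with
    | zero => simp
    | succ n ih => intro a; rw [ih, h]; push_cast; rw [add_assoc]
  have := key (b - a).val a
  rwa [ZMod.natCast_zmod_val, add_sub_cancel] at this

theorem split_torusBonds_eq_empty (A : Finset (Torus N)) (hA : (torusBonds N).split A = ∅) :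
    A = ∅ ∨ A = Finset.univ := by
  have h : ∀ e, (torusBonds N).src e ∈ A ↔ (torusBonds N).tgt e ∈ A := by
    intro e
    have := Finset.eq_empty_iff_forall_notMem.1 hA e
    simpa [BondSystem.split] using this
  have h1 : ∀ r r' : Torus N, r ∈ A ↔ r' ∈ A := by
    rintro ⟨a, b⟩ ⟨a', b'⟩
    rw [ZMod.forall_iff_of_forall_add_one (P := fun x => (x, b) ∈ A)
      (fun x => by simpa [torusBonds] using h ((x, b), false)) a a',
      ZMod.forall_iff_of_forall_add_one (P := fun x => (a', x) ∈ A)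
      (fun x => by simpa [torusBonds] using h ((a', x), true)) b b']
  rcases A.eq_empty_or_nonempty with h0 | ⟨r, hr⟩
  · exact Or.inl h0
  · exact Or.inr (Finset.eq_univ_of_forall fun r' => (h1 r r').1 hr)

instance : BorelSpace Real.Angle := inferInstanceAs (BorelSpace (AddCircle (2 * Real.pi)))

instance : OpensMeasurableSpace Real.Angle :=
  inferInstanceAs (OpensMeasurableSpace (AddCircle (2 * Real.pi)))

/-- The uniform probability measure on angles. -/
noncomputable def angleProb : Measure Real.Angle :=
  (AddCircle.haarAddCircle : Measure (AddCircle (2 * Real.pi)))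

instance : IsProbabilityMeasure angleProb :=
  inferInstanceAs (IsProbabilityMeasure (AddCircle.haarAddCircle : Measure (AddCircle (2 * Real.pi))))

theorem volume_angle_eq : (volume : Measure Real.Angle) = ENNReal.ofReal (2 * Real.pi) • angleProb :=
  rfl

theorem angleProb_apply (t : ℝ) {A : Set Real.Angle} (hA : MeasurableSet A) :
    ENNReal.ofReal (2 * Real.pi) * angleProb A =
      volume ((fun x : ℝ => (x : Real.Angle)) ⁻¹' A ∩ Set.Ioc t (t + 2 * Real.pi)) := by
  have h := (AddCircle.measurePreserving_mk (2 * Real.pi) t).measure_preimage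
    (s := A) hA.nullMeasurableSet
  rw [Measure.restrict_apply' measurableSet_Ioc] at h
  have h2 : (volume : Measure Real.Angle) A = ENNReal.ofReal (2 * Real.pi) * angleProb A := by
    rw [volume_angle_eq, Measure.smul_apply, smul_eq_mul]
  rw [← h2]
  exact h.symm

theorem measurePreserving_angle_sub (c : Real.Angle) :
    MeasurePreserving (fun φ => φ - c) angleProb angleProb :=
  measurePreserving_sub_right (AddCircle.haarAddCircle : Measure (AddCircle (2 * Real.pi))) c

theorem two_mul_sub_le_cos_sub_cos {a x y : ℝ} (hx : 0 ≤ x) (hxy : x ≤ y)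
    (hy : y ≤ Real.pi) (hax : a ≤ Real.sin x) (hay : a ≤ Real.sin y) (ha : 0 ≤ a) :
    2 * a / Real.pi * (y - x) ≤ Real.cos x - Real.cos y := by
  have hpi := Real.pi_pos
  have h1 : Real.cos x - Real.cos y = 2 * Real.sin ((x + y) / 2) * Real.sin ((y - x) / 2) := by
    rw [Real.cos_sub_cos, show (x - y) / 2 = -((y - x) / 2) by ring, Real.sin_neg]
    ring
  have h2 : a ≤ Real.sin ((x + y) / 2) := by
    have hxm : x ∈ Set.Icc 0 Real.pi := ⟨hx, by linarith⟩
    have hym : y ∈ Set.Icc 0 Real.pi := ⟨by linarith, hy⟩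
    have hc := strictConcaveOn_sin_Icc.concaveOn.2
    have := hc hxm hym (by norm_num : (0 : ℝ) ≤ 1 / 2) (by norm_num : (0 : ℝ) ≤ 1 / 2)
      (by norm_num)
    simp only [smul_eq_mul] at this
    rw [show (x + y) / 2 = 1 / 2 * x + 1 / 2 * y by ring]
    linarith
  have h3 : 2 / Real.pi * ((y - x) / 2) ≤ Real.sin ((y - x) / 2) :=
    Real.mul_le_sin (by linarith) (by linarith)
  have h4 : 0 ≤ 2 / Real.pi * ((y - x) / 2) := by
    have : 0 ≤ y - x := by linarith
    positivity
  rw [h1]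
  calc 2 * a / Real.pi * (y - x) = 2 * (a * (2 / Real.pi * ((y - x) / 2))) := by ring
    _ ≤ 2 * (Real.sin ((x + y) / 2) * Real.sin ((y - x) / 2)) := by gcongr; linarith
    _ = _ := by ring

theorem volume_arc_le {a u c : ℝ} (ha : 0 < a) :
    volume {x : ℝ | x ∈ Set.Icc 0 Real.pi ∧ a ≤ Real.sin x ∧ |Real.cos x - c| ≤ u} ≤
      ENNReal.ofReal (Real.pi * u / a) := by
  have hpi := Real.pi_pos
  refine (Real.volume_le_diam _).trans (Metric.ediam_le fun x hx y hy => ?_)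
  rw [edist_dist, Real.dist_eq]
  refine ENNReal.ofReal_le_ofReal ?_
  wlog hxy : x ≤ y generalizing x y
  · rw [abs_sub_comm]
    exact this y hy x hx (le_of_not_ge hxy)
  have h := two_mul_sub_le_cos_sub_cos hx.1.1 hxy hy.1.2 hx.2.1 hy.2.1 ha.le
  have h1 := abs_le.1 hx.2.2
  have h2 := abs_le.1 hy.2.2
  rw [abs_sub_comm, abs_of_nonneg (by linarith), le_div_iff₀ ha]
  have h3 : 2 * a / Real.pi * (y - x) ≤ 2 * u := by linarith
  rw [div_mul_eq_mul_div, div_le_iff₀ hpi] at h3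
  nlinarith

theorem angleProb_cos_le {a u c : ℝ} (ha : 0 < a) (hu : 0 ≤ u) :
    angleProb {φ | a ≤ |φ.sin| ∧ |φ.cos - c| ≤ u} ≤ ENNReal.ofReal (u / a) := by
  have hpi := Real.pi_pos
  have hm : MeasurableSet {φ : Real.Angle | a ≤ |φ.sin| ∧ |φ.cos - c| ≤ u} := by
    refine (IsClosed.inter ?_ ?_).measurableSet
    · exact isClosed_le continuous_const Real.Angle.continuous_sin.abs
    · exact isClosed_le (Real.Angle.continuous_cos.sub continuous_const).abs continuous_const
  have h := angleProb_apply (-Real.pi) hm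
  set P : Set ℝ := {x : ℝ | x ∈ Set.Icc 0 Real.pi ∧ a ≤ Real.sin x ∧ |Real.cos x - c| ≤ u}
  have hP : volume P ≤ ENNReal.ofReal (Real.pi * u / a) := volume_arc_le ha
  have hsub : ((fun x : ℝ => (x : Real.Angle)) ⁻¹' {φ | a ≤ |φ.sin| ∧ |φ.cos - c| ≤ u} ∩
      Set.Ioc (-Real.pi) (-Real.pi + 2 * Real.pi)) ⊆ P ∪ Neg.neg ⁻¹' P := by
    rintro x ⟨⟨h1, h2⟩, h3, h4⟩
    rw [Real.Angle.sin_coe] at h1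
    rw [Real.Angle.cos_coe] at h2
    rcases le_total 0 x with hx | hx
    · left
      have hx' : x ≤ Real.pi := by linarith
      rw [abs_of_nonneg (Real.sin_nonneg_of_nonneg_of_le_pi hx hx')] at h1
      exact ⟨⟨hx, hx'⟩, h1, h2⟩
    · right
      have : Real.sin x ≤ 0 := Real.sin_nonpos_of_nonpos_of_neg_pi_le hx h3.le
      rw [abs_of_nonpos this, ← Real.sin_neg] at h1
      rw [← Real.cos_neg] at h2
      exact ⟨⟨by linarith, by linarith⟩, h1, h2⟩
  have h2 : ENNReal.ofReal (2 * Real.pi) * angleProb {φ | a ≤ |φ.sin| ∧ |φ.cos - c| ≤ u} ≤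
      ENNReal.ofReal (2 * Real.pi) * ENNReal.ofReal (u / a) := by
    rw [h, ← ENNReal.ofReal_mul (by positivity)]
    calc _ ≤ volume P + volume (Neg.neg ⁻¹' P) := (measure_mono hsub).trans (measure_union_le _ _)
      _ = volume P + volume P := by rw [Measure.measure_preimage_neg]
      _ ≤ ENNReal.ofReal (Real.pi * u / a) + ENNReal.ofReal (Real.pi * u / a) :=
          add_le_add hP hP
      _ = _ := by
          rw [← ENNReal.ofReal_add (by positivity) (by positivity)]
          congr 1; ring
  exact (ENNReal.mul_le_mul_iff_right (by simpa using hpi) ENNReal.ofReal_ne_top).1 h2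

theorem angleProb_sin_le {a u c : ℝ} (ha : 0 < a) (hu : 0 ≤ u) :
    angleProb {φ | a ≤ |φ.cos| ∧ |φ.sin - c| ≤ u} ≤ ENNReal.ofReal (u / a) := by
  have hm : MeasurableSet {φ : Real.Angle | a ≤ |φ.sin| ∧ |φ.cos - c| ≤ u} := by
    refine (IsClosed.inter ?_ ?_).measurableSet
    · exact isClosed_le continuous_const Real.Angle.continuous_sin.abs
    · exact isClosed_le (Real.Angle.continuous_cos.sub continuous_const).abs continuous_const
  have h := (measurePreserving_angle_sub ((Real.pi / 2 : ℝ) : Real.Angle)).measure_preimage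
    hm.nullMeasurableSet
  refine le_trans (le_of_eq ?_) (h.trans_le (angleProb_cos_le ha hu))
  congr 1
  ext φ
  simp only [Set.mem_ofPred_eq, Set.mem_preimage, Real.Angle.sin_sub_pi_div_two,
    Real.Angle.cos_sub_pi_div_two, abs_neg]

/-- Single-site bound: a constrained spin is localized by one bond at scale `u`. -/
theorem lintegral_site_le {X : Type*} [MeasurableSpace X] (μ : Measure X) [IsProbabilityMeasure μ]
    {s : X → ℝ} (hs : Measurable s) {T : Set X} (hT : MeasurableSet T) {a u lam : ℝ}
    (hl : 0 < lam) (hu : 0 ≤ u) (c : ℝ)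
    (h : μ (T ∩ {x | |s x - c| ≤ u}) ≤ ENNReal.ofReal a) :
    ∫⁻ x, ENNReal.ofReal (T.indicator 1 x * Real.exp (-lam * (s x - c) ^ 2)) ∂μ ≤
      ENNReal.ofReal a + ENNReal.ofReal (Real.exp (-lam * u ^ 2)) := by
  have hmS : MeasurableSet (T ∩ {x | |s x - c| ≤ u}) :=
    hT.inter (measurableSet_le (by fun_prop) measurable_const)
  calc _ ≤ ∫⁻ x, ((T ∩ {x | |s x - c| ≤ u}).indicator 1 x +
        ENNReal.ofReal (Real.exp (-lam * u ^ 2))) ∂μ := by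
        refine lintegral_mono fun x => ?_
        by_cases hx : x ∈ T
        · by_cases hx2 : |s x - c| ≤ u
          · refine le_add_right ?_
            have hxx : x ∈ T ∩ {x | |s x - c| ≤ u} := ⟨hx, hx2⟩
            rw [Set.indicator_of_mem hxx, Set.indicator_of_mem hx]
            simp only [Pi.one_apply, one_mul]
            rw [ENNReal.ofReal_le_one, Real.exp_le_one_iff]
            nlinarith [mul_nonneg hl.le (sq_nonneg (s x - c))]
          · refine le_add_left (ENNReal.ofReal_le_ofReal ?_)
            rw [Set.indicator_of_mem hx]
            simp only [Pi.one_apply, one_mul]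
            refine Real.exp_le_exp.2 ?_
            have : u ^ 2 ≤ (s x - c) ^ 2 := by
              rw [← sq_abs (s x - c)]
              push Not at hx2
              gcongr
            nlinarith
        · simp [hx]
    _ = μ (T ∩ {x | |s x - c| ≤ u}) + ENNReal.ofReal (Real.exp (-lam * u ^ 2)) := by
        rw [lintegral_add_left (measurable_one.indicator hmS), lintegral_indicator_one hmS]
        simp
    _ ≤ _ := by gcongr

/-- Integrating sites successively, each factor depending only on its own site and later ones. -/
theorem lmarginal_prod_le {V X : Type*} [DecidableEq V] [MeasurableSpace X] (μ : Measure X)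
    [IsProbabilityMeasure μ] (f : V → ℕ) (h : V → (V → X) → ENNReal) (hm : ∀ r, Measurable (h r))
    (hdep : ∀ r r', f r' ≤ f r → r' ≠ r → ∀ φ x, h r' (Function.update φ r x) = h r' φ)
    (b : V → ENNReal) (hb : ∀ r φ, ∫⁻ x, h r (Function.update φ r x) ∂μ ≤ b r)
    (s : Finset V) (φ : V → X) :
    lmarginal (fun _ => μ) s (fun φ => ∏ r ∈ s, h r φ) φ ≤ ∏ r ∈ s, b r := by
  induction s using Finset.induction_on_max_value f with
  | empty => simp
  | insert r s hr hmax ih =>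
    rw [lmarginal_insert' _ (Finset.measurable_prod _ fun r _ => hm r) hr]
    have h1 : ∀ φ : V → X, ∫⁻ x, (∏ r' ∈ insert r s, h r' (Function.update φ r x)) ∂μ ≤
        b r * ∏ r' ∈ s, h r' φ := by
      intro φ
      have h2 : ∀ x, (∏ r' ∈ insert r s, h r' (Function.update φ r x)) =
          h r (Function.update φ r x) * ∏ r' ∈ s, h r' φ := by
        intro x
        rw [Finset.prod_insert hr]
        congr 1
        refine Finset.prod_congr rfl fun r' hr' => hdep r r' (hmax r' hr') ?_ φ x
        rintro rfl; exact hr hr'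
      simp only [h2]
      have hmr : Measurable fun x => h r (Function.update φ r x) :=
        (hm r).comp (measurable_update φ)
      rw [lintegral_mul_const _ hmr]
      gcongr
      exact hb r φ
    refine (lmarginal_mono h1 φ).trans ?_
    rw [Finset.prod_insert hr]
    have : lmarginal (fun _ => μ) s (fun φ => b r * ∏ r' ∈ s, h r' φ) φ =
        b r * lmarginal (fun _ => μ) s (fun φ => ∏ r' ∈ s, h r' φ) φ := by
      rw [lmarginal, lmarginal, lintegral_const_mul]
      exact (Finset.measurable_prod _ fun r _ => hm r).comp measurable_updateFinset
    rw [this]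
    gcongr

/-- Angles staying away from both coordinate axes. -/
def badAngle (a : ℝ) : Set Real.Angle := {φ | a < |φ.sin| ∧ a < |φ.cos|}

theorem measurableSet_badAngle (a : ℝ) : MeasurableSet (badAngle a) :=
  ((isOpen_lt continuous_const Real.Angle.continuous_sin.abs).inter
    (isOpen_lt continuous_const Real.Angle.continuous_cos.abs)).measurableSet

/-- Indicator of the bad angles. -/
noncomputable def badInd (a : ℝ) : Real.Angle → ℝ := (badAngle a).indicator 1

theorem measurable_badInd (a : ℝ) : Measurable (badInd a) :=
  measurable_one.indicator (measurableSet_badAngle a)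

theorem badInd_nonneg (a : ℝ) (φ : Real.Angle) : 0 ≤ badInd a φ :=
  Set.indicator_nonneg (fun _ _ => zero_le_one) φ

theorem badInd_le_one (a : ℝ) (φ : Real.Angle) : badInd a φ ≤ 1 :=
  Set.indicator_le' (g := fun _ => 1) (fun _ _ => le_rfl) (fun _ _ => zero_le_one) φ

theorem ZMod.val_sub_one_add_one {N : ℕ} [NeZero N] {a : ZMod N} (ha : a ≠ 0) :
    (a - 1).val + 1 = a.val := by
  have h0 : a.val ≠ 0 := by rwa [ne_eq, ZMod.val_eq_zero]
  have hlt := ZMod.val_lt a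
  have : a - 1 = ((a.val - 1 : ℕ) : ZMod N) := by
    rw [Nat.cast_sub (by omega), ZMod.natCast_zmod_val, Nat.cast_one]
  rw [this, ZMod.val_natCast, Nat.mod_eq_of_lt (by omega)]
  omega

variable {N : ℕ} [NeZero N]

theorem torusBonds_obs_eq (e : Torus N × Bool) :
    (torusBonds N).obs e = Real.Angle.cos ∨ (torusBonds N).obs e = Real.Angle.sin := by
  by_cases h : Even (if e.2 then e.1.2 else e.1.1).val
  · exact Or.inl (funext fun φ => if_pos h)
  · exact Or.inr (funext fun φ => if_neg h)

theorem measurable_torusBonds_obs (e : Torus N × Bool) : Measurable ((torusBonds N).obs e) := by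
  rcases torusBonds_obs_eq e with h | h <;> rw [h]
  · exact Real.Angle.continuous_cos.measurable
  · exact Real.Angle.continuous_sin.measurable

theorem angleProb_bad_obs_le {a u : ℝ} (ha : 0 < a) (hu : 0 ≤ u) (c : ℝ) (e : Torus N × Bool) :
    angleProb (badAngle a ∩ {x | |(torusBonds N).obs e x - c| ≤ u}) ≤ ENNReal.ofReal (u / a) := by
  rcases torusBonds_obs_eq e with h | h <;> rw [h]
  · refine (measure_mono ?_).trans (angleProb_cos_le (c := c) ha hu)
    exact fun φ h => ⟨h.1.1.le, h.2⟩
  · refine (measure_mono ?_).trans (angleProb_sin_le (c := c) ha hu)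
    exact fun φ h => ⟨h.1.2.le, h.2⟩

theorem card_filter_fst_ne_zero :
    (Finset.univ.filter fun r : Torus N => r.1 ≠ 0).card = N * (N - 1) := by
  have : (Finset.univ.filter fun r : Torus N => r.1 ≠ 0) =
      (Finset.univ.filter fun x : ZMod N => x ≠ 0) ×ˢ Finset.univ := by
    ext r; simp
  rw [this, Finset.card_product, Finset.filter_ne', Finset.card_erase_of_mem (Finset.mem_univ _),
    Finset.card_univ, ZMod.card, mul_comm]

/-- Factor of the row-chain decomposition at the site `r`. -/
noncomputable def chainFactor (a lam : ℝ) (r : Torus N) (φ : Torus N → Real.Angle) : ℝ :=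
  if r.1 = 0 then 1 else (badAngle a).indicator 1 (φ r) *
    Real.exp (-lam * ((torusBonds N).obs (r - (1, 0), false) (φ r) -
      (torusBonds N).obs (r - (1, 0), false) (φ (r - (1, 0)))) ^ 2)

theorem chainFactor_nonneg (a lam : ℝ) (r : Torus N) (φ : Torus N → Real.Angle) :
    0 ≤ chainFactor a lam r φ := by
  unfold chainFactor
  split_ifs
  · exact zero_le_one
  · exact mul_nonneg (badInd_nonneg a _) (Real.exp_pos _).le

theorem measurable_chainFactor (a lam : ℝ) (r : Torus N) :
    Measurable (chainFactor a lam r) := by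
  unfold chainFactor
  by_cases h : r.1 = 0
  · simp only [h, if_true]; exact measurable_const
  · simp only [h, if_false]
    have h1 : ∀ r', Measurable fun φ : Torus N → Real.Angle =>
        (torusBonds N).obs (r - (1, 0), false) (φ r') :=
      fun r' => (measurable_torusBonds_obs _).comp (measurable_pi_apply r')
    exact ((measurable_badInd a).comp (measurable_pi_apply r)).mul
      (Real.measurable_exp.comp ((((h1 r).sub (h1 _)).pow_const 2).const_mul _))

theorem patWeight_univ_le_prod_chainFactor {lam : ℝ} (hl : 0 < lam) (a : ℝ)
    (φ : Torus N → Real.Angle) :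
    (torusBonds N).patWeight (badInd a) lam Finset.univ ∅ φ ≤ ∏ r, chainFactor a lam r φ := by
  have h1 : ∏ e, gaussKer lam (e ∈ (∅ : Finset (Torus N × Bool))) ((torusBonds N).grad e φ) ≤
      ∏ r : Torus N, gaussKer lam False ((torusBonds N).grad (r - (1, 0), false) φ) := by
    rw [Fintype.prod_prod_type_right, Fintype.prod_bool]
    refine (mul_le_of_le_one_left (Finset.prod_nonneg fun _ _ => (gaussKer_pos _ _ _).le)
      (Finset.prod_le_one (fun _ _ => (gaussKer_pos _ _ _).le)
        fun _ _ => gaussKer_le_one hl _ _)).trans (le_of_eq ?_)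
    refine (Fintype.prod_equiv (Equiv.subRight ((1, 0) : Torus N)) _ _ fun r => ?_).symm
    exact gaussKer_congr _ (by simp) _
  rw [BondSystem.patWeight]
  refine (mul_le_mul_of_nonneg_left h1
    (Finset.prod_nonneg fun _ _ => badInd_nonneg _ _)).trans ?_
  rw [← Finset.prod_mul_distrib]
  refine Finset.prod_le_prod
    (fun r _ => mul_nonneg (badInd_nonneg _ _) (gaussKer_pos _ _ _).le) fun r _ => ?_
  unfold chainFactor
  split_ifs with h
  · exact mul_le_one₀ (badInd_le_one _ _) (gaussKer_pos _ _ _).le (gaussKer_le_one hl _ _)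
  · refine mul_le_mul_of_nonneg_left (le_of_eq ?_) (badInd_nonneg _ _)
    simp only [gaussKer, if_false, BondSystem.grad]
    congr 2
    rw [← neg_sq, neg_sub]
    simp [torusBonds]

theorem patZ_univ_le {a u lam : ℝ} (ha : 0 < a) (hu : 0 ≤ u) (hl : 0 < lam) :
    (torusBonds N).patZ angleProb (badInd a) lam Finset.univ ∅ ≤
      (u / a + Real.exp (-lam * u ^ 2)) ^ (N * (N - 1)) := by
  set κ := u / a + Real.exp (-lam * u ^ 2)
  have hκ : 0 ≤ κ := by positivity
  have hmarg := lmarginal_prod_le angleProb (fun r : Torus N => r.1.val)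
    (fun r φ => ENNReal.ofReal (chainFactor a lam r φ))
    (fun r => (measurable_chainFactor a lam r).ennreal_ofReal)
    (by
      intro r r' hle hne φ x
      unfold chainFactor
      by_cases h : r'.1 = 0
      · simp [h]
      · have h2 : r' - (1, 0) ≠ r := by
          rintro rfl
          have := ZMod.val_sub_one_add_one h
          simp only [Prod.fst_sub] at hle
          omega
        simp [h, Function.update_of_ne hne, Function.update_of_ne h2])
    (fun r => if r.1 = 0 then 1 else ENNReal.ofReal κ)
    (by
      intro r φ
      unfold chainFactor
      by_cases h : r.1 = 0
      · simp [h]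
      · have h2 : r - (1, 0) ≠ r := by
          intro h3
          have := ZMod.val_sub_one_add_one h
          have h4 := congrArg (fun r : Torus N => r.1.val) h3
          simp only [Prod.fst_sub] at h4
          omega
        simp only [h, if_false, Function.update_self, Function.update_of_ne h2]
        refine (lintegral_site_le angleProb (measurable_torusBonds_obs (r - (1, 0), false))
          (measurableSet_badAngle a) hl hu _ (angleProb_bad_obs_le ha hu _ _)).trans (le_of_eq ?_)
        rw [← ENNReal.ofReal_add (by positivity) (by positivity)])
    Finset.univ
  rw [BondSystem.patZ, integral_eq_lintegral_of_nonneg_ae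
    (Filter.Eventually.of_forall fun φ => (torusBonds N).patWeight_nonneg (badInd_nonneg a) _ _ _ φ)
    ((torusBonds N).measurable_patWeight measurable_torusBonds_obs
      (measurable_badInd a) _ _ _).aestronglyMeasurable]
  refine ENNReal.toReal_le_of_le_ofReal (by positivity) ?_
  calc _ ≤ ∫⁻ φ, ∏ r, ENNReal.ofReal (chainFactor a lam r φ) ∂(Measure.pi fun _ => angleProb) := by
        refine lintegral_mono fun φ => ?_
        rw [← ENNReal.ofReal_prod_of_nonneg fun r _ => chainFactor_nonneg _ _ _ _]
        exact ENNReal.ofReal_le_ofReal (patWeight_univ_le_prod_chainFactor hl a φ)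
    _ = _ := lintegral_eq_lmarginal_univ (μ := fun _ : Torus N => angleProb) (fun _ => 0)
    _ ≤ _ := hmarg _
    _ = _ := by
        rw [ENNReal.ofReal_pow hκ, ← card_filter_fst_ne_zero, Finset.prod_ite]
        simp

/-- Angles in the right half-plane with sine in the `i`-th cell of width `w`. -/
def cellAngle (w : ℝ) (i : ℕ) : Set Real.Angle :=
  {φ | 0 < φ.cos ∧ i * w ≤ φ.sin ∧ φ.sin < (i + 1) * w}

theorem measurableSet_cellAngle (w : ℝ) (i : ℕ) : MeasurableSet (cellAngle w i) := by
  have h1 := Real.Angle.continuous_cos.measurable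
  have h2 := Real.Angle.continuous_sin.measurable
  exact (measurableSet_lt measurable_const h1).inter
    ((measurableSet_le measurable_const h2).inter (measurableSet_lt h2 measurable_const))

theorem le_angleProb_cellAngle {w : ℝ} {i : ℕ} (hw : 0 < w) (hi : (i + 1) * w ≤ 1) :
    ENNReal.ofReal (w / (2 * Real.pi)) ≤ angleProb (cellAngle w i) := by
  have hpi := Real.pi_pos
  have h := angleProb_apply (-Real.pi) (measurableSet_cellAngle w i)
  have hiw : 0 ≤ i * w := by positivity
  have hsub : Set.Ico (Real.arcsin (i * w)) (Real.arcsin ((i + 1) * w)) ⊆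
      (fun x : ℝ => (x : Real.Angle)) ⁻¹' (cellAngle w i) ∩
      Set.Ioc (-Real.pi) (-Real.pi + 2 * Real.pi) := by
    rintro x ⟨h1, h2⟩
    have h0 : 0 ≤ x := (Real.arcsin_nonneg.2 hiw).trans h1
    have h3 : x < Real.pi / 2 := h2.trans_le (Real.arcsin_le_pi_div_two _)
    have h4 : x ∈ Set.Icc (-(Real.pi / 2)) (Real.pi / 2) := ⟨by linarith, h3.le⟩
    refine ⟨⟨?_, ?_, ?_⟩, ?_, ?_⟩
    · rw [Real.Angle.cos_coe]
      exact Real.cos_pos_of_mem_Ioo ⟨by linarith, h3⟩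
    · rw [Real.Angle.sin_coe]
      exact (Real.arcsin_le_iff_le_sin' ⟨h4.1, h3⟩).1 h1
    · rw [Real.Angle.sin_coe]
      exact (Real.lt_arcsin_iff_sin_lt' ⟨h4.1, h3⟩).1 h2
    · linarith
    · linarith
  have hlen : w ≤ Real.arcsin ((i + 1) * w) - Real.arcsin (i * w) := by
    have hle : Real.arcsin (i * w) ≤ Real.arcsin ((i + 1) * w) :=
      Real.monotone_arcsin (by nlinarith)
    have h1 : |Real.sin (Real.arcsin ((i + 1) * w)) - Real.sin (Real.arcsin (i * w))| ≤
        |Real.arcsin ((i + 1) * w) - Real.arcsin (i * w)| := by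
      have := Real.lipschitzWith_sin.dist_le_mul (Real.arcsin ((i + 1) * w)) (Real.arcsin (i * w))
      simpa [Real.dist_eq] using this
    rw [Real.sin_arcsin (by linarith) hi, Real.sin_arcsin (by linarith) (by nlinarith),
      abs_of_nonneg (a := Real.arcsin _ - _) (by linarith)] at h1
    have := le_abs_self ((i + 1) * w - i * w)
    linarith
  have h2 : ENNReal.ofReal (2 * Real.pi) * ENNReal.ofReal (w / (2 * Real.pi)) ≤
      ENNReal.ofReal (2 * Real.pi) * angleProb (cellAngle w i) := by
    rw [h, ← ENNReal.ofReal_mul (by positivity), mul_div_cancel₀ _ (by positivity)]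
    refine (ENNReal.ofReal_le_ofReal hlen).trans ?_
    rw [← Real.volume_Ico]
    exact measure_mono hsub
  exact (ENNReal.mul_le_mul_iff_right (by simpa using hpi) ENNReal.ofReal_ne_top).1 h2

theorem cellAngle_eq_of_mem {w : ℝ} (hw : 0 < w) {i j : ℕ} {φ : Real.Angle}
    (hi : φ ∈ cellAngle w i) (hj : φ ∈ cellAngle w j) : i = j := by
  obtain ⟨-, h1, h2⟩ := hi
  obtain ⟨-, h3, h4⟩ := hj
  have e1 : (i : ℝ) < j + 1 := lt_of_mul_lt_mul_right (h1.trans_lt h4) hw.le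
  have e2 : (j : ℝ) < i + 1 := lt_of_mul_lt_mul_right (h3.trans_lt h2) hw.le
  norm_cast at e1 e2
  omega

theorem abs_cos_sub_cos_le_of_mem_cellAngle {w : ℝ} (hw : 0 < w) {i j m : ℕ}
    (hm : (m : ℝ) ^ 2 * w ≤ 1) (him : i < m) (hjm : j < m) {φ ψ : Real.Angle}
    (hi : φ ∈ cellAngle w i) (hj : ψ ∈ cellAngle w j) : |φ.cos - ψ.cos| ≤ w := by
  have key : ∀ {i : ℕ} {φ : Real.Angle}, i < m → φ ∈ cellAngle w i → 1 - w ≤ φ.cos ∧ φ.cos ≤ 1 := by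
    intro i φ him hi
    obtain ⟨h0, h1, h2⟩ := hi
    have hle : φ.cos ≤ 1 := by
      have := Real.Angle.cos_sq_add_sin_sq φ
      nlinarith [sq_nonneg φ.sin]
    refine ⟨?_, hle⟩
    have hs0 : 0 ≤ φ.sin := le_trans (by positivity) h1
    have hs1 : φ.sin ≤ m * w := by
      have : ((i : ℝ) + 1) ≤ m := by exact_mod_cast him
      nlinarith
    have hs2 : φ.sin ^ 2 ≤ w := by
      calc φ.sin ^ 2 ≤ (m * w) ^ 2 := by gcongr
        _ = m ^ 2 * w * w := by ring
        _ ≤ 1 * w := by gcongr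
        _ = w := one_mul w
    have := Real.Angle.cos_sq_add_sin_sq φ
    nlinarith
  have h1 := key him hi
  have h2 := key hjm hj
  rw [abs_le]
  constructor <;> linarith [h1.1, h1.2, h2.1, h2.2]

theorem abs_sin_sub_sin_le_of_mem_cellAngle {w : ℝ} {i : ℕ} {φ ψ : Real.Angle}
    (hi : φ ∈ cellAngle w i) (hj : ψ ∈ cellAngle w i) : |φ.sin - ψ.sin| ≤ w := by
  obtain ⟨-, h1, h2⟩ := hi
  obtain ⟨-, h3, h4⟩ := hj
  rw [abs_le]
  constructor <;> linarith

variable {N : ℕ} [NeZero N]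

/-- Index of the pair `{2j - 1, 2j}` containing `x`. -/
def pairIndex (n : ℕ) [NeZero n] (x : ZMod N) : Fin n := Fin.ofNat n ((x.val + 1) / 2)

theorem pairIndex_add_one {n : ℕ} [NeZero n] (hN : N = n + n) (x : ZMod N) (hx : ¬ Even x.val) :
    pairIndex n (x + 1) = pairIndex n x := by
  have hlt := ZMod.val_lt x
  rw [Nat.not_even_iff_odd] at hx
  obtain ⟨j, hj⟩ := hx
  have hn := NeZero.pos n
  have : (x + 1).val = (x.val + 1) % N := by
    rw [ZMod.val_add, ZMod.val_one_eq_one_mod, Nat.add_mod_mod]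
  ext
  simp only [pairIndex, Fin.val_ofNat, this]
  rcases Nat.lt_or_ge (x.val + 1) N with h | h
  · rw [Nat.mod_eq_of_lt h]
    congr 1
    omega
  · have h2 : x.val + 1 = N := by omega
    rw [h2, Nat.mod_self, show N / 2 = n by omega, Nat.mod_self]
    exact Nat.zero_mod n

theorem pairIndex_surjective {n : ℕ} [NeZero n] (hN : N = n + n) :
    Function.Surjective (pairIndex n : ZMod N → Fin n) := by
  intro j
  refine ⟨((2 * j.val : ℕ) : ZMod N), ?_⟩
  have := j.isLt
  ext
  rw [pairIndex, ZMod.val_natCast, Nat.mod_eq_of_lt (by omega), Fin.val_ofNat,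
    show (2 * j.val + 1) / 2 = j.val by omega, Nat.mod_eq_of_lt this]

theorem abs_grad_le_of_mem_cellAngle {n m : ℕ} [NeZero n] (hN : N = n + n) {w : ℝ} (hw : 0 < w)
    (hm : (m : ℝ) ^ 2 * w ≤ 1) (σ : Fin n × Fin n → Fin m) (φ : Torus N → Real.Angle)
    (hφ : ∀ r, φ r ∈ cellAngle w (σ (pairIndex n r.1, pairIndex n r.2))) (e : Torus N × Bool) :
    |(torusBonds N).grad e φ| ≤ w := by
  obtain ⟨⟨x, y⟩, b⟩ := e
  by_cases hx : Even (if b then y else x).val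
  · have ho : (torusBonds N).obs ((x, y), b) = Real.Angle.cos := funext fun φ => if_pos hx
    rw [BondSystem.grad, ho]
    exact abs_cos_sub_cos_le_of_mem_cellAngle hw hm (Fin.is_lt _) (Fin.is_lt _) (hφ _) (hφ _)
  · have ho : (torusBonds N).obs ((x, y), b) = Real.Angle.sin := funext fun φ => if_neg hx
    rw [BondSystem.grad, ho]
    refine abs_sin_sub_sin_le_of_mem_cellAngle (hφ (x, y)) ?_
    have := hφ ((torusBonds N).tgt ((x, y), b))
    cases b
    · simpa [torusBonds, pairIndex_add_one hN x hx] using this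
    · simpa [torusBonds, pairIndex_add_one hN y hx] using this

theorem le_patZ_empty {n m : ℕ} [NeZero n] (hN : N = n + n) {w lam : ℝ} (hw : 0 < w)
    (hl : 0 < lam) (hlw : lam * w ^ 2 ≤ 1) (hm : (m : ℝ) ^ 2 * w ≤ 1) (χ : Real.Angle → ℝ) :
    (Real.exp (-2) * (w / (2 * Real.pi))) ^ (N ^ 2) * (m : ℝ) ^ (n ^ 2) ≤
      (torusBonds N).patZ angleProb χ lam ∅ ∅ := by
  have hpi := Real.pi_pos
  set box : (Fin n × Fin n → Fin m) → Set (Torus N → Real.Angle) := fun σ =>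
    Set.univ.pi fun r => cellAngle w (σ (pairIndex n r.1, pairIndex n r.2))
  have hmeas : ∀ σ, MeasurableSet (box σ) := fun σ =>
    MeasurableSet.univ_pi fun r => measurableSet_cellAngle _ _
  have hdisj : Pairwise (Function.onFun Disjoint box) := by
    intro σ σ' hne
    refine Set.disjoint_left.2 fun φ h h' => hne (funext fun ij => ?_)
    obtain ⟨x, hx⟩ := pairIndex_surjective hN ij.1
    obtain ⟨y, hy⟩ := pairIndex_surjective hN ij.2
    have h1 := h (x, y) trivial
    have h2 := h' (x, y) trivial
    simp only [hx, hy] at h1 h2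
    exact Fin.ext (cellAngle_eq_of_mem hw h1 h2)
  have hbox : ∀ σ, ENNReal.ofReal ((w / (2 * Real.pi)) ^ (N ^ 2)) ≤
      (Measure.pi fun _ : Torus N => angleProb) (box σ) := by
    intro σ
    rw [Measure.pi_pi]
    calc ENNReal.ofReal ((w / (2 * Real.pi)) ^ (N ^ 2)) =
        ∏ _r : Torus N, ENNReal.ofReal (w / (2 * Real.pi)) := by
          rw [Finset.prod_const, Finset.card_univ, Fintype.card_prod, ZMod.card,
            ENNReal.ofReal_pow (by positivity), sq]
      _ ≤ _ := by
          refine Finset.prod_le_prod' fun r _ => le_angleProb_cellAngle hw ?_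
          set i := σ (pairIndex n r.1, pairIndex n r.2)
          have hi : ((i : ℕ) : ℝ) + 1 ≤ m := by exact_mod_cast i.isLt
          have h1 : (1 : ℝ) ≤ m := by linarith [Nat.cast_nonneg (α := ℝ) (i : ℕ)]
          nlinarith [mul_le_mul_of_nonneg_right hi hw.le,
            mul_nonneg (mul_nonneg (sub_nonneg.2 h1) (zero_le_one.trans h1)) hw.le]
  have hU : ENNReal.ofReal ((w / (2 * Real.pi)) ^ (N ^ 2) * (m : ℝ) ^ (n ^ 2)) ≤
      (Measure.pi fun _ : Torus N => angleProb) (⋃ σ, box σ) := by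
    rw [measure_iUnion hdisj hmeas, tsum_fintype]
    calc _ = ∑ _σ : Fin n × Fin n → Fin m, ENNReal.ofReal ((w / (2 * Real.pi)) ^ (N ^ 2)) := by
          rw [Finset.sum_const, Finset.card_univ, Fintype.card_fun, Fintype.card_prod,
            Fintype.card_fin, Fintype.card_fin, nsmul_eq_mul, mul_comm,
            ENNReal.ofReal_mul (by positivity), ← sq]
          congr 1
          rw [← Nat.cast_pow, ENNReal.ofReal_natCast]
      _ ≤ _ := Finset.sum_le_sum fun σ _ => hbox σ
  have hlow : ∀ φ ∈ ⋃ σ, box σ, Real.exp (-2) ^ (N ^ 2) ≤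
      (torusBonds N).patWeight χ lam ∅ ∅ φ := by
    intro φ hφ
    obtain ⟨σ, hσ⟩ := Set.mem_iUnion.1 hφ
    have hg := abs_grad_le_of_mem_cellAngle hN hw hm σ φ (fun r => hσ r trivial)
    rw [BondSystem.patWeight, Finset.prod_empty, one_mul]
    calc Real.exp (-2) ^ (N ^ 2) = ∏ _e : Torus N × Bool, Real.exp (-1) := by
          rw [Finset.prod_const, Finset.card_univ]
          simp only [Fintype.card_prod, ZMod.card, Fintype.card_bool]
          rw [← Real.exp_nat_mul, ← Real.exp_nat_mul]
          congr 1
          push_cast; ring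
      _ ≤ _ := by
          refine Finset.prod_le_prod (fun _ _ => (Real.exp_pos _).le) fun e _ => ?_
          rw [gaussKer, if_neg (by simp), Real.exp_le_exp]
          have h2 : (torusBonds N).grad e φ ^ 2 ≤ w ^ 2 := sq_le_sq' (abs_le.1 (hg e)).1 (abs_le.1 (hg e)).2
          nlinarith
  have hint : Integrable ((torusBonds N).patWeight χ lam ∅ ∅)
      (Measure.pi fun _ : Torus N => angleProb) := by
    refine Integrable.of_bound (C := 1) ?_ (Filter.Eventually.of_forall fun φ => ?_)
    · unfold BondSystem.patWeight
      simp only [Finset.prod_empty, one_mul]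
      exact (Finset.measurable_prod _ fun e _ => (measurable_gaussKer _ _).comp
        ((torusBonds N).measurable_grad measurable_torusBonds_obs e)).aestronglyMeasurable
    · simp only [BondSystem.patWeight, Finset.prod_empty, one_mul]
      rw [Real.norm_of_nonneg (Finset.prod_nonneg fun _ _ => (gaussKer_pos _ _ _).le)]
      exact Finset.prod_le_one (fun _ _ => (gaussKer_pos _ _ _).le)
        fun _ _ => gaussKer_le_one hl _ _
  have hmU : MeasurableSet (⋃ σ, box σ) := MeasurableSet.iUnion hmeas
  calc _ = Real.exp (-2) ^ (N ^ 2) * ((w / (2 * Real.pi)) ^ (N ^ 2) * (m : ℝ) ^ (n ^ 2)) := by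
        rw [mul_pow]; ring
    _ ≤ Real.exp (-2) ^ (N ^ 2) * (Measure.pi fun _ : Torus N => angleProb).real (⋃ σ, box σ) := by
        refine mul_le_mul_of_nonneg_left ?_ (by positivity)
        exact (ENNReal.ofReal_le_iff_le_toReal (measure_ne_top _ _)).1 hU
    _ = ∫ φ, (⋃ σ, box σ).indicator (fun _ => Real.exp (-2) ^ (N ^ 2)) φ
          ∂(Measure.pi fun _ : Torus N => angleProb) := by
        rw [integral_indicator_const _ hmU, smul_eq_mul, mul_comm]
    _ ≤ _ := by
        refine integral_mono ((integrable_const _).indicator hmU) hint fun φ => ?_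
        refine Set.indicator_le' (hlow) (fun φ _ => ?_) φ
        simp only [BondSystem.patWeight, Finset.prod_empty, one_mul]
        exact Finset.prod_nonneg fun _ _ => (gaussKer_pos _ _ _).le

variable {N : ℕ} [NeZero N]

theorem patZ_univ_le_pow_mul {n : ℕ} [NeZero n] (hN : N = n + n) (hn : 16 ≤ n) {a q K : ℝ}
    (ha : 0 < a) (hq : 0 < q) (hK : 1 ≤ K) (hexp : K ^ 31 ≤ Real.exp (K ^ 2))
    (hlarge : 2 * (1 / a + 1) ^ 4 ≤ (q * (Real.exp (-2) / (2 * Real.pi))) ^ 4 * K ^ 8) :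
    (torusBonds N).patZ angleProb (badInd a) (K ^ 64) Finset.univ ∅ ≤
      q ^ (N ^ 2) * (torusBonds N).patZ angleProb (badInd a) (K ^ 64) ∅ ∅ := by
  have hpi := Real.pi_pos
  have hK0 : 0 < K := one_pos.trans_le hK
  set m : ℕ := ⌊K ^ 16⌋₊
  set c : ℝ := Real.exp (-2) / (2 * Real.pi) with hc
  set κ : ℝ := (1 / a + 1) * (K ^ 31)⁻¹ with hκ
  have hm1 : 1 ≤ m := Nat.one_le_floor_iff _ |>.2 (one_le_pow₀ hK)
  have hmle : (m : ℝ) ≤ K ^ 16 := Nat.floor_le (by positivity)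
  have hmge : K ^ 16 ≤ 2 * m := by
    have h1 := Nat.lt_floor_add_one (K ^ 16)
    have h2 : (1 : ℝ) ≤ m := by exact_mod_cast hm1
    linarith
  have hupper := patZ_univ_le (N := N) ha (u := (K ^ 31)⁻¹) (by positivity)
    (lam := K ^ 64) (by positivity)
  have hlower := le_patZ_empty hN (m := m) (w := (K ^ 32)⁻¹) (lam := K ^ 64) (by positivity)
    (by positivity) (by rw [inv_pow, ← pow_mul]; exact (mul_inv_cancel₀ (by positivity)).le)
    (by
      calc (m : ℝ) ^ 2 * (K ^ 32)⁻¹ ≤ (K ^ 16) ^ 2 * (K ^ 32)⁻¹ := by gcongr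
        _ = 1 := by rw [← pow_mul]; exact mul_inv_cancel₀ (by positivity)) (badInd a)
  have hκle : (K ^ 31)⁻¹ / a + Real.exp (-K ^ 64 * ((K ^ 31)⁻¹) ^ 2) ≤ κ := by
    have h1 : -K ^ 64 * ((K ^ 31)⁻¹) ^ 2 = -K ^ 2 := by field_simp
    have h2 : Real.exp (-K ^ 2) ≤ (K ^ 31)⁻¹ := by
      rw [Real.exp_neg]
      exact inv_anti₀ (by positivity) hexp
    rw [h1, hκ, add_mul, one_mul, div_eq_mul_inv, one_div, mul_comm]
    gcongr
  have hκ1 : 1 ≤ κ * K ^ 31 := by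
    rw [hκ, mul_assoc, inv_mul_cancel₀ (by positivity), mul_one]
    have : 0 < 1 / a := by positivity
    linarith
  have hκ0 : 0 < κ := by positivity
  have hκN : κ ^ (N * (N - 1)) ≤ (κ * K) ^ (4 * n ^ 2) := by
    have e1 : 4 * n ^ 2 = N * (N - 1) + 2 * n := by
      subst hN
      obtain ⟨k, rfl⟩ : ∃ k, n = k + 1 := ⟨n - 1, by omega⟩
      rw [show k + 1 + (k + 1) - 1 = 2 * k + 1 by omega]
      ring
    calc κ ^ (N * (N - 1)) = κ ^ (N * (N - 1)) * 1 := (mul_one _).symm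
      _ ≤ κ ^ (N * (N - 1)) * (κ * K ^ 31) ^ (2 * n) := by
        gcongr
        exact one_le_pow₀ hκ1
      _ = κ ^ (4 * n ^ 2) * K ^ (62 * n) := by
        rw [mul_pow κ, ← pow_mul, e1, pow_add, show 31 * (2 * n) = 62 * n by ring, mul_assoc]
      _ ≤ κ ^ (4 * n ^ 2) * K ^ (4 * n ^ 2) := by
        gcongr ?_ * ?_
        exact pow_le_pow_right₀ hK (by nlinarith)
      _ = _ := (mul_pow _ _ _).symm
  have hbase : (κ * K) ^ 4 ≤ q ^ 4 * ((c * (K ^ 32)⁻¹) ^ 4 * m) := by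
    have h1 : (κ * K) ^ 4 = (1 / a + 1) ^ 4 * (K ^ 120)⁻¹ := by
      rw [hκ]; field_simp
    have h2 : q ^ 4 * ((c * (K ^ 32)⁻¹) ^ 4 * K ^ 16) = (q * c) ^ 4 * K ^ 8 * (K ^ 120)⁻¹ := by
      field_simp
    calc (κ * K) ^ 4 ≤ (q * c) ^ 4 * K ^ 8 / 2 * (K ^ 120)⁻¹ := by
          rw [h1]; gcongr; linarith
      _ = q ^ 4 * ((c * (K ^ 32)⁻¹) ^ 4 * K ^ 16) / 2 := by rw [h2]; ring
      _ ≤ q ^ 4 * ((c * (K ^ 32)⁻¹) ^ 4 * (2 * m)) / 2 := by gcongr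
      _ = _ := by ring
  have hN2 : N ^ 2 = 4 * n ^ 2 := by subst hN; ring
  calc _ ≤ κ ^ (N * (N - 1)) := hupper.trans (by gcongr)
    _ ≤ ((κ * K) ^ 4) ^ (n ^ 2) := by rw [← pow_mul]; exact hκN
    _ ≤ (q ^ 4 * ((c * (K ^ 32)⁻¹) ^ 4 * m)) ^ (n ^ 2) := by gcongr
    _ = q ^ (N ^ 2) * ((Real.exp (-2) * ((K ^ 32)⁻¹ / (2 * Real.pi))) ^ (N ^ 2) *
          (m : ℝ) ^ (n ^ 2)) := by
        rw [mul_pow, mul_pow, ← pow_mul, ← pow_mul, hN2, hc]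
        congr 3
        ring
    _ ≤ _ := by gcongr

theorem exists_patZ_univ_le_pow_mul {a q : ℝ} (ha : 0 < a) (hq : 0 < q) :
    ∃ lam₀ : ℝ, 0 < lam₀ ∧ ∀ lam, lam₀ ≤ lam → ∀ (N : ℕ) [NeZero N], Even N → 32 ≤ N →
      (torusBonds N).patZ angleProb (badInd a) lam Finset.univ ∅ ≤
        q ^ (N ^ 2) * (torusBonds N).patZ angleProb (badInd a) lam ∅ ∅ := by
  have hpi := Real.pi_pos
  have h1 : ∀ᶠ K : ℝ in Filter.atTop, K ^ 31 ≤ Real.exp (K ^ 2) := by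
    have h := (Real.tendsto_exp_div_pow_atTop 31).eventually_ge_atTop 1
    filter_upwards [h, Filter.eventually_ge_atTop 1] with K hK h1
    rw [one_le_div (by positivity)] at hK
    exact hK.trans (Real.exp_le_exp.2 (by nlinarith))
  have h2 : ∀ᶠ K : ℝ in Filter.atTop,
      2 * (1 / a + 1) ^ 4 ≤ (q * (Real.exp (-2) / (2 * Real.pi))) ^ 4 * K ^ 8 :=
    ((Filter.tendsto_pow_atTop (by norm_num)).const_mul_atTop
      (by positivity)).eventually_ge_atTop _
  have h3 := (tendsto_rpow_atTop (show (0 : ℝ) < 1 / 64 by norm_num)).eventually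
    ((h1.and h2).and (Filter.eventually_ge_atTop 1))
  obtain ⟨l, hl⟩ := Filter.eventually_atTop.1 (h3.and (Filter.eventually_gt_atTop 0))
  refine ⟨l, (hl l le_rfl).2, fun lam hlam N _ hN hN32 => ?_⟩
  obtain ⟨⟨⟨ha1, ha2⟩, ha3⟩, h0⟩ := hl lam hlam
  obtain ⟨n, hn⟩ := hN
  have : NeZero n := ⟨by omega⟩
  have h := patZ_univ_le_pow_mul hn (by omega) ha hq ha3 ha1 ha2
  rwa [← Real.rpow_natCast, ← Real.rpow_mul h0.le,
    show (1 : ℝ) / 64 * ((64 : ℕ) : ℝ) = 1 by norm_num, Real.rpow_one] at h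

variable {N : ℕ} [NeZero N]

theorem exists_apriori_eq_smul (N : ℕ) [NeZero N] : ∃ c : ENNReal, c ≠ 0 ∧ c ≠ ⊤ ∧
    apriori N = c • Measure.pi fun _ : Torus N => angleProb := by
  have hpi := Real.pi_pos
  refine ⟨ENNReal.ofReal (√(2 * Real.pi) / (2 * Real.pi)) ^ (N ^ 2) *
    ∏ _r : Torus N, ENNReal.ofReal (2 * Real.pi), ?_, ?_, ?_⟩
  · refine mul_ne_zero (pow_ne_zero _ ?_) (Finset.prod_ne_zero_iff.2 fun _ _ => ?_)
    · exact (ENNReal.ofReal_pos.2 (by positivity)).ne'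
    · exact (ENNReal.ofReal_pos.2 (by positivity)).ne'
  · exact ENNReal.mul_ne_top (ENNReal.pow_ne_top ENNReal.ofReal_ne_top)
      (ENNReal.prod_ne_top fun _ _ => ENNReal.ofReal_ne_top)
  · have : IsFiniteMeasure (volume : Measure Real.Angle) := by
      rw [volume_angle_eq]
      exact Measure.smul_finite _ ENNReal.ofReal_ne_top
    have h : (Measure.pi fun _ : Torus N => (volume : Measure Real.Angle)) =
        (∏ _r : Torus N, ENNReal.ofReal (2 * Real.pi)) • Measure.pi fun _ : Torus N => angleProb := by
      refine Measure.pi_eq fun s _ => ?_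
      rw [Measure.smul_apply, Measure.pi_pi, smul_eq_mul, ← Finset.prod_mul_distrib]
      simp only [volume_angle_eq, Measure.smul_apply, smul_eq_mul]
    rw [apriori, h, smul_smul]

theorem sum_sq_add_sq_obs (hN : Even N) (b : Bool) (φ : Cfg N) :
    ∑ r : Torus N, (((torusBonds N).obs (r, b) (φ r)) ^ 2 +
      ((torusBonds N).obs (r, b) (φ ((torusBonds N).tgt (r, b)))) ^ 2) = (N : ℝ) ^ 2 := by
  set v : Torus N := if b then (0, 1) else (1, 0)
  have htgt : ∀ r : Torus N, (torusBonds N).tgt (r, b) = r + v := fun r => by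
    cases b <;> simp [torusBonds, v]
  have hobs : ∀ (r : Torus N) (θ : Real.Angle), ((torusBonds N).obs (r, b) θ) ^ 2 +
      ((torusBonds N).obs (r + v, b) θ) ^ 2 = 1 := by
    intro r θ
    have hcs := Real.Angle.cos_sq_add_sin_sq θ
    have hcs' := (add_comm _ _).trans hcs
    cases b
    · have h := not_even_val_add_one hN r.1
      by_cases hr : Even r.1.val <;> simp [torusBonds, v, h, hr, hcs, hcs']
    · have h := not_even_val_add_one hN r.2
      by_cases hr : Even r.2.val <;> simp [torusBonds, v, h, hr, hcs, hcs']
  have hshift := Equiv.sum_comp (Equiv.addRight v) fun r : Torus N => ((torusBonds N).obs (r, b) (φ r)) ^ 2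
  rw [Finset.sum_add_distrib, ← hshift, ← Finset.sum_add_distrib]
  simp only [Equiv.coe_addRight, htgt]
  rw [Finset.sum_congr rfl fun r _ => (add_comm _ _).trans (hobs r (φ (r + v)))]
  simp [sq]

theorem neg_hamA_eq (hN : Even N) (J : ℝ) (φ : Cfg N) :
    -hamA N J J φ = J * (N : ℝ) ^ 2 - J / 2 * ∑ e, ((torusBonds N).grad e φ) ^ 2 := by
  have h1 : -hamA N J J φ = J * ∑ b : Bool, ∑ r : Torus N, (torusBonds N).obs (r, b) (φ r) *
      (torusBonds N).obs (r, b) (φ ((torusBonds N).tgt (r, b))) := by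
    have hsplit : ∀ (P : Torus N → Prop) [DecidablePred P] (x z : Torus N → ℝ),
        ∑ r, (if P r then x r else z r) =
          (∑ r, if P r then x r else 0) + ∑ r, if ¬ P r then z r else 0 := by
      intro P _ x z
      rw [← Finset.sum_add_distrib]
      exact Finset.sum_congr rfl fun r _ => by by_cases h : P r <;> simp [h]
    rw [Fintype.sum_bool]
    have e1 : ∀ (r : Torus N) (θ θ' : Real.Angle), (torusBonds N).obs (r, true) θ *
        (torusBonds N).obs (r, true) θ' =
        if Even r.2.val then θ.cos * θ'.cos else θ.sin * θ'.sin := fun r θ θ' => by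
      by_cases h : Even r.2.val <;> simp [torusBonds, h]
    have e2 : ∀ (r : Torus N) (θ θ' : Real.Angle), (torusBonds N).obs (r, false) θ *
        (torusBonds N).obs (r, false) θ' =
        if Even r.1.val then θ.cos * θ'.cos else θ.sin * θ'.sin := fun r θ θ' => by
      by_cases h : Even r.1.val <;> simp [torusBonds, h]
    simp only [e1, e2]
    rw [hsplit (fun r : Torus N => Even r.2.val), hsplit (fun r : Torus N => Even r.1.val)]
    simp only [hamA, ham, spinOf, torusBonds, if_true, Bool.false_eq_true, if_false]
    ring
  have h2 : ∑ e, ((torusBonds N).grad e φ) ^ 2 = 2 * (N : ℝ) ^ 2 -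
      2 * ∑ b : Bool, ∑ r : Torus N, (torusBonds N).obs (r, b) (φ r) *
      (torusBonds N).obs (r, b) (φ ((torusBonds N).tgt (r, b))) := by
    have h3 : 2 * (N : ℝ) ^ 2 = ∑ b : Bool, ∑ r : Torus N, (((torusBonds N).obs (r, b) (φ r)) ^ 2 +
      ((torusBonds N).obs (r, b) (φ ((torusBonds N).tgt (r, b)))) ^ 2) := by
      simp only [sum_sq_add_sq_obs hN]
      simp
    rw [h3, Finset.mul_sum, ← Finset.sum_sub_distrib, Fintype.sum_prod_type_right]
    refine Finset.sum_congr rfl fun b _ => ?_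
    rw [Finset.mul_sum, ← Finset.sum_sub_distrib]
    refine Finset.sum_congr rfl fun r _ => ?_
    simp only [BondSystem.grad, show (torusBonds N).src (r, b) = r from rfl]
    ring
  rw [h1, h2]
  ring

theorem exp_neg_mul_hamA_eq (hN : Even N) (β J : ℝ) (χ : Real.Angle → ℝ) (φ : Cfg N) :
    Real.exp (-β * hamA N J J φ) = Real.exp (β * J * (N : ℝ) ^ 2) *
      (torusBonds N).patWeight χ (β * J / 2) ∅ ∅ φ := by
  simp only [BondSystem.patWeight, Finset.prod_empty, one_mul, gaussKer, Finset.notMem_empty,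
    if_false]
  rw [← Real.exp_sum, ← Real.exp_add, ← Finset.mul_sum,
    show -β * hamA N J J φ = β * (-hamA N J J φ) by ring, neg_hamA_eq hN]
  congr 1
  ring

theorem integrable_patWeight_empty {χ : Real.Angle → ℝ} (hχ : Measurable χ) {lam : ℝ}
    (hl : 0 < lam) : Integrable ((torusBonds N).patWeight χ lam ∅ ∅)
      (Measure.pi fun _ : Torus N => angleProb) := by
  refine Integrable.of_bound (C := 1) ((torusBonds N).measurable_patWeight
    measurable_torusBonds_obs hχ lam ∅ ∅).aestronglyMeasurable
    (Filter.Eventually.of_forall fun φ => ?_)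
  simp only [BondSystem.patWeight, Finset.prod_empty, one_mul]
  rw [Real.norm_of_nonneg (Finset.prod_nonneg fun _ _ => (gaussKer_pos _ _ _).le)]
  exact Finset.prod_le_one (fun _ _ => (gaussKer_pos _ _ _).le) fun _ _ => gaussKer_le_one hl _ _

theorem patZ_empty_pos {χ : Real.Angle → ℝ} (hχ : Measurable χ) {lam : ℝ} (hl : 0 < lam) :
    0 < (torusBonds N).patZ angleProb χ lam ∅ ∅ := by
  have h0 : ∀ φ : Cfg N, 0 < (torusBonds N).patWeight χ lam ∅ ∅ φ := fun φ => by
    simp only [BondSystem.patWeight, Finset.prod_empty, one_mul]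
    exact Finset.prod_pos fun _ _ => gaussKer_pos _ _ _
  refine (integral_pos_iff_support_of_nonneg (fun φ => (h0 φ).le)
    (integrable_patWeight_empty hχ hl)).2 ?_
  rw [show Function.support ((torusBonds N).patWeight χ lam ∅ ∅) = Set.univ from
    Set.eq_univ_of_forall fun φ => (h0 φ).ne']
  simp

theorem gibbs_apply (hN : Even N) {β J : ℝ} (hβJ : 0 < β * J / 2) {χ : Real.Angle → ℝ}
    (hχ : Measurable χ) {s : Set (Cfg N)} (hs : MeasurableSet s) :
    gibbs N β J J s = ENNReal.ofReal ((∫ φ in s, (torusBonds N).patWeight χ (β * J / 2) ∅ ∅ φ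
      ∂(Measure.pi fun _ => angleProb)) / (torusBonds N).patZ angleProb χ (β * J / 2) ∅ ∅) := by
  obtain ⟨c, hc0, hct, hc⟩ := exists_apriori_eq_smul N
  have hZ : 0 < (torusBonds N).patZ angleProb χ (β * J / 2) ∅ ∅ := patZ_empty_pos hχ hβJ
  set E := Real.exp (β * J * (N : ℝ) ^ 2)
  have hE : 0 < E := Real.exp_pos _
  have hint := integrable_patWeight_empty (N := N) hχ hβJ
  have h0 : ∀ φ : Cfg N, 0 ≤ (torusBonds N).patWeight χ (β * J / 2) ∅ ∅ φ := fun φ => by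
    simp only [BondSystem.patWeight, Finset.prod_empty, one_mul]
    exact Finset.prod_nonneg fun _ _ => (gaussKer_pos _ _ _).le
  have hZfull : ENNReal.ofReal (Zfull N β J J) =
      c * ENNReal.ofReal (E * (torusBonds N).patZ angleProb χ (β * J / 2) ∅ ∅) := by
    rw [Zfull, hc, integral_smul_measure, smul_eq_mul, ENNReal.ofReal_mul ENNReal.toReal_nonneg,
      ENNReal.ofReal_toReal hct]
    simp only [exp_neg_mul_hamA_eq hN β J χ]
    rw [integral_const_mul, BondSystem.patZ]
  rw [gibbs, Measure.smul_apply, withDensity_apply _ hs, hc, Measure.restrict_smul,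
    lintegral_smul_measure, hZfull, smul_eq_mul, smul_eq_mul]
  simp only [exp_neg_mul_hamA_eq hN β J χ]
  rw [← ofReal_integral_eq_lintegral_ofReal (hint.const_mul _).integrableOn
    (Filter.Eventually.of_forall fun φ => mul_nonneg hE.le (h0 φ)), integral_const_mul,
    ENNReal.mul_inv (Or.inl hc0) (Or.inl hct), ← ENNReal.ofReal_inv_of_pos (by positivity),
    mul_mul_mul_comm, ENNReal.inv_mul_cancel hc0 hct, one_mul, ← ENNReal.ofReal_mul (by positivity)]
  congr 1
  field_simp

theorem isProbabilityMeasure_gibbs (hN : Even N) {β J : ℝ} (hβJ : 0 < β * J / 2) :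
    IsProbabilityMeasure (gibbs N β J J) := by
  refine ⟨?_⟩
  rw [gibbs_apply hN hβJ (measurable_badInd 1) MeasurableSet.univ, Measure.restrict_univ,
    ← BondSystem.patZ, div_self (patZ_empty_pos (measurable_badInd 1) hβJ).ne', ENNReal.ofReal_one]

theorem gibbs_real_le (hN : Even N) {β J : ℝ} (hβJ : 0 < β * J / 2) {a q : ℝ} (hq : 0 < q)
    (hbad : (torusBonds N).patZ angleProb (badInd a) (β * J / 2) Finset.univ ∅ ≤
      q ^ (N ^ 2) * (torusBonds N).patZ angleProb (badInd a) (β * J / 2) ∅ ∅)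
    (A : Finset (Torus N)) (B : Finset (Torus N × Bool)) :
    (gibbs N β J J).real {φ | (∀ r ∈ A, φ r ∈ badAngle a) ∧
      ∀ e ∈ B, 1 / 2 ≤ |(torusBonds N).grad e φ|} ≤
      q ^ A.card * (√2 * Real.exp (-(β * J / 2) / 8)) ^ B.card := by
  set lam := β * J / 2 with hlam
  set s : Set (Cfg N) := {φ | (∀ r ∈ A, φ r ∈ badAngle a) ∧
      ∀ e ∈ B, 1 / 2 ≤ |(torusBonds N).grad e φ|}
  have hs : MeasurableSet s := by
    refine MeasurableSet.inter (s₁ := {φ : Cfg N | ∀ r ∈ A, φ r ∈ badAngle a})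
      (s₂ := {φ : Cfg N | ∀ e ∈ B, 1 / 2 ≤ |(torusBonds N).grad e φ|}) ?_ ?_
    · have : {φ : Cfg N | ∀ r ∈ A, φ r ∈ badAngle a} = ⋂ r ∈ A, (fun φ => φ r) ⁻¹' badAngle a := by
        ext; simp
      rw [this]
      exact Finset.measurableSet_biInter _ fun r _ =>
        measurable_pi_apply r (measurableSet_badAngle a)
    · have : {φ : Cfg N | ∀ e ∈ B, 1 / 2 ≤ |(torusBonds N).grad e φ|} =
          ⋂ e ∈ B, {φ | 1 / 2 ≤ |(torusBonds N).grad e φ|} := by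
        ext; simp
      rw [this]
      exact Finset.measurableSet_biInter _ fun e _ => measurableSet_le measurable_const
        ((torusBonds N).measurable_grad measurable_torusBonds_obs e).abs
  have hZ : 0 < (torusBonds N).patZ angleProb (badInd a) lam ∅ ∅ :=
    patZ_empty_pos (measurable_badInd a) hβJ
  have hpat := BondSystem.patZ_le (torusBonds N) angleProb measurable_torusBonds_obs
    (measurable_badInd a) (badInd_nonneg a) (badInd_le_one a) hβJ
    (exists_mirror_crossing hN) split_torusBonds_eq_empty hq
    (by rw [Fintype.card_prod, ZMod.card, ← sq]; exact hbad) A B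
  rw [measureReal_def, gibbs_apply hN hβJ (measurable_badInd a) hs, ENNReal.toReal_ofReal
    (div_nonneg (integral_nonneg fun φ => BondSystem.patWeight_nonneg _ (badInd_nonneg a) _ _ _ φ)
      hZ.le), div_le_iff₀ hZ]
  have hmono : ∫ φ in s, (torusBonds N).patWeight (badInd a) lam ∅ ∅ φ
      ∂(Measure.pi fun _ => angleProb) ≤
      Real.exp (-lam / 8) ^ B.card * (torusBonds N).patZ angleProb (badInd a) lam A B := by
    rw [BondSystem.patZ, ← integral_const_mul, ← integral_indicator hs]
    refine integral_mono ((integrable_patWeight_empty (measurable_badInd a) hβJ).indicator hs)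
      (Integrable.const_mul (Integrable.of_bound (C := 1)
        ((torusBonds N).measurable_patWeight measurable_torusBonds_obs (measurable_badInd a) lam A
          B).aestronglyMeasurable (Filter.Eventually.of_forall fun φ => ?_)) _) fun φ => ?_
    · rw [Real.norm_of_nonneg (BondSystem.patWeight_nonneg _ (badInd_nonneg a) _ _ _ φ)]
      exact BondSystem.patWeight_le_one _ (badInd_nonneg a) (badInd_le_one a) hβJ _ _ φ
    · refine Set.indicator_le' (f := (torusBonds N).patWeight (badInd a) lam ∅ ∅)
        (g := fun φ => Real.exp (-lam / 8) ^ B.card * (torusBonds N).patWeight (badInd a) lam A B φ)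
        (fun φ hφ => ?_) (fun φ _ => mul_nonneg (by positivity)
          (BondSystem.patWeight_nonneg _ (badInd_nonneg a) _ _ _ φ)) φ
      obtain ⟨hA, hB⟩ := hφ
      have h1 : ∏ r ∈ A, badInd a (φ r) = 1 := Finset.prod_eq_one fun r hr =>
        Set.indicator_of_mem (hA r hr) _
      have h2 : Real.exp (-lam / 8) ^ B.card =
          ∏ e : Torus N × Bool, if e ∈ B then Real.exp (-lam / 8) else 1 := by
        rw [Finset.prod_ite_mem, Finset.univ_inter, Finset.prod_const]
      simp only [BondSystem.patWeight, Finset.prod_empty, one_mul, h1]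
      rw [h2, ← Finset.prod_mul_distrib]
      refine Finset.prod_le_prod (fun _ _ => (gaussKer_pos _ _ _).le) fun e _ => ?_
      by_cases he : e ∈ B
      · simp only [gaussKer, he, if_true, Finset.notMem_empty, if_false]
        rw [← Real.exp_add, Real.exp_le_exp]
        have h3 : (1 / 2) ^ 2 ≤ (torusBonds N).grad e φ ^ 2 := by
          rw [← sq_abs ((torusBonds N).grad e φ)]
          have := hB e he
          gcongr
        nlinarith
      · simp [gaussKer, he]
  calc _ ≤ _ := hmono
    _ ≤ Real.exp (-lam / 8) ^ B.card * (q ^ A.card * √2 ^ B.card *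
        (torusBonds N).patZ angleProb (badInd a) lam ∅ ∅) := by gcongr
    _ = _ := by rw [mul_pow]; ring

theorem sum_biUnion_le_sum_sum {ι α : Type*} [DecidableEq α] (s : Finset ι) (t : ι → Finset α)
    {f : α → ℝ} (hf : ∀ a, 0 ≤ f a) : ∑ a ∈ s.biUnion t, f a ≤ ∑ i ∈ s, ∑ a ∈ t i, f a := by
  classical
  induction s using Finset.induction_on with
  | empty => simp
  | insert i s hi ih =>
    rw [Finset.biUnion_insert, Finset.sum_insert hi]
    have h := Finset.sum_union_inter (s₁ := t i) (s₂ := s.biUnion t) (f := f)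
    have h0 : 0 ≤ ∑ a ∈ t i ∩ s.biUnion t, f a := Finset.sum_nonneg fun a _ => hf a
    linarith

section Percolation

variable {E : Type*} {adj : E → E → Prop}

/-- `D` is nonempty and has no proper nonempty subset closed under `adj` within `D`. -/
def ConnSet (adj : E → E → Prop) (D : Finset E) : Prop :=
  D.Nonempty ∧ ∀ S ⊆ D, S.Nonempty → (∀ a ∈ S, ∀ b ∈ D, adj a b → b ∈ S) → S = D

/-- `D` is a connected component of `Γ`. -/
def IsComp (adj : E → E → Prop) (Γ D : Finset E) : Prop :=
  ConnSet adj D ∧ D ⊆ Γ ∧ ∀ a ∈ D, ∀ b ∈ Γ, adj a b → b ∈ D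

theorem IsComp.eq_of_mem [DecidableEq E] {Γ D D' : Finset E} (h : IsComp adj Γ D)
    (h' : IsComp adj Γ D') {e : E} (he : e ∈ D) (he' : e ∈ D') : D = D' := by
  have hne : (D ∩ D').Nonempty := ⟨e, Finset.mem_inter.2 ⟨he, he'⟩⟩
  have h1 : D ∩ D' = D := h.1.2 _ Finset.inter_subset_left hne fun a ha b hb hab =>
    Finset.mem_inter.2 ⟨hb, h'.2.2 a (Finset.mem_inter.1 ha).2 b (h.2.1 hb) hab⟩
  have h2 : D ∩ D' = D' := h'.1.2 _ Finset.inter_subset_right hne fun a ha b hb hab =>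
    Finset.mem_inter.2 ⟨h.2.2 a (Finset.mem_inter.1 ha).1 b (h'.2.1 hb) hab, hb⟩
  exact h1.symm.trans h2

theorem exists_isComp_mem [DecidableEq E] (hsymm : ∀ a b, adj a b → adj b a) {Γ : Finset E} {e : E}
    (he : e ∈ Γ) : ∃ D, IsComp adj Γ D ∧ e ∈ D := by
  classical
  set F := Γ.powerset.filter fun D => e ∈ D ∧ ∀ a ∈ D, ∀ b ∈ Γ, adj a b → b ∈ D
  have hF : F.Nonempty := ⟨Γ, by simpa [F, he] using fun a _ b hb _ => hb⟩
  obtain ⟨D, hD, hmin⟩ := F.exists_min_image Finset.card hF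
  simp only [F, Finset.mem_filter, Finset.mem_powerset] at hD hmin
  obtain ⟨hDΓ, heD, hcl⟩ := hD
  refine ⟨D, ⟨⟨⟨e, heD⟩, fun S hS hne hSc => ?_⟩, hDΓ, hcl⟩, heD⟩
  by_cases heS : e ∈ S
  · exact Finset.eq_of_subset_of_card_le hS (hmin S ⟨hS.trans hDΓ, heS, fun a ha b hb hab =>
      hSc a ha b (hcl a (hS ha) b hb hab) hab⟩)
  · have h := hmin (D \ S) ⟨Finset.sdiff_subset.trans hDΓ, Finset.mem_sdiff.2 ⟨heD, heS⟩,
      fun a ha b hb hab => ?_⟩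
    · have h2 := Finset.card_sdiff_add_card_eq_card hS
      have h3 := hne.card_pos
      omega
    · rw [Finset.mem_sdiff] at ha ⊢
      exact ⟨hcl a ha.1 b hb hab, fun hbS => ha.2 (hSc b hbS a ha.1 (hsymm a b hab))⟩

variable [Fintype E] [DecidableEq E]

open Classical in
theorem sum_connSet_pow_le {nb : E → Finset E} (hnb : ∀ a b, adj a b → b ∈ nb a)
    (hcard : ∀ a, (nb a).card ≤ 8) (e : E) :
    ∑ D : Finset E with ConnSet adj D ∧ e ∈ D, ((1 : ℝ) / 2 ^ 9) ^ D.card ≤ 1 := by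
  set bd : Finset E → Finset E := fun D => D.biUnion nb \ D
  set F : Finset E → Finset (Finset E) := fun D => Finset.Icc D (bd D)ᶜ
  have hbd : ∀ D, (bd D).card ≤ 8 * D.card := fun D =>
    (Finset.card_le_card Finset.sdiff_subset).trans
      ((Finset.card_biUnion_le_card_mul D nb 8 fun a _ => hcard a).trans (by rw [mul_comm]))
  have hF : ∀ D, (2 : ℝ) ^ Fintype.card E * (1 / 2 ^ 9) ^ D.card ≤ (F D).card := by
    intro D
    have hsub : D ⊆ (bd D)ᶜ := by
      rw [Finset.subset_compl_iff_disjoint_right]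
      exact Finset.disjoint_sdiff
    have h1 : (F D).card = 2 ^ ((bd D)ᶜ.card - D.card) := Finset.card_Icc_finset hsub
    have h2 := hbd D
    have h3 := Finset.card_compl_add_card (bd D)
    have h4 := Finset.card_le_card hsub
    rw [h1, one_div, inv_pow, ← div_eq_mul_inv, div_le_iff₀ (by positivity), ← pow_mul]
    push_cast
    rw [← pow_add]
    exact pow_le_pow_right₀ one_le_two (by omega)
  have hcomp : ∀ D, ConnSet adj D → ∀ ω ∈ F D, IsComp adj ω D := by
    intro D hD ω hω
    obtain ⟨h1, h2⟩ := Finset.mem_Icc.1 hω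
    refine ⟨hD, h1, fun a ha b hb hab => ?_⟩
    by_contra hbD
    have := h2 hb
    rw [Finset.mem_compl, Finset.mem_sdiff] at this
    exact this ⟨Finset.mem_biUnion.2 ⟨a, ha, hnb a b hab⟩, hbD⟩
  have hdisj : ∀ D ∈ Finset.univ.filter (fun D : Finset E => ConnSet adj D ∧ e ∈ D),
      ∀ D' ∈ Finset.univ.filter (fun D : Finset E => ConnSet adj D ∧ e ∈ D), D ≠ D' →
      Disjoint (F D) (F D') := by
    intro D hD D' hD' hne
    rw [Finset.mem_filter] at hD hD'
    refine Finset.disjoint_left.2 fun ω h h' => hne ?_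
    exact (hcomp D hD.2.1 ω h).eq_of_mem (hcomp D' hD'.2.1 ω h') hD.2.2 hD'.2.2
  have hsum := Finset.card_biUnion hdisj
  have hle : ∑ D : Finset E with ConnSet adj D ∧ e ∈ D, (F D).card ≤ 2 ^ Fintype.card E := by
    rw [← hsum, ← Fintype.card_finset]
    exact Finset.card_le_univ _
  have h2 : (2 : ℝ) ^ Fintype.card E *
      ∑ D : Finset E with ConnSet adj D ∧ e ∈ D, ((1 : ℝ) / 2 ^ 9) ^ D.card ≤
      2 ^ Fintype.card E * 1 := by
    rw [Finset.mul_sum, mul_one]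
    calc _ ≤ ∑ D : Finset E with ConnSet adj D ∧ e ∈ D, ((F D).card : ℝ) :=
          Finset.sum_le_sum fun D _ => hF D
      _ ≤ _ := by exact_mod_cast hle
  exact le_of_mul_le_mul_left h2 (by positivity)

theorem sum_connSet_weight_le {nb : E → Finset E} (hnb : ∀ a b, adj a b → b ∈ nb a)
    (hcard : ∀ a, (nb a).card ≤ 8) (g : ℕ → ℝ) {C : ℝ} (hC : 0 ≤ C) (𝒟 : Finset (Finset E))
    (h𝒟 : ∀ D ∈ 𝒟, ConnSet adj D ∧ g D.card ≤ C * (1 / 2 ^ 9) ^ D.card) :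
    ∑ D ∈ 𝒟, g D.card ≤ Fintype.card E * C := by
  classical
  calc _ ≤ ∑ D ∈ 𝒟, ∑ e ∈ D, C * (1 / 2 ^ 9) ^ D.card := by
        refine Finset.sum_le_sum fun D hD => ?_
        obtain ⟨h1, h2⟩ := h𝒟 D hD
        rw [Finset.sum_const, nsmul_eq_mul]
        have h3 : (1 : ℝ) ≤ D.card := by exact_mod_cast h1.1.card_pos
        have h4 : 0 ≤ C * (1 / 2 ^ 9) ^ D.card := by positivity
        nlinarith
    _ ≤ ∑ D : Finset E with ConnSet adj D, ∑ e ∈ D, C * (1 / 2 ^ 9) ^ D.card := by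
        refine Finset.sum_le_sum_of_subset_of_nonneg (fun D hD => ?_)
          fun D _ _ => Finset.sum_nonneg fun e _ => by positivity
        simpa using (h𝒟 D hD).1
    _ = ∑ e : E, ∑ D : Finset E with ConnSet adj D ∧ e ∈ D, C * (1 / 2 ^ 9) ^ D.card := by
        refine Finset.sum_comm' fun D e => ?_
        simp
    _ ≤ ∑ _e : E, C := by
        refine Finset.sum_le_sum fun e _ => ?_
        rw [← Finset.mul_sum]
        exact mul_le_of_le_one_right hC (sum_connSet_pow_le hnb hcard e)
    _ = _ := by rw [Finset.sum_const, Finset.card_univ, nsmul_eq_mul]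

open Classical in
/-- Components of a sparse random set are small. -/
theorem sum_exists_large_comp_le {nb : E → Finset E} (hnb : ∀ a b, adj a b → b ∈ nb a)
    (hcard : ∀ a, (nb a).card ≤ 8) (W : Finset E → ℝ) (hW : ∀ ω, 0 ≤ W ω) {y : ℝ} (hy : 0 ≤ y)
    (hy1 : y ≤ 1) (hsparse : ∀ Γ : Finset E, ∑ ω with Γ ⊆ ω, W ω ≤ (1 / 2 ^ 9 * y) ^ Γ.card) (l : ℕ) :
    ∑ ω with ∃ D, IsComp adj ω D ∧ l < D.card, W ω ≤ Fintype.card E * y ^ l := by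
  calc _ ≤ ∑ ω ∈ (Finset.univ.filter fun D : Finset E => ConnSet adj D ∧ l < D.card).biUnion
          fun D => Finset.univ.filter fun ω => D ⊆ ω, W ω := by
        refine Finset.sum_le_sum_of_subset_of_nonneg (fun ω hω => ?_) fun ω _ _ => hW ω
        obtain ⟨D, hD, hl⟩ := (Finset.mem_filter.1 hω).2
        exact Finset.mem_biUnion.2 ⟨D, by simp [hD.1, hl], by simp [hD.2.1]⟩
    _ ≤ ∑ D : Finset E with ConnSet adj D ∧ l < D.card, ∑ ω with D ⊆ ω, W ω :=
        sum_biUnion_le_sum_sum _ _ hW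
    _ ≤ ∑ D : Finset E with ConnSet adj D ∧ l < D.card, (1 / 2 ^ 9 * y) ^ D.card :=
        Finset.sum_le_sum fun D _ => hsparse D
    _ ≤ _ := by
        refine sum_connSet_weight_le hnb hcard (fun n => (1 / 2 ^ 9 * y) ^ n)
          (pow_nonneg hy l) _ fun D hD => ⟨(Finset.mem_filter.1 hD).2.1, ?_⟩
        have hl := (Finset.mem_filter.1 hD).2.2
        rw [mul_pow, mul_comm]
        gcongr ?_ * _
        exact pow_le_pow_of_le_one hy hy1 hl.le

open Classical in
theorem sum_mul_prod_le (W : Finset E → ℝ) (hW : ∀ ω, 0 ≤ W ω) {p : ℝ} (hp : 0 ≤ p)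
    (hsparse : ∀ Γ : Finset E, ∑ ω with Γ ⊆ ω, W ω ≤ p ^ Γ.card) (𝒟 : Finset (Finset E))
    (c : Finset E → ℝ) (hc : ∀ D, 0 ≤ c D) :
    ∑ ω, W ω * ∏ D ∈ 𝒟, (1 + if IsComp adj ω D then c D else 0) ≤
      ∏ D ∈ 𝒟, (1 + c D * p ^ D.card) := by
  simp only [Finset.prod_one_add, Finset.mul_sum]
  rw [Finset.sum_comm]
  refine Finset.sum_le_sum fun F _ => ?_
  have hprod : ∀ ω, ∏ D ∈ F, (if IsComp adj ω D then c D else 0) =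
      if ∀ D ∈ F, IsComp adj ω D then ∏ D ∈ F, c D else 0 := by
    intro ω
    split_ifs with h
    · exact Finset.prod_congr rfl fun D hD => if_pos (h D hD)
    · push Not at h
      obtain ⟨D, hD, hn⟩ := h
      exact Finset.prod_eq_zero hD (if_neg hn)
  have hprod0 : 0 ≤ ∏ D ∈ F, c D := Finset.prod_nonneg fun D _ => hc D
  rw [Finset.prod_mul_distrib, Finset.prod_pow_eq_pow_sum]
  simp only [hprod, mul_ite, mul_zero]
  rw [← Finset.sum_filter, ← Finset.sum_mul, mul_comm]
  refine mul_le_mul_of_nonneg_left ?_ hprod0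
  by_cases hF : ∃ ω, ∀ D ∈ F, IsComp adj ω D
  · obtain ⟨ω₀, h₀⟩ := hF
    have hcard : (F.biUnion id).card = ∑ D ∈ F, D.card := by
      refine Finset.card_biUnion fun D hD D' hD' hne => Finset.disjoint_left.2 fun e he he' => hne ?_
      exact (h₀ D hD).eq_of_mem (h₀ D' hD') he he'
    rw [← hcard]
    refine (Finset.sum_le_sum_of_subset_of_nonneg (fun ω hω => ?_) fun ω _ _ => hW ω).trans
      (hsparse _)
    rw [Finset.mem_filter] at hω ⊢
    exact ⟨hω.1, Finset.biUnion_subset.2 fun D hD => (hω.2 D hD).2.1⟩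
  · push Not at hF
    rw [Finset.sum_eq_zero fun ω hω => absurd (Finset.mem_filter.1 hω).2
      (by simpa using hF ω)]
    positivity

theorem sq_mul_pow_le {y : ℝ} (hy : 0 ≤ y) (hy1 : y ≤ 1 / 4) {n : ℕ} (hn : 1 ≤ n) :
    (n : ℝ) ^ 2 * y ^ n ≤ y := by
  induction n, hn using Nat.le_induction with
  | base => simp
  | succ n hn ih =>
    have h1 : (1 : ℝ) ≤ n := by exact_mod_cast hn
    have h2 : 0 ≤ y ^ n := by positivity
    rw [pow_succ y]
    push_cast
    calc ((n : ℝ) + 1) ^ 2 * (y ^ n * y) ≤ (2 * n) ^ 2 * (y ^ n * (1 / 4)) := by gcongr; linarith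
      _ = (n : ℝ) ^ 2 * y ^ n := by ring
      _ ≤ y := ih

theorem exp_half_le_one_add {x : ℝ} (h0 : 0 ≤ x) (h1 : x ≤ 1) : Real.exp (x / 2) ≤ 1 + x := by
  have h2 : 1 - x / 2 ≤ Real.exp (-(x / 2)) := by
    have := Real.add_one_le_exp (-(x / 2))
    linarith
  rw [Real.exp_neg] at h2
  have h3 := Real.exp_pos (x / 2)
  have h4 : (1 - x / 2) * Real.exp (x / 2) ≤ 1 := by
    calc _ ≤ (Real.exp (x / 2))⁻¹ * Real.exp (x / 2) := by gcongr
      _ = 1 := inv_mul_cancel₀ h3.ne'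
  nlinarith [mul_nonneg h0 (sub_nonneg.2 h1)]

open Classical in
/-- The sum of the squared sizes of the components of a sparse random set is small. -/
theorem sum_large_sq_comp_le {nb : E → Finset E} (hnb : ∀ a b, adj a b → b ∈ nb a)
    (hcard : ∀ a, (nb a).card ≤ 8) (W : Finset E → ℝ) (hW : ∀ ω, 0 ≤ W ω) {y : ℝ} (hy : 0 ≤ y)
    (hy1 : y ≤ 1 / 4)
    (hsparse : ∀ Γ : Finset E, ∑ ω with Γ ⊆ ω, W ω ≤ (1 / 2 ^ 9 * y) ^ Γ.card) {l : ℕ} (hl : 0 < l)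
    (K : ℝ) :
    ∑ ω with (∀ D, IsComp adj ω D → D.card ≤ l) ∧ K ≤ ∑ D with IsComp adj ω D, (D.card : ℝ) ^ 2,
      W ω ≤ Real.exp ((Fintype.card E * y - K / 2) / l ^ 2) := by
  set t : ℝ := 1 / (l : ℝ) ^ 2 with ht
  have ht0 : 0 ≤ t := by positivity
  have hl' : (0 : ℝ) < l := by exact_mod_cast hl
  set 𝒟 : Finset (Finset E) := Finset.univ.filter fun D => ConnSet adj D ∧ D.card ≤ l
  have hmain := sum_mul_prod_le (adj := adj) W hW (p := 1 / 2 ^ 9 * y) (by positivity) hsparse 𝒟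
    (fun D => t * (D.card : ℝ) ^ 2) (fun D => by positivity)
  have hup : ∏ D ∈ 𝒟, (1 + t * (D.card : ℝ) ^ 2 * (1 / 2 ^ 9 * y) ^ D.card) ≤
      Real.exp (t * (Fintype.card E * y)) := by
    calc _ ≤ ∏ D ∈ 𝒟, Real.exp (t * ((D.card : ℝ) ^ 2 * (1 / 2 ^ 9 * y) ^ D.card)) := by
          refine Finset.prod_le_prod (fun D _ => by positivity) fun D _ => ?_
          rw [add_comm, mul_assoc]
          exact Real.add_one_le_exp _
      _ = Real.exp (t * ∑ D ∈ 𝒟, ((D.card : ℝ) ^ 2 * (1 / 2 ^ 9 * y) ^ D.card)) := by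
          rw [← Real.exp_sum, Finset.mul_sum]
      _ ≤ _ := by
          rw [Real.exp_le_exp]
          refine mul_le_mul_of_nonneg_left ?_ ht0
          refine sum_connSet_weight_le hnb hcard (fun n => (n : ℝ) ^ 2 * (1 / 2 ^ 9 * y) ^ n) hy
            _ fun D hD => ⟨(Finset.mem_filter.1 hD).2.1, ?_⟩
          have hpos := (Finset.mem_filter.1 hD).2.1.1.card_pos
          rw [mul_pow, mul_left_comm, mul_comm]
          gcongr
          exact sq_mul_pow_le hy hy1 hpos
  have hlow : ∀ ω, (∀ D, IsComp adj ω D → D.card ≤ l) ∧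
      K ≤ ∑ D with IsComp adj ω D, (D.card : ℝ) ^ 2 → Real.exp (t * (K / 2)) ≤
      ∏ D ∈ 𝒟, (1 + if IsComp adj ω D then t * (D.card : ℝ) ^ 2 else 0) := by
    rintro ω ⟨h1, h2⟩
    have hsum : ∑ D with IsComp adj ω D, (D.card : ℝ) ^ 2 =
        ∑ D ∈ 𝒟, if IsComp adj ω D then (D.card : ℝ) ^ 2 else 0 := by
      rw [← Finset.sum_filter]
      refine Finset.sum_congr ?_ fun _ _ => rfl
      ext D
      simp only [𝒟, Finset.mem_filter, Finset.mem_univ, true_and]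
      exact ⟨fun h => ⟨⟨h.1, h1 D h⟩, h⟩, fun h => h.2⟩
    calc Real.exp (t * (K / 2)) ≤
        Real.exp (∑ D ∈ 𝒟, (if IsComp adj ω D then t * (D.card : ℝ) ^ 2 else 0) / 2) := by
          rw [Real.exp_le_exp, ← Finset.sum_div, mul_div_assoc']
          refine div_le_div_of_nonneg_right ?_ two_pos.le
          calc t * K ≤ t * ∑ D ∈ 𝒟, if IsComp adj ω D then (D.card : ℝ) ^ 2 else 0 := by
                rw [← hsum]; gcongr
            _ = _ := by
                rw [Finset.mul_sum]
                exact Finset.sum_congr rfl fun D _ => by rw [mul_ite, mul_zero]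
      _ = ∏ D ∈ 𝒟, Real.exp ((if IsComp adj ω D then t * (D.card : ℝ) ^ 2 else 0) / 2) :=
          Real.exp_sum _ _
      _ ≤ _ := by
          refine Finset.prod_le_prod (fun D _ => (Real.exp_pos _).le) fun D hD => ?_
          have hDl : (D.card : ℝ) ≤ l := by exact_mod_cast (Finset.mem_filter.1 hD).2.2
          refine exp_half_le_one_add ?_ ?_
          · split_ifs <;> positivity
          · split_ifs
            · rw [ht, one_div, inv_mul_le_iff₀ (by positivity), mul_one]
              gcongr
            · exact zero_le_one
  have hK := Real.exp_pos (t * (K / 2))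
  have hfin : (∑ ω with (∀ D, IsComp adj ω D → D.card ≤ l) ∧
      K ≤ ∑ D with IsComp adj ω D, (D.card : ℝ) ^ 2, W ω) * Real.exp (t * (K / 2)) ≤
      Real.exp (t * (Fintype.card E * y)) := by
    refine le_trans ?_ (hmain.trans hup)
    rw [Finset.sum_mul]
    calc _ ≤ ∑ ω with (∀ D, IsComp adj ω D → D.card ≤ l) ∧
        K ≤ ∑ D with IsComp adj ω D, (D.card : ℝ) ^ 2, W ω *
          ∏ D ∈ 𝒟, (1 + if IsComp adj ω D then t * (D.card : ℝ) ^ 2 else 0) :=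
          Finset.sum_le_sum fun ω hω =>
            mul_le_mul_of_nonneg_left (hlow ω (Finset.mem_filter.1 hω).2) (hW ω)
      _ ≤ _ := by
          refine Finset.sum_le_sum_of_subset_of_nonneg (Finset.filter_subset _ _) fun ω _ _ => ?_
          refine mul_nonneg (hW ω) (Finset.prod_nonneg fun D _ => ?_)
          split_ifs <;> positivity
  rw [← le_div_iff₀ hK, ← Real.exp_sub] at hfin
  refine hfin.trans (le_of_eq ?_)
  rw [ht]
  congr 1
  ring

end Percolation

section Plaquette

variable {N : ℕ} [NeZero N]

/-- The four bonds around the plaquette with lower left corner `t`. -/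
def plaquette (t : Torus N) : Finset (Torus N × Bool) :=
  {(t, false), (t + (1, 0), true), (t + (0, 1), false), (t, true)}

/-- Two bonds are adjacent when they share a plaquette. -/
def plaqAdj (a b : Torus N × Bool) : Prop := ∃ t, a ∈ plaquette t ∧ b ∈ plaquette t

/-- The bonds sharing a plaquette with a given one. -/
def plaqNb (e : Torus N × Bool) : Finset (Torus N × Bool) :=
  plaquette e.1 ∪ plaquette (e.1 - if e.2 then (1, 0) else (0, 1))

theorem plaqAdj_symm (a b : Torus N × Bool) (h : plaqAdj a b) : plaqAdj b a :=
  let ⟨t, h1, h2⟩ := h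
  ⟨t, h2, h1⟩

theorem mem_plaqNb (a b : Torus N × Bool) (h : plaqAdj a b) : b ∈ plaqNb a := by
  obtain ⟨t, h1, h2⟩ := h
  rw [plaqNb, Finset.mem_union]
  simp only [plaquette, Finset.mem_insert, Finset.mem_singleton] at h1
  rcases h1 with rfl | rfl | rfl | rfl
  · exact Or.inl h2
  · exact Or.inr (by simpa using h2)
  · exact Or.inr (by simpa using h2)
  · exact Or.inl h2

theorem card_plaqNb_le (e : Torus N × Bool) : (plaqNb e).card ≤ 8 := by
  have h : ∀ t : Torus N, (plaquette t).card ≤ 4 := fun t => Finset.card_le_four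
  exact (Finset.card_union_le _ _).trans (add_le_add (h _) (h _))

theorem sum_range_add_sum_range {c : Torus N × Bool → ZMod 2} (hc : ∀ t, ∑ e ∈ plaquette t, c e = 0)
    (hN : 1 < N) (i₀ j : ZMod N) (n : ℕ) :
    ∑ k ∈ Finset.range n, c ((i₀ + k, j + 1), false) =
      ∑ k ∈ Finset.range n, c ((i₀ + k, j), false) + c ((i₀ + n, j), true) + c ((i₀, j), true) := by
  have hcl : ∀ i, c ((i, j + 1), false) =
      c ((i, j), false) + c ((i + 1, j), true) + c ((i, j), true) := by
    intro i
    have h := hc (i, j)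
    have : Fact (1 < N) := ⟨hN⟩
    rw [plaquette, Finset.sum_insert (by simp), Finset.sum_insert (by simp),
      Finset.sum_insert (by simp), Finset.sum_singleton] at h
    simp only [Prod.mk_add_mk, add_zero] at h
    linear_combination (exp := 1) h - CharTwo.add_self_eq_zero (c ((i, j), false)) -
      CharTwo.add_self_eq_zero (c ((i + 1, j), true)) - CharTwo.add_self_eq_zero (c ((i, j), true))
  induction n with
  | zero => simpa using (CharTwo.add_self_eq_zero (c ((i₀, j), true))).symm
  | succ n ih =>
    rw [Finset.sum_range_succ, Finset.sum_range_succ, ih, hcl]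
    push_cast
    rw [← add_assoc i₀]
    linear_combination CharTwo.add_self_eq_zero (c ((i₀ + n, j), true))

/-- A closed cochain vanishing on a column and a row has a small potential. -/
theorem exists_potential {c : Torus N × Bool → ZMod 2} (hc : ∀ t, ∑ e ∈ plaquette t, c e = 0)
    (hN : 1 < N) {i₀ j₀ : ZMod N} (hi : ∀ j, c ((i₀, j), true) = 0)
    (hj : ∀ i, c ((i, j₀), false) = 0) :
    ∃ V : Torus N → ZMod 2, (∀ e, V ((torusBonds N).tgt e) = V e.1 + c e) ∧
      ∀ r, V r ≠ 0 → (∃ i, c ((i, r.2), false) ≠ 0) ∧ ∃ j, c ((r.1, j), true) ≠ 0 := by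
  set V : Torus N → ZMod 2 := fun r =>
    ∑ k ∈ Finset.range (r.1 - i₀).val, c ((i₀ + k, r.2), false)
  have hval : ∀ i : ZMod N, i₀ + ((i - i₀).val : ZMod N) = i := fun i => by
    rw [ZMod.natCast_zmod_val]; ring
  have hT : ∀ j, ∑ k ∈ Finset.range N, c ((i₀ + k, j), false) = 0 := by
    intro j
    refine (ZMod.forall_iff_of_forall_add_one
      (P := fun j => ∑ k ∈ Finset.range N, c ((i₀ + k, j), false) = 0) (fun j => ?_) j j₀).2 ?_
    · rw [sum_range_add_sum_range hc hN]
      simp [hi]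
    · exact Finset.sum_eq_zero fun k _ => hj _
  have hV2 : ∀ i j, V (i, j + 1) = V (i, j) + c ((i, j), true) := by
    intro i j
    simp only [V]
    rw [sum_range_add_sum_range hc hN, hval, hi, add_zero]
  refine ⟨V, ?_, fun r hr => ⟨?_, ?_⟩⟩
  · rintro ⟨⟨i, j⟩, _ | _⟩
    · simp only [torusBonds, Bool.false_eq_true, if_false, Prod.mk_add_mk, add_zero]
      have hlt := ZMod.val_lt (i - i₀)
      rcases Nat.lt_or_ge ((i - i₀).val + 1) N with h | h
      · have h1 : (i + 1 - i₀).val = (i - i₀).val + 1 := by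
          rw [show i + 1 - i₀ = i - i₀ + 1 by ring, ZMod.val_add, ZMod.val_one_eq_one_mod,
            Nat.add_mod_mod, Nat.mod_eq_of_lt h]
        simp only [V, h1, Finset.sum_range_succ, hval]
      · have h1 : (i - i₀).val + 1 = N := by omega
        have h2 : i + 1 - i₀ = 0 := by
          have : (((i - i₀).val + 1 : ℕ) : ZMod N) = 0 := by rw [h1, ZMod.natCast_self]
          push_cast at this
          rw [ZMod.natCast_zmod_val] at this
          linear_combination this
        have h3 := (congrArg (fun n => ∑ k ∈ Finset.range n, c ((i₀ + k, j), false)) h1).trans (hT j)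
        simp only [Finset.sum_range_succ, hval] at h3
        simp only [V, h2, ZMod.val_zero, Finset.range_zero, Finset.sum_empty]
        exact h3.symm
    · simp only [torusBonds, if_true, Prod.mk_add_mk, add_zero]
      exact hV2 i j
  · by_contra! h
    exact hr (Finset.sum_eq_zero fun k _ => h _)
  · by_contra! h
    refine hr ((ZMod.forall_iff_of_forall_add_one (P := fun j => V (r.1, j) = 0)
      (fun j => ?_) r.2 j₀).2 (Finset.sum_eq_zero fun k _ => hj _))
    rw [hV2, h, add_zero]

theorem sum_plaquette_ite (hN : 1 < N) (f : Torus N → ZMod 2) (t : Torus N) :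
    ∑ e ∈ plaquette t, (f e.1 + f ((torusBonds N).tgt e)) = 0 := by
  have : Fact (1 < N) := ⟨hN⟩
  obtain ⟨i, j⟩ := t
  rw [plaquette, Finset.sum_insert (by simp), Finset.sum_insert (by simp),
    Finset.sum_insert (by simp), Finset.sum_singleton]
  simp only [torusBonds, if_true, Bool.false_eq_true, if_false, Prod.mk_add_mk, add_zero]
  linear_combination CharTwo.add_self_eq_zero (f (i, j)) + CharTwo.add_self_eq_zero (f (i + 1, j)) +
    CharTwo.add_self_eq_zero (f (i + 1, j + 1)) + CharTwo.add_self_eq_zero (f (i, j + 1))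

theorem ite_mem_split_eq (U : Finset (Torus N)) (e : Torus N × Bool) :
    (if e ∈ (torusBonds N).split U then (1 : ZMod 2) else 0) =
      (if e.1 ∈ U then 1 else 0) + if (torusBonds N).tgt e ∈ U then 1 else 0 := by
  have : (torusBonds N).src e = e.1 := rfl
  by_cases h1 : e.1 ∈ U <;> by_cases h2 : (torusBonds N).tgt e ∈ U <;>
    simp [BondSystem.split, this, h1, h2, CharTwo.add_self_eq_zero]

theorem exists_forall_ne_of_card_lt {ι : Type*} (D : Finset ι) (f : ι → ZMod N) (hD : D.card < N) :
    ∃ i, ∀ e ∈ D, f e ≠ i := by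
  by_contra! h
  have h1 : (Finset.univ : Finset (ZMod N)) ⊆ D.image f := fun i _ =>
    let ⟨e, he, hi⟩ := h i
    Finset.mem_image.2 ⟨e, he, hi⟩
  have h2 := (Finset.card_le_card h1).trans Finset.card_image_le
  rw [Finset.card_univ, ZMod.card] at h2
  omega

theorem exists_potential_of_isComp (hN : 1 < N) {U : Finset (Torus N)} {D : Finset (Torus N × Bool)}
    (hD : IsComp plaqAdj ((torusBonds N).split U) D) (hcard : D.card < N) :
    ∃ V : Torus N → ZMod 2,
      (∀ e, V ((torusBonds N).tgt e) = V e.1 + if e ∈ D then 1 else 0) ∧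
      (Finset.univ.filter fun r => V r ≠ 0).card ≤ D.card ^ 2 := by
  have hc : ∀ t, ∑ e ∈ plaquette t, (if e ∈ D then (1 : ZMod 2) else 0) = 0 := by
    intro t
    by_cases h : ∃ a ∈ plaquette t, a ∈ D
    · obtain ⟨a, hat, haD⟩ := h
      refine (Finset.sum_congr rfl fun b hb => ?_).trans
        (sum_plaquette_ite hN (fun r => if r ∈ U then 1 else 0) t)
      rw [← ite_mem_split_eq]
      have : b ∈ D ↔ b ∈ (torusBonds N).split U :=
        ⟨fun h => hD.2.1 h, fun h => hD.2.2 a haD b h ⟨t, hat, hb⟩⟩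
      simp only [this]
    · push Not at h
      exact Finset.sum_eq_zero fun e he => if_neg (h e he)
  obtain ⟨i₀, hi⟩ := exists_forall_ne_of_card_lt D (fun e => e.1.1) hcard
  obtain ⟨j₀, hj⟩ := exists_forall_ne_of_card_lt D (fun e => e.1.2) hcard
  obtain ⟨V, hV, hs⟩ := exists_potential hc hN (i₀ := i₀) (j₀ := j₀)
    (fun j => if_neg fun h => hi _ h rfl) (fun i => if_neg fun h => hj _ h rfl)
  refine ⟨V, hV, ?_⟩
  have hsub : (Finset.univ.filter fun r => V r ≠ 0) ⊆
      (D.image fun e => e.1.1) ×ˢ (D.image fun e => e.1.2) := by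
    intro r hr
    obtain ⟨⟨i, h1⟩, j, h2⟩ := hs r (Finset.mem_filter.1 hr).2
    rw [Finset.mem_product]
    exact ⟨Finset.mem_image.2 ⟨_, (ite_ne_right_iff.1 h2).1, rfl⟩,
      Finset.mem_image.2 ⟨_, (ite_ne_right_iff.1 h1).1, rfl⟩⟩
  calc _ ≤ _ := Finset.card_le_card hsub
    _ ≤ D.card * D.card := by
      rw [Finset.card_product]
      exact Nat.mul_le_mul Finset.card_image_le Finset.card_image_le
    _ = _ := (sq _).symm

open Classical in
/-- A set or its complement is controlled by the components of its boundary. -/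
theorem card_le_sum_sq_or_card_compl_le (hN : 1 < N) (U : Finset (Torus N))
    (hsmall : ∀ D, IsComp plaqAdj ((torusBonds N).split U) D → D.card < N) :
    U.card ≤ ∑ D with IsComp plaqAdj ((torusBonds N).split U) D, D.card ^ 2 ∨
      Uᶜ.card ≤ ∑ D with IsComp plaqAdj ((torusBonds N).split U) D, D.card ^ 2 := by
  set Γ := (torusBonds N).split U with hΓ
  set 𝒞 : Finset (Finset (Torus N × Bool)) := Finset.univ.filter fun D => IsComp plaqAdj Γ D
  have hex : ∀ D ∈ 𝒞, ∃ V : Torus N → ZMod 2,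
      (∀ e, V ((torusBonds N).tgt e) = V e.1 + if e ∈ D then 1 else 0) ∧
      (Finset.univ.filter fun r => V r ≠ 0).card ≤ D.card ^ 2 := fun D hD =>
    exists_potential_of_isComp hN (Finset.mem_filter.1 hD).2 (hsmall D (Finset.mem_filter.1 hD).2)
  choose! V hV hcard using hex
  set supp : Finset (Torus N) := 𝒞.biUnion fun D => Finset.univ.filter fun r => V D r ≠ 0
  have hsupp : supp.card ≤ ∑ D ∈ 𝒞, D.card ^ 2 :=
    Finset.card_biUnion_le.trans (Finset.sum_le_sum hcard)
  have hsum : ∀ r, r ∉ supp → ∑ D ∈ 𝒞, V D r = 0 := fun r hr => Finset.sum_eq_zero fun D hD => by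
    by_contra h
    exact hr (Finset.mem_biUnion.2 ⟨D, hD, by simpa using h⟩)
  have hΓsum : ∀ e, ∑ D ∈ 𝒞, (if e ∈ D then (1 : ZMod 2) else 0) = if e ∈ Γ then 1 else 0 := by
    intro e
    by_cases he : e ∈ Γ
    · obtain ⟨D, hD, heD⟩ := exists_isComp_mem plaqAdj_symm he
      rw [Finset.sum_eq_single D, if_pos heD, if_pos he]
      · intro D' hD' hne
        exact if_neg fun h => hne ((Finset.mem_filter.1 hD').2.eq_of_mem hD h heD)
      · exact fun h => absurd (Finset.mem_filter.2 ⟨Finset.mem_univ _, hD⟩) h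
    · rw [if_neg he]
      exact Finset.sum_eq_zero fun D hD => if_neg fun h => he ((Finset.mem_filter.1 hD).2.2.1 h)
  set ψ : Torus N → ZMod 2 := fun r => (if r ∈ U then 1 else 0) + ∑ D ∈ 𝒞, V D r
  have hψ : ∀ e, ψ ((torusBonds N).tgt e) = ψ e.1 := by
    intro e
    have h1 : ∑ D ∈ 𝒞, V D ((torusBonds N).tgt e) =
        ∑ D ∈ 𝒞, V D e.1 + if e ∈ Γ then 1 else 0 := by
      rw [← hΓsum, ← Finset.sum_add_distrib]
      exact Finset.sum_congr rfl fun D hD => hV D hD e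
    simp only [ψ]
    rw [h1, hΓ, ite_mem_split_eq]
    linear_combination CharTwo.add_self_eq_zero
      (if (torusBonds N).tgt e ∈ U then (1 : ZMod 2) else 0)
  have hA := split_torusBonds_eq_empty (Finset.univ.filter fun r => ψ r = 0) (by
    refine Finset.filter_eq_empty_iff.2 fun e _ => ?_
    simp only [Finset.mem_filter, Finset.mem_univ, true_and, hψ, not_not]
    rfl)
  rcases hA with hA | hA
  · right
    refine (Finset.card_le_card fun r hr => ?_).trans hsupp
    by_contra hrs
    have h0 : ψ r ≠ 0 := by
      have := Finset.eq_empty_iff_forall_notMem.1 hA r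
      simpa using this
    simp only [ψ, hsum r hrs, if_neg (Finset.mem_compl.1 hr), add_zero] at h0
    exact h0 rfl
  · left
    refine (Finset.card_le_card fun r hr => ?_).trans hsupp
    by_contra hrs
    have h0 : ψ r = 0 := by
      have := Finset.mem_univ r
      rw [← hA] at this
      simpa using this
    simp only [ψ, hsum r hrs, if_pos hr, add_zero] at h0
    exact one_ne_zero h0

end Plaquette

section Contours

variable {N : ℕ} [NeZero N]

/-- The sites at which the observable `g` has modulus at most `a`. -/
noncomputable def smallSites (g : Real.Angle → ℝ) (a : ℝ) (φ : Cfg N) : Finset (Torus N) :=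
  Finset.univ.filter fun r => |g (φ r)| ≤ a

theorem mem_smallSites {g : Real.Angle → ℝ} {a : ℝ} {φ : Cfg N} {r : Torus N} :
    r ∈ smallSites g a φ ↔ |g (φ r)| ≤ a := by
  simp [smallSites]

theorem measurableSet_smallSites {g : Real.Angle → ℝ} (hg : Measurable g) (a : ℝ)
    (p : Finset (Torus N) → Prop) : MeasurableSet {φ : Cfg N | p (smallSites g a φ)} := by
  classical
  have h1 : ∀ A, MeasurableSet {φ : Cfg N | smallSites g a φ = A} := by
    intro A
    have : {φ : Cfg N | smallSites g a φ = A} = ⋂ r, {φ : Cfg N | |g (φ r)| ≤ a ↔ r ∈ A} := by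
      ext φ
      simp [Finset.ext_iff, mem_smallSites]
    rw [this]
    refine MeasurableSet.iInter fun r => ?_
    have h2 : MeasurableSet {φ : Cfg N | |g (φ r)| ≤ a} :=
      measurableSet_le (hg.comp (measurable_pi_apply r)).abs measurable_const
    by_cases hr : r ∈ A
    · simpa [hr] using h2
    · simp only [hr, iff_false]
      exact h2.compl
  have : {φ : Cfg N | p (smallSites g a φ)} =
      ⋃ A ∈ Finset.univ.filter p, {φ : Cfg N | smallSites g a φ = A} := by
    ext φ
    simp
  rw [this]
  exact Finset.measurableSet_biUnion _ fun A _ => h1 A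

theorem Real.Angle.half_le_abs_sub {a : ℝ} (ha : a ≤ 1 / 4) {α β : Real.Angle}
    (hα : |α.sin| ≤ a) (hβ : |β.cos| ≤ a) :
    1 / 2 ≤ |α.cos - β.cos| ∧ 1 / 2 ≤ |α.sin - β.sin| := by
  have key : ∀ x y : ℝ, |x| ≤ a → x ^ 2 + y ^ 2 = 1 → 3 / 4 ≤ |y| := by
    intro x y hx hxy
    refine abs_le_of_sq_le_sq' ?_ (abs_nonneg y) |>.2
    rw [sq_abs]
    have : |x| ^ 2 ≤ (1 / 4) ^ 2 := by
      have := abs_nonneg x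
      gcongr
      exact hx.trans ha
    rw [sq_abs] at this
    linarith
  have h1 := key _ _ hα (by rw [add_comm]; exact α.cos_sq_add_sin_sq)
  have h2 := key _ _ hβ β.cos_sq_add_sin_sq
  refine ⟨?_, ?_⟩
  · have := abs_sub_abs_le_abs_sub α.cos β.cos
    linarith
  · have := abs_sub_abs_le_abs_sub β.sin α.sin
    rw [abs_sub_comm] at this
    linarith

theorem half_le_abs_grad {a : ℝ} (ha : a ≤ 1 / 4) {e : Torus N × Bool} {φ : Cfg N}
    (h : (|(φ ((torusBonds N).src e)).sin| ≤ a ∧ |(φ ((torusBonds N).tgt e)).cos| ≤ a) ∨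
      (|(φ ((torusBonds N).src e)).cos| ≤ a ∧ |(φ ((torusBonds N).tgt e)).sin| ≤ a)) :
    1 / 2 ≤ |(torusBonds N).grad e φ| := by
  unfold BondSystem.grad
  rcases h with ⟨h1, h2⟩ | ⟨h1, h2⟩ <;> rcases torusBonds_obs_eq e with h | h <;> rw [h]
  · exact (Real.Angle.half_le_abs_sub ha h1 h2).1
  · exact (Real.Angle.half_le_abs_sub ha h1 h2).2
  · rw [abs_sub_comm]
    exact (Real.Angle.half_le_abs_sub ha h2 h1).1
  · rw [abs_sub_comm]
    exact (Real.Angle.half_le_abs_sub ha h2 h1).2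

/-- A bond across the boundary of a set of small sites is bad at an endpoint or has a large
gradient. -/
theorem bad_or_half_le_abs_grad {a : ℝ} (ha : a ≤ 1 / 4) {g : Real.Angle → ℝ}
    (hg : g = Real.Angle.sin ∨ g = Real.Angle.cos) {e : Torus N × Bool} {φ : Cfg N}
    (he : e ∈ (torusBonds N).split (smallSites g a φ)) :
    φ ((torusBonds N).src e) ∈ badAngle a ∨ φ ((torusBonds N).tgt e) ∈ badAngle a ∨
      1 / 2 ≤ |(torusBonds N).grad e φ| := by
  by_contra! h
  obtain ⟨h1, h2, h3⟩ := h
  refine h3.not_ge (half_le_abs_grad ha ?_)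
  simp only [badAngle, Set.mem_ofPred_eq, not_and_or, not_lt] at h1 h2
  simp only [BondSystem.split, Finset.mem_filter, Finset.mem_univ, true_and, mem_smallSites] at he
  rcases hg with rfl | rfl <;> tauto

theorem card_le_two_mul_card_image_src (Γ : Finset (Torus N × Bool)) :
    Γ.card ≤ 2 * (Γ.image (torusBonds N).src).card := by
  calc Γ.card ≤ (Γ.image (torusBonds N).src ×ˢ (Finset.univ : Finset Bool)).card :=
        Finset.card_le_card fun e he => Finset.mem_product.2
          ⟨Finset.mem_image_of_mem (torusBonds N).src he, Finset.mem_univ _⟩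
    _ = _ := by simp [Finset.card_product, mul_comm]

theorem card_le_two_mul_card_image_tgt (Γ : Finset (Torus N × Bool)) :
    Γ.card ≤ 2 * (Γ.image (torusBonds N).tgt).card := by
  have hinj : Function.Injective fun e : Torus N × Bool => ((torusBonds N).tgt e, e.2) := by
    rintro ⟨r, b⟩ ⟨r', b'⟩ h
    obtain ⟨h1, rfl⟩ := Prod.mk.injEq .. ▸ h
    cases b <;> simpa [torusBonds] using h1
  calc Γ.card = (Γ.image fun e => ((torusBonds N).tgt e, e.2)).card :=
        (Finset.card_image_of_injective _ hinj).symm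
    _ ≤ (Γ.image (torusBonds N).tgt ×ˢ (Finset.univ : Finset Bool)).card := by
        refine Finset.card_le_card fun x hx => ?_
        obtain ⟨e, he, rfl⟩ := Finset.mem_image.1 hx
        exact Finset.mem_product.2 ⟨Finset.mem_image_of_mem _ he, Finset.mem_univ _⟩
    _ = _ := by simp [Finset.card_product, mul_comm]

/-- Boundary bonds of a set of small sites are sparse. -/
theorem real_subset_split_le {ν : Measure (Cfg N)} [IsProbabilityMeasure ν] {a s p : ℝ}
    (ha : a ≤ 1 / 4) (hs : 0 ≤ s) (hs1 : s ≤ 1) (hp : 0 ≤ p) (hps : p ≤ s)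
    (hν : ∀ (A : Finset (Torus N)) (B : Finset (Torus N × Bool)),
      ν.real {φ | (∀ r ∈ A, φ r ∈ badAngle a) ∧ ∀ e ∈ B, 1 / 2 ≤ |(torusBonds N).grad e φ|} ≤
        (s ^ 4) ^ A.card * p ^ B.card)
    {g : Real.Angle → ℝ} (hg : g = Real.Angle.sin ∨ g = Real.Angle.cos)
    (Γ : Finset (Torus N × Bool)) :
    ν.real {φ | Γ ⊆ (torusBonds N).split (smallSites g a φ)} ≤ (4 * s) ^ Γ.card := by
  classical
  set S := torusBonds N
  set ev : Finset (Torus N × Bool) × Finset (Torus N × Bool) → Set (Cfg N) := fun x =>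
    {φ | (∀ r ∈ x.1.image S.src ∪ x.2.image S.tgt, φ r ∈ badAngle a) ∧
      ∀ e ∈ Γ \ (x.1 ∪ x.2), 1 / 2 ≤ |S.grad e φ|}
  have hsub : {φ | Γ ⊆ S.split (smallSites g a φ)} ⊆ ⋃ x ∈ Γ.powerset ×ˢ Γ.powerset, ev x := by
    intro φ hφ
    refine Set.mem_iUnion₂.2 ⟨(Γ.filter fun e => φ (S.src e) ∈ badAngle a,
      Γ.filter fun e => φ (S.tgt e) ∈ badAngle a),
      Finset.mem_product.2 ⟨Finset.mem_powerset.2 (Finset.filter_subset _ _),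
        Finset.mem_powerset.2 (Finset.filter_subset _ _)⟩, fun r hr => ?_, fun e he => ?_⟩
    · rcases Finset.mem_union.1 hr with h | h <;> obtain ⟨e, he, rfl⟩ := Finset.mem_image.1 h
      · exact (Finset.mem_filter.1 he).2
      · exact (Finset.mem_filter.1 he).2
    · obtain ⟨he1, he2⟩ := Finset.mem_sdiff.1 he
      simp only [Finset.mem_union, Finset.mem_filter, he1, true_and, not_or] at he2
      have := bad_or_half_le_abs_grad ha hg (hφ he1)
      tauto
  have hev : ∀ x ∈ Γ.powerset ×ˢ Γ.powerset, ν.real (ev x) ≤ s ^ Γ.card := by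
    rintro ⟨Γ₁, Γ₂⟩ hx
    simp only [Finset.mem_product, Finset.mem_powerset] at hx
    refine (hν _ _).trans ?_
    have h1 : Γ₁.card ≤ 2 * (Γ₁.image S.src).card := card_le_two_mul_card_image_src Γ₁
    have h2 : Γ₂.card ≤ 2 * (Γ₂.image S.tgt).card := card_le_two_mul_card_image_tgt Γ₂
    have h3 := Finset.card_le_card
      (Finset.subset_union_left (s₁ := Γ₁.image S.src) (s₂ := Γ₂.image S.tgt))
    have h4 := Finset.card_le_card
      (Finset.subset_union_right (s₁ := Γ₁.image S.src) (s₂ := Γ₂.image S.tgt))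
    have h5 := Finset.card_union_le Γ₁ Γ₂
    have h6 := Finset.card_sdiff_add_card_eq_card (Finset.union_subset hx.1 hx.2)
    calc _ ≤ (s ^ 4) ^ (Γ₁.image S.src ∪ Γ₂.image S.tgt).card * s ^ (Γ \ (Γ₁ ∪ Γ₂)).card := by
          gcongr
      _ = s ^ (4 * (Γ₁.image S.src ∪ Γ₂.image S.tgt).card + (Γ \ (Γ₁ ∪ Γ₂)).card) := by
          rw [pow_add, pow_mul]
      _ ≤ s ^ Γ.card := pow_le_pow_of_le_one hs hs1 (by omega)
  calc _ ≤ ν.real (⋃ x ∈ Γ.powerset ×ˢ Γ.powerset, ev x) := measureReal_mono hsub (measure_ne_top _ _)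
    _ ≤ ∑ x ∈ Γ.powerset ×ˢ Γ.powerset, ν.real (ev x) := measureReal_biUnion_finset_le _ _
    _ ≤ ∑ x ∈ Γ.powerset ×ˢ Γ.powerset, s ^ Γ.card := Finset.sum_le_sum hev
    _ = (4 * s) ^ Γ.card := by
        rw [Finset.sum_const, Finset.card_product, Finset.card_powerset, nsmul_eq_mul, mul_pow]
        push_cast
        rw [← mul_pow]
        norm_num

/-- With high probability the small sites either fill the torus up to a small fraction or have
a small density. -/
theorem real_le_card_smallSites_le {ν : Measure (Cfg N)} [IsProbabilityMeasure ν] {a y : ℝ}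
    {g : Real.Angle → ℝ} (hg : Measurable g) (hy : 0 ≤ y) (hy1 : y ≤ 1 / 4)
    (hsparse : ∀ Γ : Finset (Torus N × Bool),
      ν.real {φ | Γ ⊆ (torusBonds N).split (smallSites g a φ)} ≤ (1 / 2 ^ 9 * y) ^ Γ.card)
    {l : ℕ} (hl : 0 < l) (hlN : l < N) (K : ℝ) :
    ν.real {φ | K ≤ (smallSites g a φ).card ∧ K ≤ ((smallSites g a φ)ᶜ : Finset _).card} ≤
      2 * N ^ 2 * y ^ l + Real.exp ((2 * N ^ 2 * y - K / 2) / l ^ 2) := by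
  classical
  set S := torusBonds N
  set W : Finset (Torus N × Bool) → ℝ := fun ω => ν.real {φ | S.split (smallSites g a φ) = ω}
  have hW : ∀ (Q : Finset (Torus N × Bool) → Prop) [DecidablePred Q],
      ∑ ω with Q ω, W ω = ν.real {φ | Q (S.split (smallSites g a φ))} := by
    intro Q _
    rw [← measureReal_biUnion_finset]
    · congr 1
      ext φ
      simp
    · intro ω _ ω' _ hne
      exact Set.disjoint_left.2 fun φ h h' => hne (h.symm.trans h')
    · exact fun ω _ => measurableSet_smallSites hg a fun A => S.split A = ω
  have hE : (Fintype.card (Torus N × Bool) : ℝ) = 2 * N ^ 2 := by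
    simp [Fintype.card_prod, ZMod.card]
    ring
  have h1 := sum_exists_large_comp_le (mem_plaqNb (N := N)) card_plaqNb_le W
    (fun ω => measureReal_nonneg) hy (by linarith) (fun Γ => by simpa only [hW] using hsparse Γ) l
  have h2 := sum_large_sq_comp_le (mem_plaqNb (N := N)) card_plaqNb_le W
    (fun ω => measureReal_nonneg) hy hy1 (fun Γ => by simpa only [hW] using hsparse Γ) hl K
  rw [hW, hE] at h1 h2
  refine (measureReal_mono ?_).trans ((measureReal_union_le _ _).trans (add_le_add h1 h2))
  intro φ hφ
  by_cases hD : ∃ D, IsComp plaqAdj (S.split (smallSites g a φ)) D ∧ l < D.card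
  · exact Or.inl hD
  · push Not at hD
    refine Or.inr ⟨hD, ?_⟩
    rcases card_le_sum_sq_or_card_compl_le (by omega) (smallSites g a φ)
      (fun D hD' => (hD D hD').trans_lt hlN) with h | h
    · exact hφ.1.trans (by exact_mod_cast h)
    · exact hφ.2.trans (by exact_mod_cast h)

end Contours

section Assembly

variable {N : ℕ} [NeZero N]

/-- It is unlikely that at least half of the sites are bad. -/
theorem real_half_le_card_bad_le {ν : Measure (Cfg N)} [IsProbabilityMeasure ν] {a s : ℝ}
    (hs : 0 ≤ s) (hs1 : s ≤ 1 / 2)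
    (hν : ∀ A : Finset (Torus N), ν.real {φ | ∀ r ∈ A, φ r ∈ badAngle a} ≤ (s ^ 4) ^ A.card) :
    ν.real {φ | ∃ A : Finset (Torus N), N ^ 2 ≤ 2 * A.card ∧ ∀ r ∈ A, φ r ∈ badAngle a} ≤
      (1 / 2) ^ N := by
  have hcard : Fintype.card (Torus N) = N ^ 2 := by rw [Fintype.card_prod, ZMod.card, sq]
  have hsub : {φ : Cfg N | ∃ A : Finset (Torus N), N ^ 2 ≤ 2 * A.card ∧
      ∀ r ∈ A, φ r ∈ badAngle a} ⊆
      ⋃ A ∈ Finset.univ.filter fun A : Finset (Torus N) => N ^ 2 ≤ 2 * A.card,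
        {φ | ∀ r ∈ A, φ r ∈ badAngle a} := by
    rintro φ ⟨A, h1, h2⟩
    exact Set.mem_iUnion₂.2 ⟨A, by simpa using h1, h2⟩
  calc _ ≤ _ := measureReal_mono hsub (measure_ne_top _ _)
    _ ≤ ∑ A : Finset (Torus N) with N ^ 2 ≤ 2 * A.card,
        ν.real {φ | ∀ r ∈ A, φ r ∈ badAngle a} := measureReal_biUnion_finset_le _ _
    _ ≤ ∑ A : Finset (Torus N) with N ^ 2 ≤ 2 * A.card, (s ^ 2) ^ N ^ 2 := by
        refine Finset.sum_le_sum fun A hA => (hν A).trans ?_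
        rw [← pow_mul, ← pow_mul]
        have := (Finset.mem_filter.1 hA).2
        exact pow_le_pow_of_le_one hs (by linarith) (by omega)
    _ ≤ ∑ A : Finset (Torus N), (s ^ 2) ^ N ^ 2 :=
        Finset.sum_le_sum_of_subset_of_nonneg (Finset.filter_subset _ _) fun _ _ _ => by positivity
    _ = (2 * s ^ 2) ^ N ^ 2 := by
        rw [Finset.sum_const, Finset.card_univ, Fintype.card_finset, hcard, nsmul_eq_mul, mul_pow]
        push_cast
        rfl
    _ ≤ (1 / 2) ^ N ^ 2 := by
        gcongr
        nlinarith
    _ ≤ (1 / 2) ^ N := pow_le_pow_of_le_one (by norm_num) (by norm_num)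
        (Nat.le_self_pow two_ne_zero N)

theorem mul_one_sub_le_sum_sq {δ : ℝ} (hδ : 0 ≤ δ) {g h : Real.Angle → ℝ}
    (hgh : ∀ φ, g φ ^ 2 + h φ ^ 2 = 1) {φ : Cfg N}
    (hU : ((smallSites g (√(δ / 2)) φ)ᶜ.card : ℝ) ≤ δ / 2 * N ^ 2) :
    (N : ℝ) ^ 2 * (1 - δ) ≤ ∑ r, h (φ r) ^ 2 := by
  set U := smallSites g (√(δ / 2)) φ
  have hcard : (U.card : ℝ) + (Uᶜ.card : ℝ) = N ^ 2 := by
    rw [← Nat.cast_add, Finset.card_add_card_compl, Fintype.card_prod, ZMod.card]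
    push_cast
    ring
  have h1 : ∀ r ∈ U, 1 - δ / 2 ≤ h (φ r) ^ 2 := by
    intro r hr
    have h2 := (Real.le_sqrt (abs_nonneg _) (by linarith)).1 (mem_smallSites.1 hr)
    rw [sq_abs] at h2
    linarith [hgh (φ r)]
  calc (N : ℝ) ^ 2 * (1 - δ) ≤ U.card * (1 - δ / 2) := by nlinarith [sq_nonneg (N : ℝ)]
    _ = ∑ r ∈ U, (1 - δ / 2) := by rw [Finset.sum_const, nsmul_eq_mul]
    _ ≤ ∑ r ∈ U, h (φ r) ^ 2 := Finset.sum_le_sum h1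
    _ ≤ _ := Finset.sum_le_sum_of_subset_of_nonneg (Finset.subset_univ _) fun _ _ _ => sq_nonneg _

/-- With high probability the spins are aligned with one of the axes. -/
theorem one_sub_le_real_aligned {ν : Measure (Cfg N)} [IsProbabilityMeasure ν] {δ p : ℝ}
    (hN : 1 < N) (hδ : 0 < δ) (hδ1 : δ ≤ 1 / 8) (hp : 0 ≤ p) (hps : p ≤ δ / 2 ^ 15)
    (hν : ∀ (A : Finset (Torus N)) (B : Finset (Torus N × Bool)),
      ν.real {φ | (∀ r ∈ A, φ r ∈ badAngle √(δ / 2)) ∧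
        ∀ e ∈ B, 1 / 2 ≤ |(torusBonds N).grad e φ|} ≤ ((δ / 2 ^ 15) ^ 4) ^ A.card * p ^ B.card) :
    1 - (2 * (2 * N ^ 2 * (δ / 16) ^ N.sqrt + Real.exp (-(δ / 8 * N))) + (1 / 2) ^ N) ≤
      ν.real ({φ | (N : ℝ) ^ 2 * (1 - δ) ≤ ∑ r, (φ r).cos ^ 2} ∪
        {φ | (N : ℝ) ^ 2 * (1 - δ) ≤ ∑ r, (φ r).sin ^ 2}) := by
  set a := √(δ / 2)
  have ha : a ≤ 1 / 4 := Real.sqrt_le_iff.2 ⟨by norm_num, by linarith⟩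
  set l := N.sqrt
  have hl : 0 < l := Nat.sqrt_pos.2 (by omega)
  have hlN : l < N := Nat.sqrt_lt_self hN
  set K : ℝ := δ / 2 * N ^ 2
  have hexp : Real.exp ((2 * N ^ 2 * (δ / 16) - K / 2) / l ^ 2) ≤ Real.exp (-(δ / 8 * N)) := by
    rw [Real.exp_le_exp, div_le_iff₀ (by positivity)]
    have h1 : (l : ℝ) ^ 2 ≤ N := by exact_mod_cast Nat.sqrt_le' N
    have h2 : (N : ℝ) * l ^ 2 ≤ N * N := by gcongr
    simp only [K]
    nlinarith
  have hmix : ∀ g : Real.Angle → ℝ, g = Real.Angle.sin ∨ g = Real.Angle.cos →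
      ν.real {φ | K ≤ (smallSites g a φ).card ∧ K ≤ ((smallSites g a φ)ᶜ : Finset _).card} ≤
        2 * N ^ 2 * (δ / 16) ^ l + Real.exp (-(δ / 8 * N)) := by
    intro g hg
    have hgm : Measurable g := by
      rcases hg with rfl | rfl
      · exact Real.Angle.continuous_sin.measurable
      · exact Real.Angle.continuous_cos.measurable
    refine (real_le_card_smallSites_le hgm (y := δ / 16) (by positivity) (by linarith)
      (fun Γ => ?_) hl hlN K).trans (by gcongr)
    refine (real_subset_split_le ha (s := δ / 2 ^ 15) (by positivity) (by linarith) hp hps hν hg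
      Γ).trans_eq ?_
    congr 1
    ring
  have hbad := real_half_le_card_bad_le (ν := ν) (a := a) (s := δ / 2 ^ 15) (by positivity)
    (by linarith) fun A => by simpa using hν A ∅
  set G := {φ : Cfg N | (N : ℝ) ^ 2 * (1 - δ) ≤ ∑ r, (φ r).cos ^ 2} ∪
    {φ | (N : ℝ) ^ 2 * (1 - δ) ≤ ∑ r, (φ r).sin ^ 2}
  set B₁ := {φ : Cfg N | K ≤ (smallSites Real.Angle.sin a φ).card ∧
    K ≤ ((smallSites Real.Angle.sin a φ)ᶜ : Finset _).card}
  set B₂ := {φ : Cfg N | K ≤ (smallSites Real.Angle.cos a φ).card ∧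
    K ≤ ((smallSites Real.Angle.cos a φ)ᶜ : Finset _).card}
  set B₃ := {φ : Cfg N | ∃ A : Finset (Torus N), N ^ 2 ≤ 2 * A.card ∧ ∀ r ∈ A, φ r ∈ badAngle a}
  have hcover : Set.univ ⊆ G ∪ (B₁ ∪ B₂ ∪ B₃) := by
    intro φ _
    by_contra h
    simp only [G, Set.mem_union, not_or] at h
    obtain ⟨⟨hG1, hG2⟩, ⟨h1, h2⟩, h3⟩ := h
    have hX : K < ((smallSites Real.Angle.sin a φ)ᶜ : Finset _).card := by
      by_contra! h
      exact hG1 (mul_one_sub_le_sum_sq hδ.le (fun φ => by rw [add_comm]; exact φ.cos_sq_add_sin_sq) h)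
    have hZ : K < ((smallSites Real.Angle.cos a φ)ᶜ : Finset _).card := by
      by_contra! h
      exact hG2 (mul_one_sub_le_sum_sq hδ.le (fun φ => φ.cos_sq_add_sin_sq) h)
    have hX' : ((smallSites Real.Angle.sin a φ).card : ℝ) < K := by
      by_contra! h
      exact h1 ⟨h, hX.le⟩
    have hZ' : ((smallSites Real.Angle.cos a φ).card : ℝ) < K := by
      by_contra! h
      exact h2 ⟨h, hZ.le⟩
    set U := smallSites Real.Angle.sin a φ ∪ smallSites Real.Angle.cos a φ
    refine h3 ⟨Uᶜ, ?_, fun r hr => ?_⟩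
    · have h4 : (U.card : ℝ) + (Uᶜ.card : ℝ) = N ^ 2 := by
        rw [← Nat.cast_add, Finset.card_add_card_compl, Fintype.card_prod, ZMod.card]
        push_cast
        ring
      have h5 : (U.card : ℝ) ≤ (smallSites Real.Angle.sin a φ).card +
          (smallSites Real.Angle.cos a φ).card := by
        exact_mod_cast Finset.card_union_le _ _
      have h6 : (N : ℝ) ^ 2 ≤ 2 * (Uᶜ.card : ℝ) := by
        have : K ≤ N ^ 2 / 4 := by
          simp only [K]
          nlinarith [sq_nonneg (N : ℝ)]
        linarith
      exact_mod_cast h6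
    · simp only [U, Finset.mem_compl, Finset.mem_union, mem_smallSites, not_or, not_le] at hr
      exact hr
  have htot : 1 ≤ ν.real G + (ν.real B₁ + ν.real B₂ + ν.real B₃) := by
    calc (1 : ℝ) = ν.real Set.univ := probReal_univ.symm
      _ ≤ ν.real (G ∪ (B₁ ∪ B₂ ∪ B₃)) := measureReal_mono hcover (measure_ne_top _ _)
      _ ≤ _ := (measureReal_union_le _ _).trans (by
        gcongr
        exact (measureReal_union_le _ _).trans (by gcongr; exact measureReal_union_le _ _))
  have hB₁ : ν.real B₁ ≤ _ := hmix _ (Or.inl rfl)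
  have hB₂ : ν.real B₂ ≤ _ := hmix _ (Or.inr rfl)
  have hB₃ : ν.real B₃ ≤ _ := hbad
  linarith

/-- The symmetry exchanging the two spin components. -/
noncomputable def exchange (φ : Cfg N) : Cfg N :=
  fun r => ((Real.pi / 2 : ℝ) : Real.Angle) - φ (r + (1, 1))

theorem measurePreserving_exchange :
    MeasurePreserving (exchange (N := N)) (Measure.pi fun _ => angleProb)
      (Measure.pi fun _ => angleProb) := by
  have h1 := measurePreserving_piCongrLeft (α := fun _ : Torus N => Real.Angle)
    (fun _ => angleProb) (Equiv.addRight ((1, 1) : Torus N)).symm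
  have h2 : MeasurePreserving (fun φ => ((Real.pi / 2 : ℝ) : Real.Angle) - φ) angleProb angleProb :=
    Measure.measurePreserving_sub_left (AddCircle.haarAddCircle : Measure (AddCircle (2 * Real.pi))) _
  have h3 := measurePreserving_pi (fun _ : Torus N => angleProb) (fun _ => angleProb) fun _ => h2
  convert h3.comp h1 using 1
  funext φ r
  have := Equiv.piCongrLeft_apply_apply (fun _ : Torus N => Real.Angle)
    (Equiv.addRight ((1, 1) : Torus N)).symm φ (r + (1, 1))
  rw [(Equiv.symm_apply_eq _).2 (Equiv.coe_addRight ((1, 1) : Torus N) ▸ rfl :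
    r + (1, 1) = Equiv.addRight ((1, 1) : Torus N) r)] at this
  simp only [exchange, Function.comp_apply, MeasurableEquiv.coe_piCongrLeft]
  rw [← this]

theorem grad_exchange (hN : Even N) (e : Torus N × Bool) (φ : Cfg N) :
    (torusBonds N).grad e (exchange φ) = (torusBonds N).grad (e.1 + (1, 1), e.2) φ := by
  have hobs : ∀ θ : Real.Angle, (torusBonds N).obs e (((Real.pi / 2 : ℝ) : Real.Angle) - θ) =
      (torusBonds N).obs (e.1 + (1, 1), e.2) θ := by
    intro θ
    obtain ⟨⟨i, j⟩, _ | _⟩ := e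
    · by_cases h : Even i.val <;>
        simp [torusBonds, not_even_val_add_one hN, h, Real.Angle.cos_pi_div_two_sub,
          Real.Angle.sin_pi_div_two_sub]
    · by_cases h : Even j.val <;>
        simp [torusBonds, not_even_val_add_one hN, h, Real.Angle.cos_pi_div_two_sub,
          Real.Angle.sin_pi_div_two_sub]
  have htgt : (torusBonds N).tgt e + (1, 1) = (torusBonds N).tgt (e.1 + (1, 1), e.2) := by
    simp only [torusBonds]
    split_ifs <;> abel
  simp only [BondSystem.grad, exchange, hobs, htgt]
  rfl

theorem hamA_exchange (hN : Even N) (J : ℝ) (φ : Cfg N) :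
    hamA N J J (exchange φ) = hamA N J J φ := by
  have h : -hamA N J J (exchange φ) = -hamA N J J φ := by
    rw [neg_hamA_eq hN, neg_hamA_eq hN]
    simp only [grad_exchange hN]
    congr 2
    exact Equiv.sum_comp ((Equiv.addRight ((1, 1) : Torus N)).prodCongr (Equiv.refl Bool))
      fun e => (torusBonds N).grad e φ ^ 2
  exact neg_injective h

theorem measurable_hamA (hN : Even N) (J : ℝ) : Measurable (hamA N J J) := by
  have h : hamA N J J = fun φ =>
      -(J * (N : ℝ) ^ 2 - J / 2 * ∑ e, ((torusBonds N).grad e φ) ^ 2) := by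
    funext φ
    rw [← neg_hamA_eq hN, neg_neg]
  rw [h]
  exact ((Finset.measurable_sum _ fun e _ => ((torusBonds N).measurable_grad
    measurable_torusBonds_obs e).pow_const 2).const_mul (J / 2)).const_sub _ |>.neg

/-- The Gibbs measure is invariant under exchange of the spin components. -/
theorem gibbs_preimage_exchange (hN : Even N) (β J : ℝ) {s : Set (Cfg N)} (hs : MeasurableSet s) :
    gibbs N β J J (exchange ⁻¹' s) = gibbs N β J J s := by
  obtain ⟨c, -, -, hc⟩ := exists_apriori_eq_smul N
  have hm : Measurable fun φ : Cfg N => ENNReal.ofReal (Real.exp (-β * hamA N J J φ)) :=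
    ((measurable_hamA hN J).const_mul (-β)).exp.ennreal_ofReal
  have hT := measurePreserving_exchange (N := N)
  rw [gibbs, Measure.smul_apply, Measure.smul_apply, withDensity_apply _ hs,
    withDensity_apply _ (hT.measurable hs), hc, setLIntegral_smul_measure,
    setLIntegral_smul_measure, ← hT.setLIntegral_comp_preimage hs hm]
  simp only [hamA_exchange hN]

theorem measurableSet_le_sum_sq {g : Real.Angle → ℝ} (hg : Measurable g) (K : ℝ) :
    MeasurableSet {φ : Cfg N | K ≤ ∑ r, g (φ r) ^ 2} :=
  measurableSet_le measurable_const
    (Finset.measurable_sum _ fun r _ => (hg.comp (measurable_pi_apply r)).pow_const 2)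

theorem gibbs_cos_eq_gibbs_sin (hN : Even N) (β J K : ℝ) :
    gibbs N β J J {φ | K ≤ ∑ r, (φ r).cos ^ 2} = gibbs N β J J {φ | K ≤ ∑ r, (φ r).sin ^ 2} := by
  rw [← gibbs_preimage_exchange hN β J
    (measurableSet_le_sum_sq Real.Angle.continuous_sin.measurable K)]
  congr 1
  ext φ
  simp only [Set.mem_ofPred_eq, Set.mem_preimage, exchange, Real.Angle.sin_pi_div_two_sub]
  rw [← Equiv.sum_comp (Equiv.addRight ((1, 1) : Torus N))]
  rfl

theorem tendsto_error {δ : ℝ} (hδ : 0 < δ) (hδ1 : δ ≤ 1 / 8) :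
    Filter.Tendsto (fun N : ℕ => 2 * (2 * (N : ℝ) ^ 2 * (δ / 16) ^ N.sqrt +
      Real.exp (-(δ / 8 * N))) + (1 / 2) ^ N) Filter.atTop (nhds 0) := by
  have hsqrt : Filter.Tendsto Nat.sqrt Filter.atTop Filter.atTop :=
    Filter.tendsto_atTop_atTop.2 fun b => ⟨b * b, fun n hn => Nat.le_sqrt.2 hn⟩
  have h1 : Filter.Tendsto (fun N : ℕ => 9 * ((N.sqrt : ℝ) ^ 4 * (δ / 16) ^ N.sqrt)) Filter.atTop
      (nhds 0) := by
    simpa using ((tendsto_pow_const_mul_const_pow_of_abs_lt_one 4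
      (r := δ / 16) (by rw [abs_of_pos (by positivity)]; linarith)).comp hsqrt).const_mul 9
  have h2 : Filter.Tendsto (fun N : ℕ => (N : ℝ) ^ 2 * (δ / 16) ^ N.sqrt) Filter.atTop
      (nhds 0) := by
    refine squeeze_zero (fun N => by positivity) (fun N => ?_) h1
    rw [← mul_assoc]
    gcongr
    have h3 : N ≤ 3 * N.sqrt ^ 2 := by
      have := Nat.sqrt_le_add N
      nlinarith [Nat.le_self_pow two_ne_zero N.sqrt]
    have h4 : N ^ 2 ≤ 9 * N.sqrt ^ 4 := by
      calc N ^ 2 ≤ (3 * N.sqrt ^ 2) ^ 2 := by gcongr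
        _ = _ := by ring
    exact_mod_cast h4
  have h3 : Filter.Tendsto (fun N : ℕ => Real.exp (-(δ / 8 * N))) Filter.atTop (nhds 0) :=
    Real.tendsto_exp_neg_atTop_nhds_zero.comp
      (tendsto_natCast_atTop_atTop.const_mul_atTop (by positivity))
  have h4 : Filter.Tendsto (fun N : ℕ => (1 / 2 : ℝ) ^ N) Filter.atTop (nhds 0) :=
    tendsto_pow_atTop_nhds_zero_of_lt_one (by norm_num) (by norm_num)
  simpa [mul_assoc] using (((h2.const_mul 2).add h3).const_mul 2).add h4

end Assembly

/-- Orientational long-range order on the torus: at the symmetric point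
`J₁ = J₂ = J > 0` and low temperatures, with probability close to `1/2` nearly all
spins align with either of the two lattice axes. -/
theorem orientational_long_range_order (J : ℝ) (hJ : 0 < J) (δ : ℝ) (hδ : 0 < δ) :
    ∃ β₀ : ℝ, ∃ ε : ℕ → ℝ, Filter.Tendsto ε Filter.atTop (nhds 0) ∧
      ∀ β : ℝ, β₀ ≤ β → ∃ N₁ : ℕ,
        ∀ (N : ℕ) [NeZero N], Even N → N₁ ≤ N →
          ENNReal.ofReal (1 / 2 - ε N) ≤
            gibbs N β J J
              {φ : Cfg N | (N : ℝ) ^ 2 * (1 - δ) ≤ ∑ r : Torus N, Real.Angle.cos (φ r) ^ 2} ∧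
          ENNReal.ofReal (1 / 2 - ε N) ≤
            gibbs N β J J
              {φ : Cfg N | (N : ℝ) ^ 2 * (1 - δ) ≤ ∑ r : Torus N, Real.Angle.sin (φ r) ^ 2} := by
  set δ' := min δ (1 / 8)
  have hδ' : 0 < δ' := lt_min hδ (by norm_num)
  have hδ1 : δ' ≤ 1 / 8 := min_le_right _ _
  set s := δ' / 2 ^ 15
  have hs : 0 < s := by positivity
  obtain ⟨lam₀, hlam₀, hpat⟩ := exists_patZ_univ_le_pow_mul (a := √(δ' / 2)) (q := s ^ 4)
    (by positivity) (by positivity)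
  refine ⟨2 * max lam₀ (-8 * Real.log (s / √2)) / J, _,
    ((tendsto_error hδ' hδ1).div_const 2).mono_right (by simp), fun β hβ => ⟨32, fun N _ hN hN1 => ?_⟩⟩
  have hlam : max lam₀ (-8 * Real.log (s / √2)) ≤ β * J / 2 := by
    rw [div_le_iff₀ hJ] at hβ
    linarith
  obtain ⟨h1, h2⟩ := max_le_iff.1 hlam
  have hβJ : 0 < β * J / 2 := hlam₀.trans_le h1
  have hps : √2 * Real.exp (-(β * J / 2) / 8) ≤ s := by
    rw [mul_comm, ← le_div_iff₀ (by positivity), ← Real.le_log_iff_exp_le (by positivity)]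
    linarith
  have hprob := isProbabilityMeasure_gibbs hN hβJ
  have hmain := one_sub_le_real_aligned (ν := gibbs N β J J) (by omega) hδ' hδ1 (by positivity) hps
    (gibbs_real_le hN hβJ (by positivity) (hpat _ h1 N hN hN1))
  have hsum := hmain.trans (measureReal_union_le _ _)
  simp only [measureReal_def] at hsum
  rw [gibbs_cos_eq_gibbs_sin hN, ← two_mul] at hsum
  have hfinal : ENNReal.ofReal (1 / 2 - (2 * (2 * (N : ℝ) ^ 2 * (δ' / 16) ^ N.sqrt +
      Real.exp (-(δ' / 8 * N))) + (1 / 2) ^ N) / 2) ≤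
      gibbs N β J J {φ : Cfg N | (N : ℝ) ^ 2 * (1 - δ') ≤ ∑ r, (φ r).sin ^ 2} :=
    ENNReal.ofReal_le_of_le_toReal (by linarith)
  have hmono : (N : ℝ) ^ 2 * (1 - δ) ≤ (N : ℝ) ^ 2 * (1 - δ') := by
    gcongr
    exact min_le_left _ _
  refine ⟨?_, hfinal.trans (measure_mono fun φ hφ => hmono.trans hφ)⟩
  rw [← gibbs_cos_eq_gibbs_sin hN] at hfinal
  exact hfinal.trans (measure_mono fun φ hφ => hmono.trans hφ)
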